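/- Let λ ≥ 1 be an integer, let G be a λ-connected finite simple graph with minimum degree δ, and let C be a longest cycle in G. If c̄ ≥ min{λ − 1, δ − λ + 1}, where c̄ is the length of a longest cycle in the subgraph of G induced by the vertices not on C, then |C| ≥ λ(δ − λ + 2). -/

import Mathlib

open SimpleGraph

/-- A cycle `C` is a longest cycle in `G` if no cycle of `G` has greater length. -/
def IsLongestCycle {V : Type*} (G : SimpleGraph V) {v : V} (C : G.Walk v v) : Prop :=
  C.IsCycle ∧ ∀ (u : V) (D : G.Walk u u), D.IsCycle → D.length ≤ C.length

open scoped Classical in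
/-- The length of a longest path in `H`, with the convention that it is `-1`
when `H` has no vertices. -/
noncomputable def pbar {W : Type*} (H : SimpleGraph W) : ℤ :=
  if Nonempty W then
    ((sSup {n : ℕ | ∃ (u v : W) (p : H.Walk u v), p.IsPath ∧ p.length = n} : ℕ) : ℤ)
  else -1

/-- The length of a longest cycle in `H`, where a single vertex counts as a cycle of
length 1 and a single edge as a cycle of length 2, with the convention that it is `0`
when `H` has no vertices. -/
noncomputable def cbar {W : Type*} (H : SimpleGraph W) : ℕ :=
  sSup {n : ℕ | (n = 1 ∧ Nonempty W) ∨ (n = 2 ∧ ∃ u v : W, H.Adj u v) ∨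
    ∃ (v : W) (c : H.Walk v v), c.IsCycle ∧ c.length = n}

/-- `G` is `k`-connected: it has at least `k+1` vertices and remains connected
after the deletion of any set of fewer than `k` vertices. -/
def IsKConnected {V : Type*} [Fintype V] (G : SimpleGraph V) (k : ℕ) : Prop :=
  k + 1 ≤ Fintype.card V ∧
    ∀ S : Finset V, S.card < k → (G.induce ((↑S : Set V)ᶜ)).Connected

set_option linter.unusedSectionVars false

namespace LongCycle

section Paths

variable {V : Type*} [DecidableEq V]

/-- There is a path of `G` from `a` to `b` whose vertex set is exactly `S`. -/
def PathOn (G : SimpleGraph V) (S : Finset V) (a b : V) : Prop :=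
  ∃ l : List V, l.Nodup ∧ l.IsChain G.Adj ∧ l.head? = some a ∧ l.getLast? = some b ∧
    l.toFinset = S

namespace PathOn

variable {G H : SimpleGraph V} {S T : Finset V} {a b c d : V}

theorem single (G : SimpleGraph V) (a : V) : PathOn G {a} a a :=
  ⟨[a], by simp⟩

theorem symm (h : PathOn G S a b) : PathOn G S b a := by
  obtain ⟨l, h1, h2, h3, h4, h5⟩ := h
  refine ⟨l.reverse, by simpa, ?_, by simpa, by simpa, by simpa⟩
  rw [List.isChain_reverse]
  exact h2.imp fun _ _ h => h.symm

theorem join (h : PathOn G S a b) (h' : PathOn G T c d) (hbc : G.Adj b c)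
    (hd : Disjoint S T) : PathOn G (S ∪ T) a d := by
  obtain ⟨l, h1, h2, h3, h4, rfl⟩ := h
  obtain ⟨m, k1, k2, k3, k4, rfl⟩ := h'
  refine ⟨l ++ m, ?_, ?_, ?_, ?_, by simp⟩
  · refine List.nodup_append'.2 ⟨h1, k1, ?_⟩
    intro x hx hy
    exact (Finset.disjoint_left.1 hd) (by simpa using hx) (by simpa using hy)
  · refine List.isChain_append.2 ⟨h2, k2, ?_⟩
    intro x hx y hy
    rw [h4] at hx; rw [k3] at hy
    simp only [Option.mem_def, Option.some.injEq] at hx hy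
    subst hx; subst hy; exact hbc
  · simp [List.head?_append, h3]
  · simp [List.getLast?_append, k4]

theorem mono (hGH : G ≤ H) (h : PathOn G S a b) : PathOn H S a b := by
  obtain ⟨l, h1, h2, h3⟩ := h
  exact ⟨l, h1, h2.imp fun _ _ h => hGH h, h3⟩

theorem left_mem (h : PathOn G S a b) : a ∈ S := by
  obtain ⟨l, h1, h2, h3, h4, rfl⟩ := h
  simpa using List.mem_of_mem_head? h3

theorem right_mem (h : PathOn G S a b) : b ∈ S := h.symm.left_mem

theorem card_pos (h : PathOn G S a b) : 0 < S.card := Finset.card_pos.2 ⟨a, h.left_mem⟩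

theorem of_list {l : List V} (h1 : l.Nodup) (h2 : l.IsChain G.Adj) (h3 : l.head? = some a)
    (h4 : l.getLast? = some b) : PathOn G l.toFinset a b := ⟨l, h1, h2, h3, h4, rfl⟩

end PathOn

/-- Every cycle of `G` (an edge being regarded as a cycle of length two) has at most `n`
vertices. -/
def CircBound (G : SimpleGraph V) (n : ℕ) : Prop :=
  ∀ S a b, PathOn G S a b → G.Adj b a → S.card ≤ n

theorem PathOn.exists_isCycle {G : SimpleGraph V} {S : Finset V} {a b : V}
    (h : PathOn G S a b) (hab : G.Adj b a) (hS : 3 ≤ S.card) :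
    ∃ (v : V) (p : G.Walk v v), p.IsCycle ∧ p.length = S.card := by
  obtain ⟨l, h1, h2, h3, h4, rfl⟩ := h
  rw [List.toFinset_card_of_nodup h1] at hS ⊢
  have hne : l ≠ [] := by rintro rfl; simp at h3
  have ha : l.head hne = a := by
    rw [List.head?_eq_some_head hne] at h3; simpa using h3
  have hb : l.getLast hne = b := by
    rw [List.getLast?_eq_some_getLast hne] at h4; simpa using h4
  subst ha hb
  refine ⟨_, Walk.cons hab (Walk.ofSupport l hne h2), ?_, ?_⟩
  · rw [Walk.isCycle_iff_isPath_tail_and_le_length]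
    refine ⟨?_, ?_⟩
    · simp only [Walk.tail_cons]
      refine (Walk.isPath_copy _ _ _).2 ?_
      rw [Walk.isPath_def, Walk.support_ofSupport]; exact h1
    · simp only [Walk.length_cons, Walk.length_ofSupport]; omega
  · simp only [Walk.length_cons, Walk.length_ofSupport]; omega

/-- `u` enumerates cyclically, along a cycle of `G`, a set of `n` vertices; for `n = 1` and
`n = 2` the cycle is degenerate. -/
structure CyclicEnum (G : SimpleGraph V) (n : ℕ) (u : ℤ → V) : Prop where
  pos : 0 < n
  eq_iff : ∀ i j, u i = u j ↔ (n : ℤ) ∣ i - j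
  adj : ∀ i, u i ≠ u (i + 1) → G.Adj (u i) (u (i + 1))

namespace CyclicEnum

variable {G : SimpleGraph V} {n : ℕ} {u : ℤ → V}

theorem shift (h : CyclicEnum G n u) (k : ℤ) : CyclicEnum G n (fun i => u (i + k)) where
  pos := h.pos
  eq_iff i j := by rw [h.eq_iff]; congr! 1; ring
  adj i hi := by
    have := h.adj (i + k)
    rw [show i + 1 + k = i + k + 1 by ring] at *
    exact this hi

theorem reflect (h : CyclicEnum G n u) (k : ℤ) : CyclicEnum G n (fun i => u (k - i)) where
  pos := h.pos
  eq_iff i j := by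
    rw [h.eq_iff, ← dvd_neg]; congr! 1; ring
  adj i hi := by
    have := h.adj (k - (i + 1))
    rw [show k - (i + 1) + 1 = k - i by ring] at this
    exact (this (Ne.symm hi)).symm

theorem add_period (h : CyclicEnum G n u) (i : ℤ) : u (i + n) = u i := by
  rw [h.eq_iff]; simp

theorem injOn (h : CyclicEnum G n u) {i j a : ℤ} (hi : a ≤ i) (hi' : i < a + n) (hj : a ≤ j)
    (hj' : j < a + n) (e : u i = u j) : i = j := by
  rw [h.eq_iff] at e
  have := Int.eq_zero_of_abs_lt_dvd e (by rw [abs_lt]; constructor <;> omega)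
  omega

theorem exists_rep (h : CyclicEnum G n u) (a i : ℤ) : ∃ j, a ≤ j ∧ j < a + n ∧ u j = u i := by
  have hn : (0 : ℤ) < n := by exact_mod_cast h.pos
  refine ⟨a + (i - a) % n, ?_, ?_, ?_⟩
  · have := Int.emod_nonneg (i - a) hn.ne'; omega
  · have := Int.emod_lt_of_pos (i - a) hn; omega
  · rw [h.eq_iff]
    have := Int.mul_ediv_add_emod (i - a) n
    exact ⟨-((i - a) / n), by linarith⟩

theorem card_image (h : CyclicEnum G n u) {a b : ℤ} (hb : b < a + n) :
    ((Finset.Icc a b).image u).card = (b + 1 - a).toNat := by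
  rw [Finset.card_image_of_injOn, Int.card_Icc]
  intro i hi j hj e
  simp only [Finset.coe_Icc, Set.mem_Icc] at hi hj
  exact h.injOn (a := a) hi.1 (by omega) hj.1 (by omega) e

theorem disjoint_image (h : CyclicEnum G n u) {a b c d : ℤ} (hbc : b < c) 
    (hd : d < a + n) : Disjoint ((Finset.Icc a b).image u) ((Finset.Icc c d).image u) := by
  rw [Finset.disjoint_left]
  intro x hx hy
  simp only [Finset.mem_image, Finset.mem_Icc] at hx hy
  obtain ⟨i, hi, rfl⟩ := hx
  obtain ⟨j, hj, e⟩ := hy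
  have := h.injOn (a := a) (i := j) (j := i) (by omega) (by omega) (by omega) (by omega) e
  omega

theorem segment (h : CyclicEnum G n u) {a b : ℤ} (hab : a ≤ b) (hb : b < a + n) :
    PathOn G ((Finset.Icc a b).image u) (u a) (u b) := by
  obtain ⟨k, rfl⟩ := Int.le.dest hab
  clear hab
  induction k with
  | zero => simpa using PathOn.single G (u a)
  | succ k ih =>
    have h1 := ih (by push_cast at hb; omega)
    have h2 := h1.join (PathOn.single G (u (a + k + 1))) ?_ ?_
    · convert h2 using 1
      · ext x
        simp only [Finset.mem_image, Finset.mem_Icc, Finset.mem_union, Finset.mem_singleton]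
        constructor
        · rintro ⟨i, hi, rfl⟩
          rcases eq_or_ne i (a + k + 1) with rfl | hne
          · right; rfl
          · left; exact ⟨i, by push_cast at hi; omega, rfl⟩
        · rintro (⟨i, hi, rfl⟩ | rfl)
          · exact ⟨i, by push_cast; omega, rfl⟩
          · exact ⟨_, by push_cast; omega, rfl⟩
      · push_cast; rw [add_assoc]
    · apply h.adj
      intro e
      have := h.injOn (a := a) (by omega) (by push_cast at hb; omega) (by omega) 
        (by push_cast at hb; omega) e
      omega
    · have := h.disjoint_image (a := a) (b := a + k) (c := a + k + 1) (d := a + k + 1) (by omega)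
        (by push_cast at hb; omega)
      simpa using this

end CyclicEnum

theorem exists_cyclicEnum_of_list {G : SimpleGraph V} {l : List V} (h1 : l.Nodup)
    (h2 : l.IsChain G.Adj) {a b : V} (h3 : l.head? = some a) (h4 : l.getLast? = some b)
    (hab : G.Adj b a ∨ a = b) :
    ∃ u : ℤ → V, CyclicEnum G l.length u ∧ (∀ i : ℕ, (hi : i < l.length) → u i = l[i]) ∧
      (∀ x, x ∈ l ↔ ∃ i, u i = x) := by
  have hne : l ≠ [] := by rintro rfl; simp at h3
  have hpos : 0 < l.length := List.length_pos_iff.2 hne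
  have hz : (0 : ℤ) < l.length := by exact_mod_cast hpos
  have hlt : ∀ z : ℤ, (z % l.length).toNat < l.length := fun z => by
    have := Int.emod_lt_of_pos z hz
    omega
  have hu : ∀ z : ℤ, ∃ x, ∃ k : ℕ, ∃ hk : k < l.length, (k : ℤ) = z % l.length ∧ x = l[k] :=
    fun z => ⟨_, _, hlt z, by have := Int.emod_nonneg z hz.ne'; omega, rfl⟩
  choose u k hk hkz hux using hu
  have ha : a = l[0] := by
    rw [List.head?_eq_getElem?, List.getElem?_eq_getElem hpos] at h3
    simpa using h3.symm
  have hb : b = l[l.length - 1] := by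
    rw [List.getLast?_eq_getElem?, List.getElem?_eq_getElem (by omega)] at h4
    simpa using h4.symm
  refine ⟨u, ⟨hpos, ?_, ?_⟩, ?_, ?_⟩
  · intro i j
    rw [hux, hux, h1.getElem_inj_iff]
    rw [Int.dvd_iff_emod_eq_zero, ← Int.emod_eq_emod_iff_emod_sub_eq_zero, ← hkz, ← hkz]
    exact Nat.cast_inj.symm
  · intro i hi
    rcases Nat.lt_or_ge (k i + 1) l.length with hlt' | hge
    · have : k (i + 1) = k i + 1 := by
        have e := hkz (i + 1)
        rw [Int.add_emod, ← hkz i] at e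
        have h1' : ((1 : ℤ) % l.length) = 1 := Int.emod_eq_of_lt (by omega) (by omega)
        rw [h1', Int.emod_eq_of_lt (by omega) (by omega)] at e
        omega
      rw [hux i, hux (i + 1)]
      simp only [this]
      exact List.isChain_iff_getElem.1 h2 (k i) hlt'
    · have hki : k i = l.length - 1 := by have := hk i; omega
      have : k (i + 1) = 0 := by
        have e := hkz (i + 1)
        rw [← Int.emod_add_emod, ← hkz i, hki] at e
        have : ((l.length - 1 : ℕ) : ℤ) + 1 = l.length := by omega
        rw [this] at e
        simpa using e
      rw [hux i, hux (i + 1)] at hi ⊢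
      simp only [this, hki] at hi ⊢
      rw [← ha, ← hb] at hi ⊢
      rcases hab with h | h
      · exact h
      · exact absurd h.symm hi
  · intro i hi
    have e := hkz i
    rw [Int.emod_eq_of_lt (by omega) (by omega)] at e
    have : k i = i := by exact_mod_cast e
    rw [hux]; simp only [this]
  · intro x
    constructor
    · intro hx
      obtain ⟨i, hi, rfl⟩ := List.mem_iff_getElem.1 hx
      refine ⟨i, ?_⟩
      have e := hkz i
      rw [Int.emod_eq_of_lt (by omega) (by omega)] at e
      have : k i = i := by exact_mod_cast e
      rw [hux]; simp only [this]
    · rintro ⟨i, rfl⟩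
      rw [hux]; exact List.getElem_mem _

end Paths

section Capacity

open scoped Classical

variable {V : Type*} [DecidableEq V]

/-- A path outside a longest cycle, attached to the cycle at two positions, forces these positions
to be far apart. -/
theorem CyclicEnum.bridge {G : SimpleGraph V} {L : ℕ} {c : ℤ → V} (hc : CyclicEnum G L c)
    (hb : CircBound G L) {S : Finset V} {p q : V} (hS : PathOn G S p q) (hd : ∀ k, c k ∉ S)
    {i j : ℤ} (hip : G.Adj (c i) p) (hjq : G.Adj (c j) q) (hij : i < j) (hji : j ≤ i + L) :
    (S.card : ℤ) + 1 ≤ j - i := by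
  have hs := hc.segment hji (by omega)
  rw [hc.add_period] at hs
  have hdis : Disjoint ((Finset.Icc j (i + L)).image c) S := by
    rw [Finset.disjoint_left]
    intro x hx
    obtain ⟨k, -, rfl⟩ := Finset.mem_image.1 hx
    exact hd k
  have h1 := hb _ _ _ (hs.join hS hip hdis) hjq.symm
  rw [Finset.card_union_of_disjoint hdis, hc.card_image (by omega)] at h1
  omega

/-- A path between two positions of a longest cycle is not longer than the arc it short-cuts. -/
theorem CyclicEnum.bridge_of_mem {G : SimpleGraph V} {L : ℕ} {c : ℤ → V} (hc : CyclicEnum G L c)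
    (hb : CircBound G L) {S : Finset V} {i j : ℤ} (hS : PathOn G S (c i) (c j))
    (hd : ∀ k, j < k → k < i + L → c k ∉ S)
    (hij : i < j) (hji : j < i + L) :
    (S.card : ℤ) ≤ j - i + 1 := by
  have hne : ∀ k, j ≤ k → k < i + L → G.Adj (c k) (c (k + 1)) := by
    intro k h1 h2
    apply hc.adj
    intro e
    have := hc.injOn (a := i + 1) (by omega) (by omega) (by omega) (by omega) e
    omega
  rcases eq_or_ne (j + 1) (i + L) with h | h
  · have h1 := hb _ _ _ hS (by have := hne j le_rfl hji; rwa [h, hc.add_period] at this)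
    omega
  · have hs := hc.segment (a := j + 1) (b := i + L - 1) (by omega) (by omega)
    have hdis : Disjoint S ((Finset.Icc (j + 1) (i + L - 1)).image c) := by
      rw [Finset.disjoint_right]
      intro x hx
      obtain ⟨k, hk, rfl⟩ := Finset.mem_image.1 hx
      rw [Finset.mem_Icc] at hk
      exact hd k (by omega) (by omega)
    have hl := hne (i + L - 1) (by omega) (by omega)
    rw [sub_add_cancel, hc.add_period] at hl
    have h1 := hb _ _ _ (hS.join hs (hne j le_rfl hji) hdis) hl
    rw [Finset.card_union_of_disjoint hdis, hc.card_image (by omega)] at h1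
    omega

theorem sum_Ico_shift {M : Type*} [AddCommMonoid M] {f : ℤ → M} {L : ℕ}
    (hf : ∀ i, f (i + L) = f i) (a b : ℤ) :
    ∑ k ∈ Finset.Ico a (a + L), f k = ∑ k ∈ Finset.Ico b (b + L), f k := by
  have key : ∀ a : ℤ, ∑ k ∈ Finset.Ico (a + 1) (a + 1 + L), f k
      = ∑ k ∈ Finset.Ico a (a + L), f k := by
    intro a
    rcases Nat.eq_zero_or_pos L with rfl | hL
    · simp
    have e1 : Finset.Ico a (a + L) = insert a (Finset.Ico (a + 1) (a + L)) := by
      ext; simp only [Finset.mem_Ico, Finset.mem_insert]; omega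
    have e2 : Finset.Ico (a + 1) (a + 1 + L) = insert (a + L) (Finset.Ico (a + 1) (a + L)) := by
      ext; simp only [Finset.mem_Ico, Finset.mem_insert]; omega
    rw [e1, e2, Finset.sum_insert (by simp), Finset.sum_insert (by simp), hf]
  have key2 : ∀ a : ℤ, ∑ k ∈ Finset.Ico a (a + L), f k = ∑ k ∈ Finset.Ico 0 (0 + (L : ℤ)), f k := by
    intro a
    induction a using Int.induction_on with
    | zero => rfl
    | succ i ih => rw [← ih, key]
    | pred i ih => rw [← ih, ← key, sub_add_cancel]
  rw [key2 a, key2 b]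

/-- If positive values of a periodic function keep their distance, its sum over a period is at
most the period. -/
theorem sum_le_period {f : ℤ → ℕ} {L : ℕ} (hf : ∀ i, f (i + L) = f i)
    (h : ∀ i j : ℤ, i < j → j ≤ i + L → 0 < f i → 0 < f j → ((f i + f j : ℕ) : ℤ) ≤ 2 * (j - i))
    (a : ℤ) : ∑ k ∈ Finset.Ico a (a + L), f k ≤ L := by
  by_cases hex : ∃ i, 0 < f i
  · obtain ⟨i, hi⟩ := hex
    rw [sum_Ico_shift hf a i]
    have key : ∀ n : ℕ, ∀ i : ℤ, n ≤ L → 0 < f i → 0 < f (i + n) →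
        ((2 * ∑ k ∈ Finset.Ico i (i + n), f k + f (i + n) : ℕ) : ℤ) ≤ 2 * n + f i := by
      intro n
      induction n using Nat.strong_induction_on with
      | _ n ih =>
        intro i hn h1 h2
        rcases Nat.eq_zero_or_pos n with rfl | hpos
        · simp
        by_cases hm : ∃ m : ℕ, 0 < m ∧ m < n ∧ 0 < f (i + m)
        · obtain ⟨m, hm1, hm2, hm3⟩ := hm
          have a1 := ih m hm2 i (by omega) h1 hm3
          have e : i + m + (n - m : ℕ) = i + n := by push_cast [hm2.le]; ring
          have a2 := ih (n - m) (by omega) (i + m) (by omega) hm3 (by rwa [e])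
          rw [e] at a2
          have : ∑ k ∈ Finset.Ico i (i + n), f k = ∑ k ∈ Finset.Ico i (i + m), f k
              + ∑ k ∈ Finset.Ico (i + m) (i + n), f k := by
            rw [← Finset.sum_union]
            · congr 1; ext; simp only [Finset.mem_Ico, Finset.mem_union]; omega
            · rw [Finset.disjoint_left]; intro x; simp only [Finset.mem_Ico]; omega
          rw [this]; push_cast [hm2.le] at *; linarith
        · have : ∑ k ∈ Finset.Ico i (i + n), f k = f i := by
            rw [Finset.sum_eq_single_of_mem i (by simp; omega)]
            intro k hk hki
            rw [Finset.mem_Ico] at hk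
            by_contra h0
            exact hm ⟨(k - i).toNat, by omega, by omega, by
              rw [show i + ((k - i).toNat : ℤ) = k by omega]; omega⟩
          have h3 := h i (i + n) (by omega) (by omega) h1 h2
          rw [this]
          push_cast at *
          linarith
    have := key L i le_rfl hi (by rwa [hf])
    rw [hf] at this
    push_cast at this
    have h3 : ((∑ k ∈ Finset.Ico i (i + L), f k : ℕ) : ℤ) ≤ L := by push_cast; linarith
    exact_mod_cast h3
  · push Not at hex
    rw [Finset.sum_eq_zero (fun k _ => Nat.le_zero.1 (hex k))]; exact Nat.zero_le _

/-- The vertices of a cyclic enumeration. -/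
noncomputable def cycVerts (n : ℕ) (u : ℤ → V) : Finset V := (Finset.Ico (0 : ℤ) n).image u

theorem CyclicEnum.mem_cycVerts {G : SimpleGraph V} {n : ℕ} {u : ℤ → V} (h : CyclicEnum G n u)
    {x : V} : x ∈ cycVerts n u ↔ ∃ i, u i = x := by
  simp only [cycVerts, Finset.mem_image, Finset.mem_Ico]
  constructor
  · rintro ⟨i, -, h⟩; exact ⟨i, h⟩
  · rintro ⟨i, rfl⟩
    obtain ⟨j, h1, h2, h3⟩ := h.exists_rep 0 i
    exact ⟨j, by omega, h3⟩

theorem CyclicEnum.apply_mem {G : SimpleGraph V} {n : ℕ} {u : ℤ → V} (h : CyclicEnum G n u)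
    (i : ℤ) : u i ∈ cycVerts n u := h.mem_cycVerts.2 ⟨i, rfl⟩

theorem CyclicEnum.sum_cycVerts {G : SimpleGraph V} {n : ℕ} {u : ℤ → V} (h : CyclicEnum G n u)
    {M : Type*} [AddCommMonoid M] (F : V → M) (p : ℤ) :
    ∑ x ∈ cycVerts n u, F x = ∑ k ∈ Finset.Ico p (p + n), F (u k) := by
  rw [sum_Ico_shift (f := fun k => F (u k)) (fun i => by simp only [h.add_period]) p 0, zero_add,
    cycVerts, Finset.sum_image]
  intro i hi j hj e
  simp only [Finset.coe_Ico, Set.mem_Ico] at hi hj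
  exact h.injOn (a := 0) hi.1 (by omega) hj.1 (by omega) e

theorem CyclicEnum.card_cycVerts {G : SimpleGraph V} {n : ℕ} {u : ℤ → V} (h : CyclicEnum G n u) :
    (cycVerts n u).card = n := by
  have := h.sum_cycVerts (fun _ => 1) 0
  simpa using this

/-- A family of pairwise disjoint paths of `K`, one starting at each vertex `x` of `S` and
continuing through the list `t x` outside `S`. -/
structure Tails (K : SimpleGraph V) (S : Finset V) (t : V → List V) : Prop where
  nil : ∀ x ∉ S, t x = []
  chain : ∀ x, (x :: t x).IsChain K.Adj
  nodup : ∀ x, (t x).Nodup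
  disj : ∀ x y, x ≠ y → List.Disjoint (t x) (t y)
  notMem : ∀ x, ∀ z ∈ t x, z ∉ S

/-- The last vertex of the path `x :: t x`. -/
def tailEnd (t : V → List V) (x : V) : V := (x :: t x).getLast (List.cons_ne_nil _ _)

theorem PathOn.append_list {G : SimpleGraph V} {S : Finset V} {p q : V} (h : PathOn G S p q)
    {l : List V} (h1 : (q :: l).IsChain G.Adj) (h2 : l.Nodup) (h3 : ∀ z ∈ l, z ∉ S) :
    PathOn G (S ∪ l.toFinset) p ((q :: l).getLast (List.cons_ne_nil _ _)) := by
  rcases l with _ | ⟨z, l⟩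
  · simpa using h
  · rw [List.isChain_cons_cons] at h1
    have := PathOn.of_list (G := G) h2 h1.2 (a := z) rfl
      (List.getLast?_eq_some_getLast (List.cons_ne_nil _ _))
    have hd : Disjoint S (z :: l).toFinset := by
      rw [Finset.disjoint_right]
      intro x hx
      exact h3 x (by simpa using hx)
    rw [List.getLast_cons (List.cons_ne_nil z l)]
    exact h.join this h1.1 hd

theorem exists_adj_of_mem_tail {K : SimpleGraph V} {x z : V} {l : List V}
    (h : (x :: l).IsChain K.Adj) (hz : z ∈ l) : ∃ y, K.Adj y z := by
  induction l generalizing x with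
  | nil => simp at hz
  | cons y l ih =>
    rw [List.isChain_cons_cons] at h
    rcases List.mem_cons.1 hz with rfl | hz
    · exact ⟨x, h.1⟩
    · exact ih h.2 hz

section

variable {G K : SimpleGraph V} {L n : ℕ} {c u : ℤ → V} {t : V → List V}

theorem tailEnd_notMem (ht : Tails K (cycVerts n u) t)
    (hK : ∀ x y, K.Adj x y → ∀ k, c k ≠ y) (hH : ∀ i k, c k ≠ u i) (i : ℤ) :
    ∀ k, c k ≠ tailEnd t (u i) := by
  intro k
  have : tailEnd t (u i) ∈ u i :: t (u i) := List.getLast_mem _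
  rcases List.mem_cons.1 this with h | h
  · rw [h]; exact hH i k
  · obtain ⟨y, hy⟩ := exists_adj_of_mem_tail (ht.chain _) h
    exact hK _ _ hy k

theorem Tails.arc (hu : CyclicEnum K n u) (ht : Tails K (cycVerts n u) t) 
    {a d : ℤ} (hd0 : 0 < d) (hdn : d < n) :
    ∃ S : Finset V, PathOn K S (tailEnd t (u (a + d))) (tailEnd t (u a)) ∧ n - d + 1 ≤ S.card ∧
      ∀ x ∈ S, (∃ i, u i = x) ∨ ∃ y, K.Adj y x := by
  have hs := hu.segment (a := a + d - n) (b := a) (by omega) (by omega)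
  have e : u (a + d - n) = u (a + d) := by rw [← hu.add_period, sub_add_cancel]
  rw [e] at hs
  have hsub : ∀ x ∈ (Finset.Icc (a + d - n) a).image u, ∃ i, u i = x := by
    intro x hx
    obtain ⟨k, -, rfl⟩ := Finset.mem_image.1 hx
    exact ⟨k, rfl⟩
  have h1 := hs.append_list (ht.chain _) (ht.nodup _) (fun z hz hz' => 
    ht.notMem _ z hz (hu.mem_cycVerts.2 (hsub z hz')))
  have hne : u (a + d) ≠ u a := by
    intro e
    have := hu.injOn (a := a) (by omega) (by omega) (by omega) (by omega) e
    omega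
  have h2 := h1.symm.append_list (ht.chain _) (ht.nodup _) (fun z hz hz' => by
    rcases Finset.mem_union.1 hz' with h | h
    · exact ht.notMem _ z hz (hu.mem_cycVerts.2 (hsub z h))
    · exact ht.disj _ _ hne hz (by simpa using h))
  refine ⟨_, h2.symm, ?_, ?_⟩
  · have := Finset.card_le_card (s := (Finset.Icc (a + d - n) a).image u)
      (t := (Finset.Icc (a + d - n) a).image u ∪ (t (u a)).toFinset ∪ (t (u (a + d))).toFinset)
      (by intro x hx; simp only [Finset.mem_union]; tauto)
    rw [hu.card_image (by omega)] at this
    omega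
  · intro x hx
    simp only [Finset.mem_union] at hx
    rcases hx with (h | h) | h
    · exact Or.inl (hsub x h)
    · exact Or.inr (exists_adj_of_mem_tail (ht.chain _) (by simpa using h))
    · exact Or.inr (exists_adj_of_mem_tail (ht.chain _) (by simpa using h))

theorem sum_le_of_consecutive {F : ℤ → ℕ} (h4 : ∀ k, F k ≤ 4) (h : ∀ k, F k + F (k + 1) ≤ 4)
    (N : ℕ) (a : ℤ) : ∑ k ∈ Finset.Ico a (a + N), F k ≤ 2 * N + 2 := by
  induction N using Nat.strong_induction_on generalizing a with
  | _ N ih =>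
    rcases N with _ | _ | N
    · simp
    · have : Finset.Ico a (a + ((0 + 1 : ℕ) : ℤ)) = {a} := by
        ext; simp only [Finset.mem_Ico, Finset.mem_singleton]; push_cast; omega
      rw [this]; simpa using h4 a
    · have := ih N (by omega) (a + 2)
      have e : Finset.Ico a (a + ((N + 1 + 1 : ℕ) : ℤ))
          = insert a (insert (a + 1) (Finset.Ico (a + 2) (a + 2 + N))) := by
        ext; simp only [Finset.mem_Ico, Finset.mem_insert]; push_cast; omega
      rw [e, Finset.sum_insert (by simp), Finset.sum_insert (by simp)]
      have := h a
      omega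

theorem sum_le_of_cross {A B : ℤ → Prop} {F : ℤ → ℕ} (hF0 : ∀ a, ¬ A a → ¬ B a → F a = 0)
    (hFA : ∀ a, ¬ B a → F a ≤ 2) (hFB : ∀ a, ¬ A a → F a ≤ 2) (hF4 : ∀ a, F a ≤ 4)
    {n d : ℕ} {a : ℤ} (hd : 2 ≤ d) (hdn : d < n)
    (ha : (A a ∧ B (a + d)) ∨ (B a ∧ A (a + d)))
    (hno : ∀ k : ℤ, ∀ e : ℕ, 0 < e → e < d → ¬ ((A k ∧ B (k + e)) ∨ (B k ∧ A (k + e)))) :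
    ∑ k ∈ Finset.Ico (a + 1) (a + 1 + n), F k ≤ 2 * (n - d + 1 : ℕ) + 2 := by
  have hnopair : ∀ k m : ℤ, ∀ e : ℕ, m = k + e → 0 < e → e < d →
      ¬ ((A k ∧ B m) ∨ (B k ∧ A m)) := by
    rintro k m e rfl h1 h2 h3
    exact hno k e h1 h2 h3
  have hbetween : ∀ k, a < k → k < a + d → F k = 0 := by
    intro k h1 h2
    have g1 := hnopair a k (k - a).toNat (by omega) (by omega) (by omega)
    have g2 := hnopair k (a + d) (a + d - k).toNat (by omega) (by omega) (by omega)
    apply hF0 <;> tauto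
  have hcons : ∀ k, F k + F (k + 1) ≤ 4 := by
    intro k
    have g := hnopair k (k + 1) 1 (by norm_num) (by omega) (by omega)
    by_cases n1 : A k ∨ B k
    · by_cases n2 : A (k + 1) ∨ B (k + 1)
      · have b1 : F k ≤ 2 := by
          by_cases c : B k
          · exact hFB k (by tauto)
          · exact hFA k c
        have b2 : F (k + 1) ≤ 2 := by
          by_cases c : B (k + 1)
          · exact hFB _ (by tauto)
          · exact hFA _ c
        omega
      · have b1 := hF0 (k + 1) (by tauto) (by tauto)
        have b2 := hF4 k
        omega
    · have b1 := hF0 k (by tauto) (by tauto)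
      have b2 := hF4 (k + 1)
      omega
  have hs := sum_le_of_consecutive hF4 hcons (n - d + 1) (a + d)
  have hsplit : ∑ k ∈ Finset.Ico (a + 1) (a + 1 + n), F k
      = ∑ k ∈ Finset.Ico (a + d) (a + d + (n - d + 1 : ℕ)), F k := by
    symm
    apply Finset.sum_subset
    · intro k; simp only [Finset.mem_Ico]; push_cast [hdn.le]; omega
    · intro k h1 h2
      simp only [Finset.mem_Ico] at h1 h2
      push_cast [hdn.le] at h2
      exact hbetween k (by omega) (by omega)
  rw [hsplit]
  exact hs

theorem weighted_capacity (hKG : K ≤ G) (hc : CyclicEnum G L c) (hb : CircBound G L)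
    (hu : CyclicEnum K n u)
    (ht : Tails K (cycVerts n u) t) (hK : ∀ x y, K.Adj x y → ∀ k, c k ≠ y)
    (hH : ∀ i k, c k ≠ u i) {w : V → ℕ} (hw : ∀ x, w x ≤ 2)
    (hws : ∑ x ∈ cycVerts n u, w x ≤ n + 1) :
    ∑ x ∈ cycVerts n u, w x *
      ((Finset.Ico (0 : ℤ) L).filter fun k => G.Adj (c k) (tailEnd t x)).card ≤ L := by
  set f : ℤ → ℕ := fun k => ∑ x ∈ cycVerts n u, if G.Adj (c k) (tailEnd t x) then w x else 0
    with hf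
  have hgoal : ∑ x ∈ cycVerts n u, w x *
      ((Finset.Ico (0 : ℤ) L).filter fun k => G.Adj (c k) (tailEnd t x)).card
      = ∑ k ∈ Finset.Ico (0 : ℤ) (0 + L), f k := by
    rw [zero_add, hf, Finset.sum_comm]
    refine Finset.sum_congr rfl fun x _ => ?_
    rw [← Finset.sum_filter, Finset.sum_const, smul_eq_mul, mul_comm]
  rw [hgoal]
  apply sum_le_period
  · intro i; simp only [hf, hc.add_period]
  intro i j hij hji hi hj
  have hpos : ∀ k, 0 < f k → ∃ a : ℤ, G.Adj (c k) (tailEnd t (u a)) ∧ 0 < w (u a) := by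
    intro k hk
    obtain ⟨x, hx, h0⟩ := Finset.exists_ne_zero_of_sum_ne_zero hk.ne'
    obtain ⟨a, rfl⟩ := hu.mem_cycVerts.1 hx
    by_cases h : G.Adj (c k) (tailEnd t (u a))
    · rw [if_pos h] at h0; exact ⟨a, h, by omega⟩
    · rw [if_neg h] at h0; exact absurd rfl h0
  set A : ℤ → Prop := fun a => G.Adj (c i) (tailEnd t (u a)) ∧ 0 < w (u a) with hA
  set B : ℤ → Prop := fun a => G.Adj (c j) (tailEnd t (u a)) ∧ 0 < w (u a) with hB
  set F : ℤ → ℕ := fun a => (if G.Adj (c i) (tailEnd t (u a)) then w (u a) else 0) +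
    (if G.Adj (c j) (tailEnd t (u a)) then w (u a) else 0) with hF
  have hsum : ∀ p : ℤ, f i + f j = ∑ a ∈ Finset.Ico p (p + n), F a := by
    intro p
    rw [hf]; simp only []
    rw [← Finset.sum_add_distrib, hu.sum_cycVerts _ p]
  have hper : ∀ a, u (a + n) = u a := hu.add_period
  have hF0 : ∀ a, ¬ A a → ¬ B a → F a = 0 := by
    intro a h1 h2
    simp only [hA, hB, not_and, not_lt, Nat.le_zero] at h1 h2
    simp only [hF]
    split_ifs with h3 h4 h4
    · simp [h1 h3]
    · simp [h1 h3]
    · simp [h2 h4]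
    · rfl
  have hFA : ∀ a, ¬ B a → F a ≤ 2 := by
    intro a h2
    simp only [hB, not_and, not_lt, Nat.le_zero] at h2
    have := hw (u a)
    simp only [hF]
    split_ifs with h3 h4 h4
    · simp [h2 h4]
    · omega
    · simp [h2 h4]
    · omega
  have hFB : ∀ a, ¬ A a → F a ≤ 2 := by
    intro a h2
    simp only [hA, not_and, not_lt, Nat.le_zero] at h2
    have := hw (u a)
    simp only [hF]
    split_ifs with h3 h4 h4
    · simp [h2 h3]
    · simp [h2 h3]
    · omega
    · omega
  have hF4 : ∀ a, F a ≤ 4 := by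
    intro a
    have := hw (u a)
    simp only [hF]; split_ifs <;> omega
  have hFw : ∀ p : ℤ, ∑ a ∈ Finset.Ico p (p + n), F a ≤ 2 * (n + 1) := by
    intro p
    calc _ ≤ ∑ a ∈ Finset.Ico p (p + n), 2 * w (u a) := by
          refine Finset.sum_le_sum fun a _ => ?_
          simp only [hF]; split_ifs <;> omega
      _ = 2 * ∑ x ∈ cycVerts n u, w x := by rw [← Finset.mul_sum, hu.sum_cycVerts _ p]
      _ ≤ _ := by omega
  have hgap : ∀ a d : ℤ, 0 < d → d < n → (A a ∧ B (a + d)) ∨ (B a ∧ A (a + d)) →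
      n - d + 2 ≤ j - i := by
    intro a d h1 h2 h3
    obtain ⟨S, hS, hcard, hmem⟩ := ht.arc hu (a := a) h1 h2
    have hdis : ∀ k, c k ∉ S := by
      intro k hk
      rcases hmem _ hk with ⟨i, hi⟩ | ⟨y, hy⟩
      · exact hH i k hi.symm
      · exact hK _ _ hy k rfl
    rcases h3 with ⟨hx, hy⟩ | ⟨hx, hy⟩
    · have := hc.bridge hb (hS.symm.mono hKG) hdis hx.1 hy.1 hij hji
      omega
    · have := hc.bridge hb (hS.mono hKG) hdis hy.1 hx.1 hij hji
      omega
  by_cases hex : ∃ d : ℕ, 0 < d ∧ d < n ∧ ∃ a, (A a ∧ B (a + d)) ∨ (B a ∧ A (a + d))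
  · obtain ⟨d, ⟨hd0, hdn, a, ha⟩, hmin⟩ : ∃ d : ℕ, (0 < d ∧ d < n ∧
        ∃ a, (A a ∧ B (a + d)) ∨ (B a ∧ A (a + d))) ∧ ∀ e < d, ¬ (0 < e ∧ e < n ∧
        ∃ a, (A a ∧ B (a + e)) ∨ (B a ∧ A (a + e))) :=
      ⟨Nat.find hex, Nat.find_spec hex, fun e he => Nat.find_min hex he⟩
    have hg := hgap a d (by omega) (by omega) ha
    clear_value A B F
    clear hgap hpos hex
    rcases Nat.lt_or_ge d 2 with h1 | h2
    · have := hFw 0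
      rw [← hsum 0] at this
      omega
    have hs := sum_le_of_cross hF0 hFA hFB hF4 (a := a) h2 hdn ha
      fun k e h1 h2 h3 => hmin e h2 ⟨h1, by omega, k, h3⟩
    rw [← hsum (a + 1)] at hs
    omega
  · have hsame : ∀ a b, A a → B b → u a = u b := by
      intro a b h1 h2
      by_contra hne
      obtain ⟨b', g1, g2, g3⟩ := hu.exists_rep a b
      have hb' : B b' := by simp only [hB, g3]; exact h2
      have : b' ≠ a := by rintro rfl; exact hne g3
      exact hex ⟨(b' - a).toNat, by omega, by omega, a, Or.inl ⟨h1, by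
        rwa [show a + ((b' - a).toNat : ℤ) = b' by omega]⟩⟩
    obtain ⟨a, ha⟩ := hpos i hi
    obtain ⟨b, hb'⟩ := hpos j hj
    have e := hsame a b ha hb'
    have hg := hc.bridge hb (PathOn.single G (tailEnd t (u a))) (fun k hk =>
      tailEnd_notMem ht hK hH a k (by simpa using hk)) ha.1 (by rw [e]; exact hb'.1) hij hji
    have hn : (0 : ℤ) < n := by exact_mod_cast hu.pos
    have : ∑ k ∈ Finset.Ico a (a + n), F k ≤ 4 := by
      rw [Finset.sum_eq_single_of_mem a (by simp; omega)]
      · exact hF4 a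
      · intro k hk hka
        rw [Finset.mem_Ico] at hk
        have hne : u k ≠ u a := fun h =>
          hka (hu.injOn (a := a) hk.1 hk.2 le_rfl (by omega) h)
        apply hF0
        · intro h; exact hne ((hsame k b h hb').trans e.symm)
        · intro h; exact hne (hsame a k ha h).symm
    rw [← hsum a] at this
    rw [Finset.card_singleton] at hg
    push_cast at hg
    omega

theorem capacity (hKG : K ≤ G) (hc : CyclicEnum G L c) (hb : CircBound G L)
    (hu : CyclicEnum K n u)
    (ht : Tails K (cycVerts n u) t) (hK : ∀ x y, K.Adj x y → ∀ k, c k ≠ y)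
    (hH : ∀ i k, c k ≠ u i) {J : Finset V} (hJ : J ⊆ cycVerts n u) {s m : ℕ}
    (hs : ∀ x ∈ J, s ≤ ((Finset.Ico (0 : ℤ) L).filter fun k => G.Adj (c k) (tailEnd t x)).card)
    (hm : m ≤ 2 * J.card) (hmn : m ≤ n + 1) : m * s ≤ L := by
  obtain ⟨J1, h1, e1⟩ := Finset.exists_subset_card_eq (show m / 2 ≤ J.card by omega)
  obtain ⟨J2, h2, e2⟩ := Finset.exists_subset_card_eq (show (m + 1) / 2 ≤ J.card by omega)
  set w : V → ℕ := fun x => (if x ∈ J1 then 1 else 0) + (if x ∈ J2 then 1 else 0) with hw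
  have hsum : ∑ x ∈ cycVerts n u, w x = m := by
    rw [hw, Finset.sum_add_distrib, Finset.sum_ite_mem, Finset.sum_ite_mem,
      Finset.inter_eq_right.2 (h1.trans hJ), Finset.inter_eq_right.2 (h2.trans hJ)]
    simp only [Finset.sum_const, smul_eq_mul, mul_one]
    omega
  have := weighted_capacity hKG hc hb hu ht hK hH (w := w) 
    (fun x => by simp only [hw]; split_ifs <;> omega) (by omega)
  refine le_trans ?_ this
  rw [← hsum, Finset.sum_mul]
  refine Finset.sum_le_sum fun x _ => ?_
  by_cases hx : x ∈ J
  · exact Nat.mul_le_mul le_rfl (hs x hx)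
  · have : w x = 0 := by
      simp only [hw]
      rw [if_neg (fun h => hx (h1 h)), if_neg (fun h => hx (h2 h))]
    rw [this]; simp

end

end Capacity

section TailSystems

open scoped Classical

variable {V : Type*} [DecidableEq V] {K : SimpleGraph V} {S : Finset V} {Bad : V → Prop}
  {t : V → List V}

/-- The contribution of the tail `l` at `x` to the measure which is maximised below. -/
noncomputable def tailWeight (Bad : V → Prop) (x : V) (l : List V) : ℕ :=
  l.length + (if l = [] then 0 else 1) +
    (if Bad ((x :: l).getLast (List.cons_ne_nil _ _)) then 0 else 1)

/-- The measure of a family of tails: it rewards long tails, nontrivial tails and ends outside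
`Bad`. -/
noncomputable def tailMeasure (S : Finset V) (Bad : V → Prop) (t : V → List V) : ℕ :=
  ∑ x ∈ S, tailWeight Bad x (t x)

/-- A family of tails of maximum measure. -/
structure MaxTails (K : SimpleGraph V) (S : Finset V) (Bad : V → Prop) (t : V → List V) : Prop
    extends Tails K S t where
  max : ∀ t', Tails K S t' → tailMeasure S Bad t' ≤ tailMeasure S Bad t

theorem tailMeasure_update {x : V} (hx : x ∈ S) (l : List V) :
    tailMeasure S Bad (Function.update t x l) + tailWeight Bad x (t x) =
      tailMeasure S Bad t + tailWeight Bad x l := by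
  unfold tailMeasure
  rw [← Finset.add_sum_erase _ _ hx, ← Finset.add_sum_erase S (fun x => tailWeight Bad x (t x)) hx]
  have : ∑ y ∈ S.erase x, tailWeight Bad y (Function.update t x l y)
      = ∑ y ∈ S.erase x, tailWeight Bad y (t y) :=
    Finset.sum_congr rfl fun y hy => by
      rw [Function.update_of_ne (Finset.ne_of_mem_erase hy)]
  rw [this, Function.update_self]
  omega

theorem exists_maxTails [Fintype V] (K : SimpleGraph V) (S : Finset V) (Bad : V → Prop) :
    ∃ t, MaxTails K S Bad t := by
  have h0 : Tails K S fun _ => [] := ⟨by simp, by simp, by simp, by simp, by simp⟩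
  have hbd : ∀ t, Tails K S t → tailMeasure S Bad t ≤ S.card * (Fintype.card V + 2) := by
    intro t ht
    unfold tailMeasure
    rw [← smul_eq_mul]
    apply Finset.sum_le_card_nsmul
    intro x _
    have := (ht.nodup x).length_le_card
    unfold tailWeight
    split_ifs <;> omega
  set P : ℕ → Prop := fun n => ∃ t, Tails K S t ∧ tailMeasure S Bad t = n with hP
  obtain ⟨t, ht, hm⟩ := Nat.findGreatest_spec (P := P) (hbd _ h0) ⟨_, h0, rfl⟩
  refine ⟨t, ht, fun t' ht' => ?_⟩
  rw [hm]
  exact Nat.le_findGreatest (hbd t' ht') ⟨t', ht', rfl⟩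

theorem Tails.update (ht : Tails K S t) {x : V} (hx : x ∈ S) {l : List V}
    (hc : (x :: l).IsChain K.Adj) (hn : l.Nodup) (hz : ∀ z ∈ l, z ∉ S ∧ ∀ y ≠ x, z ∉ t y) :
    Tails K S (Function.update t x l) where
  nil y hy := by
    rw [Function.update_of_ne (by rintro rfl; exact hy hx)]; exact ht.nil y hy
  chain y := by
    rcases eq_or_ne y x with rfl | h
    · simpa using hc
    · rw [Function.update_of_ne h]; exact ht.chain y
  nodup y := by
    rcases eq_or_ne y x with rfl | h
    · simpa using hn
    · rw [Function.update_of_ne h]; exact ht.nodup y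
  disj y y' hne := by
    rcases eq_or_ne y x with rfl | h
    · rw [Function.update_self, Function.update_of_ne hne.symm]
      intro z h1 h2
      exact (hz z h1).2 y' hne.symm h2
    · rw [Function.update_of_ne h]
      rcases eq_or_ne y' x with rfl | h'
      · rw [Function.update_self]
        intro z h1 h2
        exact (hz z h2).2 y hne h1
      · rw [Function.update_of_ne h']; exact ht.disj y y' hne
  notMem y z h := by
    rcases eq_or_ne y x with rfl | h'
    · rw [Function.update_self] at h; exact (hz z h).1
    · rw [Function.update_of_ne h'] at h; exact ht.notMem y z h

/-- Cut the tail at `y` before `z` and give the part from `z` on to `x`. -/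
noncomputable def moveTail (t : V → List V) (x y : V) (a : List V) (b : List V) : V → List V :=
  Function.update (Function.update t y a) x b

theorem Tails.move (ht : Tails K S t) {x y z : V} {a b : List V} (hx : x ∈ S) (hy : y ∈ S)
    (hty : t y = a ++ z :: b) (hxy : x ≠ y) (hadj : K.Adj x z) :
    Tails K S (moveTail t x y a (z :: b)) := by
  have hc := ht.chain y
  rw [hty] at hc
  have hn := ht.nodup y
  rw [hty] at hn
  have h1 : Tails K S (Function.update t y a) := by
    refine ht.update hy ?_ (List.Nodup.of_append_left hn) ?_
    · rw [← List.cons_append] at hc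
      exact hc.left_of_append
    · intro w hw
      have : w ∈ t y := by rw [hty]; simp [hw]
      exact ⟨ht.notMem _ _ this, fun y' hy' h => ht.disj y' y hy' h this⟩
  refine h1.update hx ?_ (List.Nodup.of_append_right hn) ?_
  · rw [← List.cons_append] at hc
    exact List.isChain_cons_cons.2 ⟨hadj, hc.right_of_append⟩
  · intro w hw
    have hwy : w ∈ t y := by rw [hty]; exact List.mem_append_right _ hw
    refine ⟨ht.notMem _ _ hwy, fun y' hy' h => ?_⟩
    rcases eq_or_ne y' y with rfl | h'
    · rw [Function.update_self] at h
      exact (List.nodup_append'.1 hn).2.2 h hw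
    · rw [Function.update_of_ne h'] at h
      exact ht.disj y' y h' h hwy

theorem tailMeasure_move {x y z : V} {a b : List V} (hx : x ∈ S) (hy : y ∈ S)
    (hty : t y = a ++ z :: b) (hxy : x ≠ y) (htx : t x = []) (hbad : Bad x) :
    tailMeasure S Bad (moveTail t x y a (z :: b)) = tailMeasure S Bad t +
      ((if a = [] then 0 else 1) +
        if Bad ((y :: a).getLast (List.cons_ne_nil _ _)) then 0 else 1) := by
  have h1 := tailMeasure_update (Bad := Bad) (t := t) hy a
  have h2 := tailMeasure_update (Bad := Bad) (t := Function.update t y a) hx (z :: b)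
  rw [Function.update_of_ne hxy, htx] at h2
  unfold moveTail
  rw [hty] at h1
  simp only [tailWeight, List.length_append, List.length_cons, List.append_eq_nil_iff,
    reduceCtorEq, and_false, if_false, List.length_nil, if_true, List.getLast_singleton, hbad]
    at h1 h2
  have e : (y :: (a ++ z :: b)).getLast (List.cons_ne_nil _ _)
      = (x :: z :: b).getLast (List.cons_ne_nil _ _) := by
    rw [List.getLast_cons (List.cons_ne_nil z b)]
    simp only [← List.cons_append]
    rw [List.getLast_append_of_ne_nil]
  rw [e] at h1
  omega

theorem MaxTails.head_of_adj (ht : MaxTails K S Bad t) {x y z : V} (hx : x ∈ S)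
    (htx : t x = []) (hbad : Bad x) (hz : z ∈ t y) (hadj : K.Adj x z) :
    ∃ q, t y = z :: q := by
  obtain ⟨a, b, hty⟩ := List.append_of_mem hz
  have hy : y ∈ S := by
    by_contra h; rw [ht.nil y h] at hz; simp at hz
  have hxy : x ≠ y := by rintro rfl; rw [htx] at hz; simp at hz
  have := ht.max _ (ht.toTails.move hx hy hty hxy hadj)
  rw [tailMeasure_move hx hy hty hxy htx hbad] at this
  have ha : a = [] := by
    by_contra h
    rw [if_neg h] at this; omega
  subst ha
  exact ⟨b, hty⟩

theorem MaxTails.move (ht : MaxTails K S Bad t) {x y z : V} {q : List V} (hx : x ∈ S)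
    (hy : y ∈ S) (htx : t x = []) (hbad : Bad x) (hty : t y = z :: q) (hadj : K.Adj x z) :
    MaxTails K S Bad (moveTail t x y [] (z :: q)) ∧ Bad y := by
  have hxy : x ≠ y := by rintro rfl; rw [htx] at hty; simp at hty
  have hm := ht.toTails.move hx hy (a := []) hty hxy hadj
  have h1 := tailMeasure_move hx hy (a := []) hty hxy htx hbad
  have h2 := ht.max _ hm
  refine ⟨⟨hm, fun t' ht' => (ht.max t' ht').trans (by omega)⟩, ?_⟩
  by_contra h
  simp [h] at h1
  omega

theorem MaxTails.mem_of_adj (ht : MaxTails K S Bad t) {x z : V} (hx : x ∈ S)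
    (hbad : Bad (tailEnd t x)) (hadj : K.Adj (tailEnd t x) z) : z ∈ S ∨ ∃ y, z ∈ t y := by
  by_contra! hcon
  have h1 : Tails K S (Function.update t x (t x ++ [z])) := by
    refine ht.toTails.update hx ?_ ?_ ?_
    · rw [← List.cons_append]
      refine List.isChain_append.2 ⟨ht.chain x, List.isChain_singleton _, ?_⟩
      intro p hp q hq
      simp only [List.head?_cons, Option.mem_def, Option.some.injEq] at hq
      rw [List.getLast?_eq_some_getLast (List.cons_ne_nil _ _)] at hp
      simp only [Option.mem_def, Option.some.injEq] at hp
      subst hp hq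
      exact hadj
    · refine List.nodup_append'.2 ⟨ht.nodup x, by simp, ?_⟩
      intro w hw hw'
      simp only [List.mem_singleton] at hw'
      subst hw'
      exact hcon.2 x hw
    · intro w hw
      rcases List.mem_append.1 hw with hw | hw
      · exact ⟨ht.notMem _ _ hw, fun y hy h => ht.disj y x hy h hw⟩
      · simp only [List.mem_singleton] at hw
        subst hw
        exact ⟨hcon.1, fun y _ => hcon.2 y⟩
  have h2 := ht.max _ h1
  have h3 := tailMeasure_update (Bad := Bad) (t := t) hx (t x ++ [z])
  have hb' : Bad ((x :: t x).getLast (List.cons_ne_nil _ _)) := hbad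
  simp only [tailWeight, hb', if_true, List.length_append, List.length_singleton] at h3
  rw [if_neg (show ¬ (t x ++ [z] = []) by simp)] at h3
  split_ifs at h3 <;> omega

/-- Reverse the part of the tail at `x` from position `i` on. -/
noncomputable def rotateTail (t : V → List V) (x : V) (i : ℕ) : V → List V :=
  Function.update t x ((t x).take i ++ ((t x).drop i).reverse)

theorem isChain_take_append_reverse_drop {x e : V} {l : List V} (hc : (x :: l).IsChain K.Adj)
    {i : ℕ} (hi : i < l.length) (he : (x :: l).getLast (List.cons_ne_nil _ _) = e)
    (hadj : K.Adj ((x :: l)[i]'(by simp; omega)) e) :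
    (x :: (l.take i ++ (l.drop i).reverse)).IsChain K.Adj := by
  have hsplit : x :: l = (x :: l).take (i + 1) ++ (x :: l).drop (i + 1) :=
    (List.take_append_drop _ _).symm
  rw [hsplit] at hc
  rw [List.take_succ_cons, List.drop_succ_cons] at hc
  rw [← List.cons_append]
  refine List.isChain_append.2 ⟨hc.left_of_append, ?_, ?_⟩
  · rw [List.isChain_reverse]
    exact hc.right_of_append.imp fun _ _ h => h.symm
  · intro p hp q hq
    rw [List.head?_reverse] at hq
    have hne : l.drop i ≠ [] := by rw [Ne, List.drop_eq_nil_iff]; omega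
    have hq' : q = e := by
      rw [List.getLast?_eq_some_getLast hne] at hq
      simp only [Option.mem_def, Option.some.injEq] at hq
      rw [← hq, ← he, List.getLast_drop, List.getLast_cons]
    have hp' : p = (x :: l)[i]'(by simp; omega) := by
      rw [← List.take_succ_cons, List.getLast?_eq_getElem?] at hp
      simp only [List.length_take, List.length_cons] at hp
      rw [min_eq_left (by omega), Nat.add_sub_cancel, List.getElem?_take_of_lt (by omega),
        List.getElem?_eq_getElem (by simp; omega)] at hp
      simpa using hp.symm
    rw [hp', hq']
    exact hadj

theorem MaxTails.rotate (ht : MaxTails K S Bad t) {x : V} (hx : x ∈ S) {i : ℕ}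
    (hi : i < (t x).length) (hbad : Bad (tailEnd t x))
    (hadj : K.Adj ((x :: t x)[i]'(by simp; omega)) (tailEnd t x)) :
    MaxTails K S Bad (rotateTail t x i) ∧ tailEnd (rotateTail t x i) x = (t x)[i] ∧
      Bad ((t x)[i]) := by
  have hperm : ((t x).take i ++ ((t x).drop i).reverse).Perm (t x) := by
    conv_rhs => rw [← List.take_append_drop i (t x)]
    exact List.Perm.append_left _ (List.reverse_perm _)
  have h1 : Tails K S (rotateTail t x i) := by
    refine ht.toTails.update hx ?_ ?_ ?_
    · exact isChain_take_append_reverse_drop (ht.chain x) hi rfl hadj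
    · exact hperm.nodup_iff.2 (ht.nodup x)
    · intro w hw
      have hw := hperm.mem_iff.1 hw
      exact ⟨ht.notMem _ _ hw, fun y hy h => ht.disj y x hy h hw⟩
  have he : ∀ hne, (x :: ((t x).take i ++ ((t x).drop i).reverse)).getLast hne = (t x)[i] := by
    intro hne
    have hd : ((t x).drop i).reverse ≠ [] := by
      rw [Ne, List.reverse_eq_nil_iff, List.drop_eq_nil_iff]; omega
    rw [List.getLast_cons (by simp; omega), List.getLast_append_of_ne_nil _ hd,
      List.getLast_reverse, List.head_drop]
  have h2 := ht.max _ h1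
  have h3 := tailMeasure_update (Bad := Bad) (t := t) hx
    ((t x).take i ++ ((t x).drop i).reverse)
  have hb' : Bad ((x :: t x).getLast (List.cons_ne_nil _ _)) := hbad
  have hne : t x ≠ [] := by rintro h; rw [h] at hi; simp at hi
  have hne' : (t x).take i ++ ((t x).drop i).reverse ≠ [] := by
    intro h
    have := hperm.length_eq
    rw [h, List.length_nil] at this
    omega
  simp only [tailWeight, he, hperm.length_eq, hb', if_true, if_neg hne, if_neg hne'] at h3
  unfold rotateTail at h2 ⊢
  refine ⟨⟨h1, fun t' ht' => (ht.max t' ht').trans (by omega)⟩, ?_, ?_⟩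
  · unfold tailEnd
    simp only [Function.update_self]
    exact he _
  · by_contra h
    rw [if_neg h] at h3
    omega

end TailSystems

section TailSystems

open scoped Classical

variable {V : Type*} [DecidableEq V] [Fintype V] {K : SimpleGraph V} {S : Finset V}
  {Bad : V → Prop} {t : V → List V}

/-- The set of neighbours of `x`. -/
noncomputable def nbr (K : SimpleGraph V) (x : V) : Finset V := Finset.univ.filter (K.Adj x)

@[simp] theorem mem_nbr {x y : V} : y ∈ nbr K x ↔ K.Adj x y := by simp [nbr]

theorem Tails.nodup_cons (ht : Tails K S t) {x : V} (hx : x ∈ S) : (x :: t x).Nodup :=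
  List.nodup_cons.2 ⟨fun h => ht.notMem _ _ h hx, ht.nodup x⟩

theorem Tails.disjoint_cons (ht : Tails K S t) {x y : V} (hx : x ∈ S) (hy : y ∈ S)
    (hxy : x ≠ y) : List.Disjoint (x :: t x) (y :: t y) := by
  intro z h1 h2
  rcases List.mem_cons.1 h1 with rfl | h1
  · rcases List.mem_cons.1 h2 with rfl | h2
    · exact hxy rfl
    · exact ht.notMem _ _ h2 hx
  · rcases List.mem_cons.1 h2 with rfl | h2
    · exact ht.notMem _ _ h1 hy
    · exact ht.disj x y hxy h1 h2

theorem MaxTails.mem_cons_of_adj {n : ℕ} {u : ℤ → V} (hu : CyclicEnum K n u)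
    (hb : CircBound K n) (ht : MaxTails K (cycVerts n u) Bad t) {k : ℕ} (hk : n < 2 * k)
    (hBad : ∀ x, Bad x → k ≤ (nbr K x).card) {x z : V} (hx : x ∈ cycVerts n u)
    (hne : t x ≠ []) (hbad : Bad (tailEnd t x)) (hadj : K.Adj (tailEnd t x) z) :
    z ∈ x :: t x := by
  by_contra hz
  set S := cycVerts n u with hS
  set e := tailEnd t x with he
  set P : V → List V := fun y => List.rdropWhile (fun z => decide (¬ K.Adj e z)) (y :: t y)
    with hP
  have hpre : ∀ y, P y <+: y :: t y := fun y => List.rdropWhile_prefix _ _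
  have hlast : ∀ y, (h : P y ≠ []) → K.Adj e ((P y).getLast h) := by
    intro y h
    have := List.rdropWhile_last_not _ _ h
    by_contra h'
    exact this (decide_eq_true (p := ¬ K.Adj e _) h')
  have hhead : ∀ y, P y ≠ [] → (P y).head? = some y := by
    intro y h
    obtain ⟨s, hs⟩ := hpre y
    rcases hPy : P y with _ | ⟨w, l⟩
    · exact absurd hPy h
    · rw [hPy] at hs
      simp only [List.cons_append, List.cons.injEq] at hs
      simp [hs.1]
  have hmemP : ∀ y, ∀ w ∈ y :: t y, K.Adj e w → w ∈ P y := by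
    intro y w hw hew
    rw [← @List.rdropWhile_append_rtakeWhile _ (fun z => decide (¬ K.Adj e z)) (y :: t y)] at hw
    rcases List.mem_append.1 hw with h | h
    · exact h
    · have := List.mem_rtakeWhile_imp h
      simp [hew] at this
  have het : e ∈ t x := by
    rw [he, tailEnd, List.getLast_cons hne]
    exact List.getLast_mem _
  have heS : e ∉ S := ht.notMem _ _ het
  have heP : ∀ y ∈ S, e ∉ P y := by
    intro y hy h
    rcases eq_or_ne y x with rfl | hyx
    · obtain ⟨s, hs⟩ := hpre y
      rcases s.eq_nil_or_concat with rfl | ⟨s', w, rfl⟩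
      · have hPne : P y ≠ [] := by rintro h'; rw [h'] at h; simp at h
        have h1 := hlast y hPne
        rw [List.append_nil] at hs
        have : (P y).getLast hPne = e := by
          rw [he, tailEnd]; congr 1
        rw [this] at h1
        exact K.loopless.irrefl _ h1
      · have hnd := ht.nodup_cons hy
        have hw : e = w := by
          rw [he, tailEnd]
          simp only [← hs]
          simp
        rw [← hs] at hnd
        exact (List.nodup_append'.1 hnd).2.2 h (by simp [hw])
    · exact ht.disjoint_cons hy hx hyx ((hpre y).subset h) (List.mem_cons_of_mem _ het)
  have hpath : ∀ y ∈ S, (h : P y ≠ []) → PathOn K (P y).toFinset y ((P y).getLast h) := by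
    intro y hy h
    refine PathOn.of_list ?_ ?_ (hhead y h) (List.getLast?_eq_some_getLast h)
    · exact (ht.nodup_cons hy).sublist (hpre y).sublist
    · obtain ⟨r, hr⟩ := hpre y
      have := ht.chain y
      rw [← hr] at this
      exact (List.isChain_append.1 this).1
  have hcardP : ∀ y ∈ S, (P y).toFinset.card = (P y).length := fun y hy =>
    List.toFinset_card_of_nodup ((ht.nodup_cons hy).sublist (hpre y).sublist)
  have hdisP : ∀ y ∈ S, ∀ y' ∈ S, y ≠ y' → Disjoint (P y).toFinset (P y').toFinset := by
    intro y hy y' hy' hyy'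
    rw [Finset.disjoint_left]
    intro w h1 h2
    simp only [List.mem_toFinset] at h1 h2
    exact ht.disjoint_cons hy hy' hyy' ((hpre y).subset h1) ((hpre y').subset h2)
  have hPS : ∀ y ∈ S, ∀ w ∈ P y, w ∈ S → w = y := by
    intro y hy w hw hwS
    rcases List.mem_cons.1 ((hpre y).subset hw) with h | h
    · exact h
    · exact absurd hwS (ht.notMem _ _ h)
  have hgap : ∀ i j : ℤ, i < j → j < i + n → P (u i) ≠ [] → P (u j) ≠ [] →
      (((P (u i)).length + (P (u j)).length : ℕ) : ℤ) ≤ j - i := by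
    intro i j hij hji h1 h2
    have hi := hu.apply_mem i
    have hj := hu.apply_mem j
    have hne : u i ≠ u j := fun h => by
      have := hu.injOn (a := i) le_rfl (by omega) hij.le hji h
      omega
    have hd1 : Disjoint (P (u i)).toFinset {e} := by
      simpa using heP _ hi
    have hd2 : Disjoint ((P (u i)).toFinset ∪ {e}) (P (u j)).toFinset := by
      rw [Finset.disjoint_union_left]
      refine ⟨hdisP _ hi _ hj hne, ?_⟩
      simpa using heP _ hj
    have h3 := ((hpath _ hi h1).join (PathOn.single K e) (hlast _ h1).symm hd1).join
      (hpath _ hj h2).symm (hlast _ h2) hd2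
    have h4 := hu.bridge_of_mem hb h3 ?_ hij hji
    · rw [Finset.card_union_of_disjoint hd2, Finset.card_union_of_disjoint hd1, hcardP _ hi,
        hcardP _ hj, Finset.card_singleton] at h4
      push_cast at h4 ⊢
      omega
    · intro k hjk hki hmem
      have hk := hu.apply_mem k
      simp only [Finset.mem_union, List.mem_toFinset, Finset.mem_singleton] at hmem
      rcases hmem with (h | h) | h
      · have := hu.injOn (a := i) (by omega) (by omega) le_rfl (by omega) (hPS _ hi _ h hk)
        omega
      · exact heS (h ▸ hk)
      · have := hu.injOn (a := i) (by omega) (by omega) (by omega) (by omega) (hPS _ hj _ h hk)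
        omega
  have hPx : P x ≠ [] := by
    have h1 := ht.chain x
    have h2 : x :: t x = (x :: (t x).dropLast) ++ [e] := by
      rw [List.cons_append]
      congr 1
      rw [he, tailEnd, List.getLast_cons hne]
      exact (List.dropLast_append_getLast hne).symm
    rw [h2] at h1
    have h3 := (List.isChain_append.1 h1).2.2 _
      (List.getLast?_eq_some_getLast (List.cons_ne_nil _ _)) e rfl
    have := hmemP x _ (by rw [h2]; exact List.mem_append_left _ (List.getLast_mem _)) h3.symm
    intro h
    rw [h] at this
    simp at this
  obtain ⟨y, hy, hzy⟩ : ∃ y ∈ S, z ∈ y :: t y := by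
    rcases ht.mem_of_adj hx hbad hadj with h | ⟨y, h⟩
    · exact ⟨z, h, by simp⟩
    · refine ⟨y, ?_, by simp [h]⟩
      by_contra hyS
      rw [ht.nil y hyS] at h
      simp at h
  have hPy : P y ≠ [] := by
    have := hmemP y z hzy hadj
    intro h; rw [h] at this; simp at this
  have hyx : y ≠ x := by rintro rfl; exact hz hzy
  have hn : (0 : ℤ) < n := by exact_mod_cast hu.pos
  have hhalf : ∀ i, P (u i) ≠ [] → 2 * (P (u i)).length ≤ n := by
    intro i hi
    obtain ⟨w, hw, hwi, hPw⟩ : ∃ w ∈ S, w ≠ u i ∧ P w ≠ [] := by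
      by_cases h : x = u i
      · exact ⟨y, hy, by rw [← h]; exact hyx, hPy⟩
      · exact ⟨x, hx, h, hPx⟩
    obtain ⟨j', rfl⟩ := hu.mem_cycVerts.1 hw
    obtain ⟨j, h1, h2, h3⟩ := hu.exists_rep i j'
    rw [← h3] at hwi hPw
    have hij : i ≠ j := by rintro rfl; exact hwi rfl
    have g1 := hgap i j (by omega) h2 hi hPw
    have g2 := hgap j (i + n) (by omega) (by omega) hPw (by rwa [hu.add_period])
    rw [hu.add_period] at g2
    push_cast at g1 g2
    omega
  have hsum := sum_le_period (L := n) (f := fun i => 2 * (P (u i)).length)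
    (fun i => by simp only [hu.add_period]) (by
      intro i j hij hji h1 h2
      have hi : P (u i) ≠ [] := by intro h; simp [h] at h1
      have hj : P (u j) ≠ [] := by intro h; simp [h] at h2
      rcases hji.lt_or_eq with h | h
      · have := hgap i j hij h hi hj
        push_cast at this ⊢
        omega
      · have g := hhalf i hi
        have : u j = u i := by rw [h, hu.add_period]
        rw [this]
        push_cast
        omega) 0
  rw [← hu.sum_cycVerts (fun y => 2 * (P y).length), ← Finset.mul_sum] at hsum
  have hdeg : (nbr K e).card ≤ ∑ y ∈ cycVerts n u, (P y).length := by
    calc (nbr K e).card ≤ ((cycVerts n u).biUnion fun y => (P y).toFinset).card := by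
          apply Finset.card_le_card
          intro w hw
          rw [mem_nbr] at hw
          rw [Finset.mem_biUnion]
          rcases ht.mem_of_adj hx hbad hw with h | ⟨y, h⟩
          · exact ⟨w, h, by simpa using hmemP w w (by simp) hw⟩
          · refine ⟨y, ?_, by simpa using hmemP y w (by simp [h]) hw⟩
            by_contra hyS
            rw [ht.nil y hyS] at h
            simp at h
      _ ≤ ∑ y ∈ cycVerts n u, (P y).toFinset.card := Finset.card_biUnion_le
      _ ≤ _ := Finset.sum_le_sum fun y _ => List.toFinset_card_le _
  have := hBad _ hbad
  omega

/-- If some nontrivial tail of a maximum family ends in `Bad`, then rotations of that tail produce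
a cycle with many vertices whose neighbourhoods are contained in it. -/
theorem exists_cycle_of_nontrivial {n : ℕ} {u : ℤ → V} (hu : CyclicEnum K n u)
    (hb : CircBound K n) {k : ℕ} (hk : n < 2 * k) (hBad : ∀ x, Bad x → k ≤ (nbr K x).card)
    (hex : ∃ t x, MaxTails K (cycVerts n u) Bad t ∧ x ∈ cycVerts n u ∧ t x ≠ [] ∧
      Bad (tailEnd t x)) :
    ∃ (R L : Finset V) (p q : V), PathOn K R p q ∧ K.Adj q p ∧ k + 1 ≤ R.card ∧ L ⊆ R ∧
      k ≤ L.card ∧ ∀ w ∈ L, k ≤ (nbr K w).card ∧ nbr K w ⊆ R := by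
  set S := cycVerts n u with hS
  have hidx : ∀ t x, MaxTails K S Bad t → x ∈ S → t x ≠ [] → Bad (tailEnd t x) →
      ∀ w, K.Adj (tailEnd t x) w → ∃ m : ℕ, m < (t x).length ∧ (x :: t x)[m]? = some w := by
    intro t x ht hx hne hbad w hw
    obtain ⟨m, hm, hmw⟩ := List.mem_iff_getElem.1
      (ht.mem_cons_of_adj hu hb hk hBad hx hne hbad hw)
    refine ⟨m, ?_, by rw [List.getElem?_eq_getElem hm, hmw]⟩
    by_contra hlt
    have : m = (x :: t x).length - 1 := by simp only [List.length_cons] at hm ⊢; omega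
    subst this
    have : tailEnd t x = w := by
      rw [tailEnd, List.getLast_eq_getElem]
      exact hmw
    rw [this] at hw
    exact K.loopless.irrefl _ hw
  have hex' : ∃ m : ℕ, ∃ t x w, MaxTails K S Bad t ∧ x ∈ S ∧ t x ≠ [] ∧ Bad (tailEnd t x) ∧
      K.Adj (tailEnd t x) w ∧ (x :: t x)[m]? = some w := by
    obtain ⟨t, x, ht, hx, hne, hbad⟩ := hex
    obtain ⟨w, hw⟩ := Finset.card_pos.1 ((show 0 < k by omega).trans_le (hBad _ hbad))
    rw [mem_nbr] at hw
    obtain ⟨m, -, hm⟩ := hidx t x ht hx hne hbad w hw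
    exact ⟨m, t, x, w, ht, hx, hne, hbad, hw, hm⟩
  obtain ⟨m, ⟨t, x, z, ht, hx, hne, hbad, hz, hmz⟩, hmin⟩ : ∃ m : ℕ, (∃ t x w,
      MaxTails K S Bad t ∧ x ∈ S ∧ t x ≠ [] ∧ Bad (tailEnd t x) ∧
      K.Adj (tailEnd t x) w ∧ (x :: t x)[m]? = some w) ∧ ∀ j < m, ¬ (∃ t x w,
      MaxTails K S Bad t ∧ x ∈ S ∧ t x ≠ [] ∧ Bad (tailEnd t x) ∧
      K.Adj (tailEnd t x) w ∧ (x :: t x)[j]? = some w) :=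
    ⟨Nat.find hex', Nat.find_spec hex', fun j hj => Nat.find_min hex' hj⟩
  have hnd := ht.nodup_cons hx
  set l := x :: t x with hl
  set e := tailEnd t x with he
  have hlen : l.length = (t x).length + 1 := by simp [hl]
  have hml : m < l.length := (List.getElem?_eq_some_iff.1 hmz).1
  set R := (l.drop m).toFinset with hR
  set I : Finset (Fin (t x).length) :=
    Finset.univ.filter fun i => K.Adj e (l[(i : ℕ)]'(by have := i.2; omega)) with hI
  set L := I.image fun i : Fin (t x).length => (t x)[(i : ℕ)] with hL
  have hgt : ∀ i : Fin (t x).length, (t x)[(i : ℕ)] = l[(i : ℕ) + 1] := by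
    intro i; simp [hl]
  have hIm : ∀ i ∈ I, m ≤ i := by
    intro i hi
    by_contra hlt
    simp only [hI, Finset.mem_filter, Finset.mem_univ, true_and] at hi
    exact hmin i (by omega) ⟨t, x, _, ht, hx, hne, hbad, hi,
      List.getElem?_eq_getElem (hlen ▸ by have := i.2; omega)⟩
  have hmemR : ∀ j, (hj : j < l.length) → m ≤ j → l[j] ∈ R := by
    intro j hj hmj
    rw [hR, List.mem_toFinset, List.mem_iff_getElem]
    exact ⟨j - m, by simp; omega, by simp [hmj]⟩
  have heR : e ∈ R := by
    have := hmemR (l.length - 1) (by omega) (by omega)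
    rw [he, tailEnd, List.getLast_eq_getElem]
    exact this
  have hnbr : nbr K e ⊆ I.image fun i : Fin (t x).length => l[(i : ℕ)]'(by have := i.2; omega) := by
    intro w hw
    rw [mem_nbr] at hw
    obtain ⟨j, hj, hjw⟩ := hidx t x ht hx hne hbad w hw
    obtain ⟨hjl, hjw'⟩ := List.getElem?_eq_some_iff.1 hjw
    rw [Finset.mem_image]
    exact ⟨⟨j, hj⟩, by simp only [hI, Finset.mem_filter, Finset.mem_univ, true_and]; rwa [hjw'],
      hjw'⟩
  have hdeg := hBad _ hbad
  refine ⟨R, L, z, e, ?_, hz, ?_, ?_, ?_, ?_⟩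
  · have hdne : l.drop m ≠ [] := by rw [Ne, List.drop_eq_nil_iff]; omega
    refine PathOn.of_list (hnd.sublist (List.drop_sublist _ _)) ((ht.chain x).suffix
      (List.drop_suffix _ _)) ?_ ?_
    · rw [List.head?_drop, hmz]
    · rw [List.getLast?_eq_some_getLast hdne, List.getLast_drop]; rfl
  · have : insert e (nbr K e) ⊆ R := by
      intro w hw
      rcases Finset.mem_insert.1 hw with rfl | hw
      · exact heR
      · obtain ⟨i, hi, rfl⟩ := Finset.mem_image.1 (hnbr hw)
        exact hmemR _ _ (hIm i hi)
    have h2 := Finset.card_le_card this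
    rw [Finset.card_insert_of_notMem (by simp)] at h2
    omega
  · intro w hw
    obtain ⟨i, hi, rfl⟩ := Finset.mem_image.1 hw
    simp only [hgt]
    exact hmemR _ _ (by have := hIm i hi; omega)
  · rw [hL, Finset.card_image_of_injective]
    · have := (Finset.card_le_card hnbr).trans Finset.card_image_le
      omega
    · intro i j hij
      exact Fin.ext (((ht.nodup x).getElem_inj_iff).1 hij)
  · intro w hw
    obtain ⟨i, hi, rfl⟩ := Finset.mem_image.1 hw
    have hmi := hIm i hi
    simp only [hI, Finset.mem_filter, Finset.mem_univ, true_and] at hi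
    obtain ⟨hr1, hr2, hr3⟩ := ht.rotate hx i.2 hbad hi.symm
    refine ⟨hBad _ hr3, ?_⟩
    intro v hv
    rw [mem_nbr] at hv
    have hrx : rotateTail t x i x = (t x).take i ++ ((t x).drop i).reverse := by
      simp [rotateTail]
    have hperm : ((t x).take i ++ ((t x).drop i).reverse).Perm (t x) := by
      conv_rhs => rw [← List.take_append_drop i (t x)]
      exact List.Perm.append_left _ (List.reverse_perm _)
    have hrne : rotateTail t x i x ≠ [] := by
      rw [hrx]; intro h
      have := hperm.length_eq
      rw [h, List.length_nil] at this
      have := i.2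
      omega
    have hvl := hr1.mem_cons_of_adj hu hb hk hBad hx hrne (by rwa [hr2]) (by rwa [hr2])
    rw [hrx] at hvl
    have hvl : v ∈ l := ((hperm.cons x).mem_iff).1 hvl
    obtain ⟨j, hj, rfl⟩ := List.mem_iff_getElem.1 hvl
    rcases Nat.lt_or_ge j m with hjm | hjm
    · exfalso
      refine hmin j hjm ⟨rotateTail t x i, x, l[j], hr1, hx, hrne, by rwa [hr2], by rwa [hr2], ?_⟩
      rw [hrx, ← List.cons_append, List.getElem?_append_left (by simp; omega),
        ← List.take_succ_cons, List.getElem?_take_of_lt (by omega)]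
      exact List.getElem?_eq_getElem hj
    · exact hmemR j hj hjm

end TailSystems

section Trivial

open scoped Classical

variable {V : Type*} [DecidableEq V] [Fintype V] {K : SimpleGraph V} {S : Finset V}
  {Bad : V → Prop} {t : V → List V}

/-- A move of a tail, together with all of its vertices, to a bad vertex without a tail. -/
def TailStep (K : SimpleGraph V) (S : Finset V) (Bad : V → Prop) (t t' : V → List V) : Prop :=
  ∃ x y z q, x ∈ S ∧ y ∈ S ∧ t x = [] ∧ Bad x ∧ t y = z :: q ∧ K.Adj x z ∧
    t' = moveTail t x y [] (z :: q)

theorem moveTail_left (t : V → List V) (x y : V) (a b : List V) : moveTail t x y a b x = b := by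
  simp [moveTail]

theorem moveTail_right (t : V → List V) {x y : V} (h : x ≠ y) (a b : List V) :
    moveTail t x y a b y = a := by
  simp [moveTail, h.symm]

theorem moveTail_of_ne (t : V → List V) {x y w : V} (hx : w ≠ x) (hy : w ≠ y) (a b : List V) :
    moveTail t x y a b w = t w := by
  simp [moveTail, hx, hy]

/-- If in maximum families every bad end is a trivial tail, then the bad vertices reachable by
moving tails have all their outside neighbours in a small set of heads of tails. -/
theorem exists_heads_of_trivial (K : SimpleGraph V) (S : Finset V) (Bad : V → Prop)
    (hno : ¬ ∃ t x, MaxTails K S Bad t ∧ x ∈ S ∧ t x ≠ [] ∧ Bad (tailEnd t x)) :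
    ∃ (t : V → List V) (Y W : Finset V), Tails K S t ∧ Y ⊆ S ∧ Disjoint W S ∧
      (∀ y ∈ Y, Bad y ∧ ∀ z, K.Adj y z → z ∈ S ∨ z ∈ W) ∧
      (∀ y ∈ Y, ∃ o : V → V, Set.InjOn o W ∧ ∀ z ∈ W, o z ∈ S ∧ o z ≠ y ∧ K.Adj (o z) z) ∧
      (∀ z ∈ W, ∃ y ∈ Y, K.Adj y z) ∧
      W.card + (S.filter fun x => Bad (tailEnd t x)).card ≤ Y.card := by
  obtain ⟨t₀, ht₀⟩ := exists_maxTails K S Bad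
  set Re : (V → List V) → Prop := fun t => Relation.ReflTransGen (TailStep K S Bad) t₀ t with hRe
  have hmax : ∀ t, Re t → MaxTails K S Bad t := by
    intro t ht
    induction ht with
    | refl => exact ht₀
    | tail _ hs ih =>
      obtain ⟨x, y, z, q, hx, hy, htx, hbad, hty, hadj, rfl⟩ := hs
      exact (ih.move hx hy htx hbad hty hadj).1
  have hheads : ∀ t, Re t → ∀ z, (∃ x, (t x).head? = some z) ↔ ∃ x, (t₀ x).head? = some z := by
    intro t ht
    induction ht with
    | refl => exact fun z => Iff.rfl
    | @tail t t' _ hs ih =>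
      intro w
      rw [← ih w]
      obtain ⟨x, y, z, q, hx, hy, htx, hbad, hty, hadj, rfl⟩ := hs
      have hxy : x ≠ y := by rintro rfl; rw [htx] at hty; simp at hty
      constructor
      · rintro ⟨v, hv⟩
        rcases eq_or_ne v x with rfl | hvx
        · rw [moveTail_left, ← hty] at hv
          exact ⟨y, hv⟩
        · rcases eq_or_ne v y with rfl | hvy
          · rw [moveTail_right _ hxy] at hv; simp at hv
          · rw [moveTail_of_ne _ hvx hvy] at hv
            exact ⟨v, hv⟩
      · rintro ⟨v, hv⟩
        rcases eq_or_ne v x with rfl | hvx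
        · rw [htx] at hv; simp at hv
        · rcases eq_or_ne v y with rfl | hvy
          · exact ⟨x, by rw [moveTail_left, ← hty, hv]⟩
          · exact ⟨v, by rw [moveTail_of_ne _ hvx hvy, hv]⟩
  set Y : Finset V := S.filter fun x => Bad x ∧ ∃ t, Re t ∧ t x = [] with hY
  have howner : ∀ t, Re t → ∀ x z, (t₀ x).head? = some z → (t x).head? = some z ∨ x ∈ Y := by
    intro t ht
    induction ht with
    | refl => exact fun x z h => Or.inl h
    | @tail t t' hr hs ih =>
      intro v w hv
      rcases ih v w hv with h | h
      · have hre : Re t' := Relation.ReflTransGen.tail hr hs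
        have hst := hs
        obtain ⟨x, y, z, q, hx, hy, htx, hbad, hty, hadj, rfl⟩ := hs
        have hxy : x ≠ y := by rintro rfl; rw [htx] at hty; simp at hty
        rcases eq_or_ne v x with rfl | hvx
        · rw [htx] at h; simp at h
        · rcases eq_or_ne v y with rfl | hvy
          · right
            rw [hY, Finset.mem_filter]
            exact ⟨hy, ((hmax t hr).move hx hy htx hbad hty hadj).2, _, hre,
              moveTail_right _ hxy _ _⟩
          · left; rw [moveTail_of_ne _ hvx hvy, h]
      · exact Or.inr h
  set W : Finset V := Finset.univ.filter fun z =>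
    (∃ y ∈ Y, K.Adj y z) ∧ ∃ x, (t₀ x).head? = some z with hW
  have hmemY : ∀ y ∈ Y, y ∈ S ∧ Bad y ∧ ∃ t, MaxTails K S Bad t ∧ Re t ∧ t y = [] := by
    intro y hy
    rw [hY, Finset.mem_filter] at hy
    obtain ⟨h1, h2, t, h3, h4⟩ := hy
    exact ⟨h1, h2, t, hmax t h3, h3, h4⟩
  have hmemW : ∀ z, z ∈ W ↔ (∃ y ∈ Y, K.Adj y z) ∧ ∃ x, (t₀ x).head? = some z := by
    intro z; simp [hW]
  have hown : ∀ t, Re t → ∀ x z, (t x).head? = some z → x ∈ S ∧ K.Adj x z ∧ z ∉ S ∧ z ∈ t x := by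
    intro t ht x z h
    have hm := hmax t ht
    have hz : z ∈ t x := List.mem_of_head? h
    refine ⟨?_, ?_, hm.notMem _ _ hz, hz⟩
    · by_contra hx; rw [hm.nil x hx] at hz; simp at hz
    · have := hm.chain x
      rcases hl : t x with _ | ⟨w, l⟩
      · rw [hl] at hz; simp at hz
      · rw [hl] at this h
        simp only [List.head?_cons, Option.some.injEq] at h
        subst h
        exact (List.isChain_cons_cons.1 this).1
  refine ⟨t₀, Y, W, ht₀.toTails, Finset.filter_subset _ _, ?_, ?_, ?_, ?_, ?_⟩
  · rw [Finset.disjoint_left]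
    intro z hz
    obtain ⟨x, hx⟩ := ((hmemW z).1 hz).2
    exact (hown t₀ .refl x z hx).2.2.1
  · intro y hy
    obtain ⟨hyS, hbad, t, hm, hr, hty⟩ := hmemY y hy
    refine ⟨hbad, fun z hz => ?_⟩
    have hend : tailEnd t y = y := by simp [tailEnd, hty]
    rcases hm.mem_of_adj (x := y) (z := z) hyS (by rwa [hend]) (by rwa [hend]) with h | ⟨x, h⟩
    · exact Or.inl h
    · right
      obtain ⟨q, hq⟩ := hm.head_of_adj hyS hty hbad h hz
      exact (hmemW z).2 ⟨⟨y, hy, hz⟩, (hheads t hr z).1 ⟨x, by simp [hq]⟩⟩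
  · intro y hy
    obtain ⟨hyS, hbad, t, hm, hr, hty⟩ := hmemY y hy
    have : ∀ z ∈ W, ∃ x, (t x).head? = some z := fun z hz =>
      (hheads t hr z).2 ((hmemW z).1 hz).2
    refine ⟨fun z => if h : z ∈ W then (this z h).choose else z, ?_, ?_⟩
    · intro z hz w hw hzw
      have hz' : z ∈ W := hz
      have hw' : w ∈ W := hw
      simp only [hz', hw', dif_pos] at hzw
      have h1 := (this z hz').choose_spec
      have h2 := (this w hw').choose_spec
      rw [hzw, h2] at h1
      exact (Option.some.inj h1).symm
    · intro z hz
      simp only [hz, dif_pos]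
      have h1 := (this z hz).choose_spec
      obtain ⟨h2, h3, -, h4⟩ := hown t hr _ _ h1
      refine ⟨h2, ?_, h3⟩
      intro h
      rw [h, hty] at h1
      simp at h1
  · intro z hz
    exact ((hmemW z).1 hz).1
  · have : ∀ z ∈ W, ∃ x, (t₀ x).head? = some z := fun z hz => ((hmemW z).1 hz).2
    choose! o ho using this
    have hinj : Set.InjOn o W := by
      intro z hz w hw hzw
      have h1 := ho z hz
      rw [hzw, ho w hw] at h1
      exact (Option.some.inj h1).symm
    rw [← Finset.card_image_of_injOn hinj, ← Finset.card_union_of_disjoint]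
    · apply Finset.card_le_card
      intro x hx
      rcases Finset.mem_union.1 hx with hx | hx
      · obtain ⟨z, hz, rfl⟩ := Finset.mem_image.1 hx
        obtain ⟨⟨y, hy, hyz⟩, -⟩ := (hmemW z).1 hz
        obtain ⟨hyS, hbad, t, hm, hr, hty⟩ := hmemY y hy
        rcases howner t hr _ _ (ho z hz) with h | h
        · obtain ⟨hoS, -, -, h4⟩ := hown t hr _ _ h
          obtain ⟨q, hq⟩ := hm.head_of_adj hyS hty hbad h4 hyz
          have hne : y ≠ o z := by intro h'; rw [← h', hty] at hq; simp at hq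
          rw [hY, Finset.mem_filter]
          exact ⟨hoS, (hm.move hyS hoS hty hbad hq hyz).2, _,
            hr.tail ⟨y, o z, z, q, hyS, hoS, hty, hbad, hq, hyz, rfl⟩, moveTail_right _ hne _ _⟩
        · exact h
      · rw [Finset.mem_filter] at hx
        have htx : t₀ x = [] := by
          by_contra h
          exact hno ⟨t₀, x, ht₀, hx.1, h, hx.2⟩
        rw [hY, Finset.mem_filter]
        exact ⟨hx.1, by simpa [tailEnd, htx] using hx.2, t₀, .refl, htx⟩
    · rw [Finset.disjoint_left]
      intro x hx hx'
      obtain ⟨z, hz, rfl⟩ := Finset.mem_image.1 hx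
      rw [Finset.mem_filter] at hx'
      refine hno ⟨t₀, o z, ht₀, hx'.1, ?_, hx'.2⟩
      intro h
      have := ho z hz
      rw [h] at this
      simp at this

end Trivial

section Arcs

variable {V : Type*} [DecidableEq V] {K G : SimpleGraph V}

/-- A path of `K` from `a` to `b` with vertex set `T` of size `N`. -/
def SPath (K : SimpleGraph V) (T : Finset V) (N : ℤ) (a b : V) : Prop :=
  PathOn K T a b ∧ (T.card : ℤ) = N

namespace SPath

variable {T T' : Finset V} {N N' : ℤ} {a b c d : V}

theorem single (K : SimpleGraph V) (a : V) : SPath K {a} 1 a a :=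
  ⟨PathOn.single K a, by simp⟩

theorem symm (h : SPath K T N a b) : SPath K T N b a := ⟨h.1.symm, h.2⟩

theorem join (h : SPath K T N a b) (h' : SPath K T' N' c d) (hbc : K.Adj b c)
    (hd : Disjoint T T') : SPath K (T ∪ T') (N + N') a d :=
  ⟨h.1.join h'.1 hbc hd, by rw [Finset.card_union_of_disjoint hd, Nat.cast_add, h.2, h'.2]⟩

theorem le_of_adj {n : ℕ} (hb : CircBound K n) (h : SPath K T N a b) (hab : K.Adj b a) : N ≤ n := by
  rw [← h.2]; exact_mod_cast hb _ _ _ h.1 hab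

end SPath

/-- The vertices `u i, …, u j` of a closed walk. -/
noncomputable def seg (u : ℤ → V) (i j : ℤ) : Finset V := (Finset.Icc i j).image u

theorem mem_seg {u : ℤ → V} {i j : ℤ} {x : V} : x ∈ seg u i j ↔ ∃ k, (i ≤ k ∧ k ≤ j) ∧ u k = x := by
  simp [seg]

theorem disjoint_singleton_seg {u : ℤ → V} {i j : ℤ} {s : V} (hs : ∀ k, u k ≠ s) :
    Disjoint {s} (seg u i j) := by
  rw [Finset.disjoint_singleton_left, mem_seg]
  rintro ⟨k, -, hk⟩
  exact hs k hk

theorem disjoint_seg_singleton {u : ℤ → V} {i j : ℤ} {s : V} (hs : ∀ k, u k ≠ s) :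
    Disjoint (seg u i j) {s} := (disjoint_singleton_seg hs).symm

namespace CyclicEnum

variable {n : ℕ} {u : ℤ → V}

theorem sPath (hu : CyclicEnum K n u) {i j : ℤ} (hij : i ≤ j) (hj : j < i + n) :
    SPath K (seg u i j) (j + 1 - i) (u i) (u j) :=
  ⟨hu.segment hij hj, by rw [seg, hu.card_image hj]; omega⟩

theorem seg_disjoint (hu : CyclicEnum K n u) {i j k l : ℤ} (hjk : j < k) (hl : l < i + n) :
    Disjoint (seg u i j) (seg u k l) := hu.disjoint_image hjk hl

theorem seg_disjoint' (hu : CyclicEnum K n u) {i j k l : ℤ} (hjk : l < i) (hl : j < k + n) :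
    Disjoint (seg u i j) (seg u k l) := (hu.disjoint_image hjk hl).symm

theorem adj_succ (hu : CyclicEnum K n u) (hn : 2 ≤ n) (i : ℤ) : K.Adj (u i) (u (i + 1)) := by
  apply hu.adj
  intro h
  have := hu.injOn (a := i) le_rfl (by omega) (by omega) (by omega) h
  omega

end CyclicEnum

end Arcs

section FirstBound

open scoped Classical

variable {V : Type*} [DecidableEq V] [Fintype V] {G K : SimpleGraph V} {L h : ℕ} {c u : ℤ → V}

/-- Let `u 0`, `u 1` be consecutive on a longest cycle, and let `o` choose distinct neighbours on
the cycle for the vertices of a set `W` outside. The neighbours of `u 0` in `W` force non-neighbours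
of `u 1`. -/
theorem card_nbr_add_card_nbr_lt (hu : CyclicEnum K h u) (hb : CircBound K h) (h2 : 2 ≤ h)
    {W : Finset V} (hW : Disjoint W (cycVerts h u)) {o : V → V} (ho : Set.InjOn o W)
    (hoW : ∀ z ∈ W, o z ∈ cycVerts h u ∧ o z ≠ u 0 ∧ K.Adj (o z) z) :
    (nbr K (u 1) ∩ cycVerts h u).card + (nbr K (u 0) ∩ W).card + 1 ≤ h := by
  have hs : ∀ z ∈ W, ∀ k, u k ≠ z := by
    rintro z hz k rfl
    exact Finset.disjoint_left.1 hW hz (hu.apply_mem k)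
  have hj : ∀ z ∈ W, ∃ j : ℤ, 1 ≤ j ∧ j < h ∧ u j = o z := by
    intro z hz
    obtain ⟨h1, h3, -⟩ := hoW z hz
    obtain ⟨i, hi⟩ := hu.mem_cycVerts.1 h1
    obtain ⟨j, h4, h5, h6⟩ := hu.exists_rep 0 i
    rw [hi] at h6
    refine ⟨j, ?_, by omega, h6⟩
    have : j ≠ 0 := by rintro rfl; exact h3 h6.symm
    omega
  choose! j hj1 hj2 hj3 using hj
  set I := (nbr K (u 0) ∩ W).image fun z => u (j z + 1) with hI
  have hIc : I.card = (nbr K (u 0) ∩ W).card := by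
    apply Finset.card_image_of_injOn
    intro z hz w hw hzw
    have hz' : z ∈ W := Finset.mem_of_mem_inter_right hz
    have hw' : w ∈ W := Finset.mem_of_mem_inter_right hw
    have h1 := hj1 z hz'
    have h2 := hj2 z hz'
    have h3 := hj1 w hw'
    have h4 := hj2 w hw'
    have := hu.injOn (a := 1) (i := j z + 1) (j := j w + 1) (by omega) (by omega) (by omega)
      (by omega) hzw
    apply ho hz' hw'
    rw [← hj3 z hz', ← hj3 w hw']
    congr 1
    omega
  have hu1 : u 1 ∉ I := by
    intro hmem
    obtain ⟨z, hz, hz1⟩ := Finset.mem_image.1 hmem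
    have hz' := Finset.mem_of_mem_inter_right hz
    have h1 := hj1 z hz'
    have h2 := hj2 z hz'
    have := hu.injOn (a := 1) (i := j z + 1) (j := 1) (by omega) (by omega) (by omega)
      (by omega) hz1
    omega
  have hdis : Disjoint (nbr K (u 1) ∩ cycVerts h u) I := by
    rw [Finset.disjoint_left]
    intro x hx hxI
    obtain ⟨z, hz, rfl⟩ := Finset.mem_image.1 hxI
    have hz' := Finset.mem_of_mem_inter_right hz
    have hz0 : K.Adj (u 0) z := by simpa using Finset.mem_of_mem_inter_left hz
    have hx1 : K.Adj (u 1) (u (j z + 1)) := by simpa using Finset.mem_of_mem_inter_left hx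
    have h1 := hj1 z hz'
    have h2 := hj2 z hz'
    have ha : K.Adj z (u (j z)) := by rw [hj3 z hz']; exact (hoW z hz').2.2.symm
    have h3 := (((SPath.single K z).join (hu.sPath h1 (by omega)).symm ha
      (disjoint_singleton_seg (hs z hz')))).join
      (hu.sPath (i := j z + 1) (j := h) (by omega) (by omega)) hx1 (by
        rw [Finset.disjoint_union_left]
        exact ⟨disjoint_singleton_seg (hs z hz'), hu.seg_disjoint (by omega) (by omega)⟩)
    have := h3.le_of_adj hb (by
      have := hu.add_period 0
      rw [zero_add] at this
      rwa [this])
    omega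
  have hsub : insert (u 1) ((nbr K (u 1) ∩ cycVerts h u) ∪ I) ⊆ cycVerts h u := by
    intro x hx
    rw [Finset.mem_insert, Finset.mem_union] at hx
    rcases hx with rfl | hx | hx
    · exact hu.apply_mem _
    · exact Finset.mem_of_mem_inter_right hx
    · obtain ⟨z, -, rfl⟩ := Finset.mem_image.1 hx
      exact hu.apply_mem _
  have := Finset.card_le_card hsub
  rw [Finset.card_insert_of_notMem (by simp [hu1]), Finset.card_union_of_disjoint hdis, hIc,
    hu.card_cycVerts] at this
  omega

theorem CyclicEnum.cycVerts_reflect (hu : CyclicEnum K h u) (k : ℤ) :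
    cycVerts h (fun i => u (k - i)) = cycVerts h u := by
  ext x
  rw [hu.mem_cycVerts, (hu.reflect k).mem_cycVerts]
  constructor
  · rintro ⟨i, rfl⟩; exact ⟨_, rfl⟩
  · rintro ⟨i, rfl⟩; exact ⟨k - i, by simp⟩

theorem CyclicEnum.cycVerts_shift (hu : CyclicEnum K h u) (k : ℤ) :
    cycVerts h (fun i => u (i + k)) = cycVerts h u := by
  ext x
  rw [hu.mem_cycVerts, (hu.shift k).mem_cycVerts]
  constructor
  · rintro ⟨i, rfl⟩; exact ⟨_, rfl⟩
  · rintro ⟨i, rfl⟩; exact ⟨i - k, by simp⟩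

/-- If fewer than half of the vertices of the cycle lie outside `Y`, two consecutive ones lie in
`Y`. -/
theorem CyclicEnum.exists_consecutive (hu : CyclicEnum K h u) {Y : Finset V}
    (hY : h < 2 * Y.card) (hYS : Y ⊆ cycVerts h u) : ∃ i, u i ∈ Y ∧ u (i + 1) ∈ Y := by
  by_contra! hcon
  have h1 : ∑ x ∈ cycVerts h u, (if x ∈ Y then 1 else 0) = Y.card := by
    rw [Finset.sum_ite_mem, Finset.inter_eq_right.2 hYS]
    simp
  have h2 := h1
  rw [hu.sum_cycVerts _ 0] at h2
  have h3 := h1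
  rw [← hu.cycVerts_shift 1, (hu.shift 1).sum_cycVerts _ 0] at h3
  have h4 : ∑ k ∈ Finset.Ico (0 : ℤ) (0 + h),
      ((if u k ∈ Y then 1 else 0) + (if u (k + 1) ∈ Y then 1 else 0)) ≤
      ∑ k ∈ Finset.Ico (0 : ℤ) (0 + h), 1 := by
    apply Finset.sum_le_sum
    intro k _
    have := hcon k
    split_ifs <;> simp_all
  rw [Finset.sum_add_distrib, h2, h3] at h4
  simp at h4
  omega

/-- A vertex off the cycle `c` has many neighbours on it if it has few neighbours off it. -/
theorem mul_le_of_cyclicEnum (hKG : K ≤ G) (hc : CyclicEnum G L c) (hb : CircBound G L)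
    (hu : CyclicEnum K h u) (hbK : CircBound K h) (hK : ∀ x y, K.Adj x y → ∀ k, c k ≠ y)
    (hH : ∀ i k, c k ≠ u i) {d : ℕ} (hd : ∀ x, (∀ k, c k ≠ x) →
      d ≤ (nbr K x).card + ((Finset.Ico (0 : ℤ) L).filter fun k => G.Adj (c k) x).card) :
    (h + 1) * (d + 1 - h) ≤ L := by
  have hpos := hu.pos
  obtain ⟨Bad, hBad⟩ : ∃ B : V → Prop, ∀ x, B x ↔ h ≤ (nbr K x).card := ⟨_, fun _ => Iff.rfl⟩
  by_cases hex : ∃ t x, MaxTails K (cycVerts h u) Bad t ∧ x ∈ cycVerts h u ∧ t x ≠ [] ∧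
      Bad (tailEnd t x)
  · exfalso
    obtain ⟨R, -, p, q, h1, h2, h3, -⟩ := exists_cycle_of_nontrivial hu hbK (k := h) (by omega)
      (fun x hx => (hBad x).1 hx) hex
    have := hbK _ _ _ h1 h2
    omega
  obtain ⟨t, Y, W, ht, hYS, hWS, hY, ho, hW, hcard⟩ := exists_heads_of_trivial _ _ _ hex
  set J := (cycVerts h u).filter fun x => ¬ Bad (tailEnd t x) with hJ
  have hJc : ((cycVerts h u).filter fun x => Bad (tailEnd t x)).card + J.card = h := by
    rw [hJ, Finset.card_filter_add_card_filter_not, hu.card_cycVerts]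
  have hend : ∀ x ∈ cycVerts h u, ∀ k, c k ≠ tailEnd t x := by
    intro x hx k hk
    rcases hl : t x with _ | ⟨z, l⟩
    · obtain ⟨i, rfl⟩ := hu.mem_cycVerts.1 hx
      exact hH i k (by rw [hk]; simp [tailEnd, hl])
    · have hm : tailEnd t x ∈ t x := by
        rw [tailEnd, List.getLast_cons (by simp [hl])]
        exact List.getLast_mem _
      obtain ⟨y, hy⟩ := exists_adj_of_mem_tail (ht.chain x) hm
      exact hK _ _ hy k hk
  refine capacity hKG hc hb hu ht hK hH (Finset.filter_subset _ _) (J := J) ?_ ?_ le_rfl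
  · intro x hx
    rw [hJ, Finset.mem_filter] at hx
    have h1 := hd _ (hend x hx.1)
    have h2 := hx.2
    rw [hBad, not_le] at h2
    omega
  by_contra hlt
  have hYne : Y.Nonempty := by
    rw [Finset.nonempty_iff_ne_empty]
    rintro rfl
    simp only [Finset.card_empty] at hcard
    omega
  have hsub : ∀ y ∈ Y, nbr K y ⊆ (nbr K y ∩ cycVerts h u) ∪ (nbr K y ∩ W) := by
    intro y hy z hz
    rw [Finset.mem_union, Finset.mem_inter, Finset.mem_inter]
    have := (hY y hy).2 z (by simpa using hz)
    tauto
  have hdeg : ∀ y ∈ Y, h ≤ (nbr K y ∩ cycVerts h u).card + (nbr K y ∩ W).card := fun y hy =>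
    ((hBad y).1 (hY y hy).1).trans ((Finset.card_le_card (hsub y hy)).trans (Finset.card_union_le _ _))
  have hWc : 1 ≤ W.card := by
    obtain ⟨y, hy⟩ := hYne
    have h1 := hdeg y hy
    have h2 : nbr K y ∩ cycVerts h u ⊆ (cycVerts h u).erase y := by
      intro z hz
      rw [Finset.mem_erase]
      refine ⟨?_, Finset.mem_of_mem_inter_right hz⟩
      rintro rfl
      simp at hz
    have h3 := Finset.card_le_card h2
    rw [Finset.card_erase_of_mem (hYS hy), hu.card_cycVerts] at h3
    have h4 : (nbr K y ∩ W).card ≤ W.card := Finset.card_le_card Finset.inter_subset_right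
    omega
  have hYh : Y.card ≤ h := by
    have := Finset.card_le_card hYS
    rwa [hu.card_cycVerts] at this
  obtain ⟨i, hi, hi'⟩ := hu.exists_consecutive (Y := Y) (by omega) hYS
  have key : ∀ v : ℤ → V, CyclicEnum K h v → cycVerts h v = cycVerts h u → v 0 ∈ Y →
      (nbr K (v 1) ∩ cycVerts h u).card + (nbr K (v 0) ∩ W).card + 1 ≤ h := by
    intro v hv hvu h0
    obtain ⟨o, ho1, ho2⟩ := ho _ h0
    rw [← hvu] at hWS ho2 ⊢
    exact card_nbr_add_card_nbr_lt hv hbK (by omega) hWS ho1 ho2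
  have k1 := key _ (hu.shift i) (hu.cycVerts_shift i) (by simpa using hi)
  have k2 := key _ (hu.reflect (i + 1)) (hu.cycVerts_reflect (i + 1)) (by simpa using hi')
  simp only [zero_add, sub_zero, add_sub_cancel_right, add_comm (1 : ℤ) i] at k1 k2
  have d1 := hdeg _ hi
  have d2 := hdeg _ hi'
  omega

end FirstBound

section IntervalCounts

theorem card_add_card_le_of_abs_sub_le {A B : Finset ℤ} (hA : A.Nonempty) (hB : B.Nonempty) {c : ℤ}
    (h : ∀ p ∈ A, ∀ q ∈ B, |p - q| ≤ c) : ((A.card + B.card : ℕ) : ℤ) ≤ 2 * (c + 1) := by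
  set lo := A.min' hA
  set hi := A.max' hA
  have h1 : A ⊆ Finset.Icc lo hi := fun x hx =>
    Finset.mem_Icc.2 ⟨A.min'_le x hx, A.le_max' x hx⟩
  have h2 : B ⊆ Finset.Icc (hi - c) (lo + c) := fun x hx => by
    have e1 := abs_le.1 (h lo (A.min'_mem hA) x hx)
    have e2 := abs_le.1 (h hi (A.max'_mem hA) x hx)
    exact Finset.mem_Icc.2 ⟨by omega, by omega⟩
  have h3 := Finset.card_le_card h1
  have h4 := Finset.card_le_card h2
  rw [Int.card_Icc] at h3 h4
  have h5 : lo ≤ hi := A.min'_le _ (A.max'_mem hA)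
  have h6 := Finset.card_pos.2 hB
  push_cast
  omega

open scoped Classical

/-- If `A m` and `B (m + 1)` never hold together, then `A` and `B` have few points on an
interval. -/
theorem card_filter_add_card_filter_le {A B : ℤ → Prop} {i j : ℤ} (hij : i ≤ j)
    (h : ∀ m, i ≤ m → m < j → A m → ¬ B (m + 1)) :
    ((((Finset.Icc i j).filter A).card + ((Finset.Icc i j).filter B).card : ℕ) : ℤ)
      ≤ j - i + 1 + if B i then 1 else 0 := by
  set A' := (Finset.Icc i (j - 1)).filter A
  set B' := (Finset.Icc i (j - 1)).filter fun m => B (m + 1)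
  have h1 : ((Finset.Icc i j).filter A).card ≤ A'.card + 1 := by
    have : (Finset.Icc i j).filter A ⊆ insert j A' := by
      intro m hm
      simp only [A', Finset.mem_filter, Finset.mem_Icc, Finset.mem_insert] at hm ⊢
      by_cases hmj : m = j
      · exact Or.inl hmj
      · exact Or.inr ⟨by omega, hm.2⟩
    exact (Finset.card_le_card this).trans (Finset.card_insert_le _ _)
  have h2 : ((Finset.Icc i j).filter B).card ≤ B'.card + if B i then 1 else 0 := by
    have : (Finset.Icc i j).filter B ⊆ (B'.image fun m => m + 1) ∪ if B i then {i} else ∅ := by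
      intro m hm
      simp only [B', Finset.mem_filter, Finset.mem_Icc, Finset.mem_union, Finset.mem_image] at hm ⊢
      by_cases hmi : m = i
      · right; subst hmi; simp [hm.2]
      · exact Or.inl ⟨m - 1, ⟨by omega, by simpa using hm.2⟩, by omega⟩
    refine (Finset.card_le_card this).trans ((Finset.card_union_le _ _).trans ?_)
    have := Finset.card_image_le (s := B') (f := fun m => m + 1)
    split_ifs <;> simp only [Finset.card_singleton, Finset.card_empty] <;> omega
  have h3 : Disjoint A' B' := by
    rw [Finset.disjoint_left]
    intro m hm hm'
    simp only [A', B', Finset.mem_filter, Finset.mem_Icc] at hm hm'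
    exact h m (by omega) (by omega) hm.2 hm'.2
  have h4 : (A' ∪ B').card ≤ (Finset.Icc i (j - 1)).card :=
    Finset.card_le_card (Finset.union_subset (Finset.filter_subset _ _) (Finset.filter_subset _ _))
  rw [Finset.card_union_of_disjoint h3, Int.card_Icc] at h4
  split_ifs at h2 ⊢ <;> push_cast <;> omega

end IntervalCounts

section LongPaths

open scoped Classical

variable {V : Type*} [DecidableEq V] [Fintype V] {K : SimpleGraph V} {h : ℕ} {u : ℤ → V}
  {W Y : Finset V} {D d : ℤ}

theorem CyclicEnum.sPath_uIcc (hu : CyclicEnum K h u) {p q : ℤ} (hpq : |p - q| < h) :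
    SPath K (seg u (min p q) (max p q)) (|p - q| + 1) (u p) (u q) := by
  rcases le_total p q with hle | hle
  · have := hu.sPath hle (by rw [abs_lt] at hpq; omega)
    rw [min_eq_left hle, max_eq_right hle, abs_of_nonpos (by omega)]
    convert this using 1
    ring
  · have := (hu.sPath hle (by rw [abs_lt] at hpq; omega)).symm
    rw [min_eq_right hle, max_eq_left hle, abs_of_nonneg (by omega)]
    convert this using 1
    ring

/-- The number of neighbours of `v` among `u i, …, u j`, counted by index. -/
noncomputable def cnt (K : SimpleGraph V) (u : ℤ → V) (v : V) (i j : ℤ) : ℕ :=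
  ((Finset.Icc i j).filter fun k => K.Adj v (u k)).card

theorem cnt_split (v : V) {i j k : ℤ} (hij : i ≤ j + 1) (hjk : j ≤ k) :
    cnt K u v i k = cnt K u v i j + cnt K u v (j + 1) k := by
  unfold cnt
  rw [← Finset.card_union_of_disjoint, ← Finset.filter_union]
  · congr 2
    ext m
    simp only [Finset.mem_Icc, Finset.mem_union]
    omega
  · rw [Finset.disjoint_left]
    intro m hm hm'
    simp only [Finset.mem_filter, Finset.mem_Icc] at hm hm'
    omega

theorem cnt_le_of_mem {q i j : ℤ} (hi : i ≤ q) (hj : q ≤ j) :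
    (cnt K u (u q) i j : ℤ) ≤ j - i := by
  have : (Finset.Icc i j).filter (fun k => K.Adj (u q) (u k)) ⊆ (Finset.Icc i j).erase q := by
    intro m hm
    rw [Finset.mem_filter] at hm
    rw [Finset.mem_erase]
    refine ⟨?_, hm.1⟩
    rintro rfl
    exact K.loopless.irrefl _ hm.2
  have h1 := Finset.card_le_card this
  rw [Finset.card_erase_of_mem (Finset.mem_Icc.2 ⟨hi, hj⟩), Int.card_Icc] at h1
  unfold cnt
  omega

/-- A longest cycle `u`, together with a set `W` off the cycle, such that the vertices of the cycle
in `Y` have all of their at least `D - 1` neighbours on the cycle or in `W`, and such that all paths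
from `u 0` to `u d` have at most `D - 2` vertices. -/
structure ShortPair (K : SimpleGraph V) (h : ℕ) (u : ℤ → V) (W Y : Finset V) (D d : ℤ) : Prop where
  cyc : CyclicEnum K h u
  bound : CircBound K h
  notMem : ∀ s ∈ W, ∀ k, u k ≠ s
  nbr_subset : ∀ y ∈ Y, ∀ z, K.Adj y z → (∃ k, u k = z) ∨ z ∈ W
  le_card_nbr : ∀ y ∈ Y, D - 1 ≤ (nbr K y).card
  two_mul_lt : 0 < W.card → 2 * (W.card : ℤ) + 1 ≤ D
  pos : 0 < d
  lt : d < h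
  short : ∀ T N, SPath K T N (u 0) (u d) → N ≤ D - 2

namespace ShortPair

/-- The number of neighbours in `W`. -/
noncomputable def wdeg (K : SimpleGraph V) (W : Finset V) (v : V) : ℕ := (W.filter (K.Adj v)).card

theorem le_cnt_add_wdeg (hS : ShortPair K h u W Y D d) {y : V} (hy : y ∈ Y) (p : ℤ) :
    D - 1 ≤ cnt K u y p (p + h - 1) + wdeg K W y := by
  have h1 : nbr K y ⊆ (((Finset.Icc p (p + h - 1)).filter fun k => K.Adj y (u k)).image u) ∪
      W.filter (K.Adj y) := by
    intro z hz
    rw [mem_nbr] at hz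
    rw [Finset.mem_union, Finset.mem_image, Finset.mem_filter]
    rcases hS.nbr_subset y hy z hz with ⟨k, rfl⟩ | hz'
    · left
      obtain ⟨j, h1, h2, h3⟩ := hS.cyc.exists_rep p k
      refine ⟨j, ?_, h3⟩
      rw [Finset.mem_filter, Finset.mem_Icc, h3]
      exact ⟨by omega, hz⟩
    · exact Or.inr ⟨hz', hz⟩
  have h2 := (Finset.card_le_card h1).trans (Finset.card_union_le _ _)
  have h3 : (((Finset.Icc p (p + h - 1)).filter fun k => K.Adj y (u k)).image u).card ≤
      cnt K u y p (p + h - 1) := Finset.card_image_le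
  have h4 := hS.le_card_nbr y hy
  unfold wdeg
  omega

theorem reflect (hS : ShortPair K h u W Y D d) : ShortPair K h (fun i => u (d - i)) W Y D d where
  cyc := hS.cyc.reflect d
  bound := hS.bound
  notMem s hs k := hS.notMem s hs _
  nbr_subset y hy z hz := (hS.nbr_subset y hy z hz).imp_left fun ⟨k, hk⟩ => ⟨d - k, by simpa⟩
  le_card_nbr := hS.le_card_nbr
  two_mul_lt := hS.two_mul_lt
  pos := hS.pos
  lt := hS.lt
  short T N hT := hS.short T N (by simpa using hT.symm)

theorem shift (hS : ShortPair K h u W Y D d) :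
    ShortPair K h (fun i => u (i + d)) W Y D (h - d) where
  cyc := hS.cyc.shift d
  bound := hS.bound
  notMem s hs k := hS.notMem s hs _
  nbr_subset y hy z hz := (hS.nbr_subset y hy z hz).imp_left fun ⟨k, hk⟩ => ⟨k - d, by simpa⟩
  le_card_nbr := hS.le_card_nbr
  two_mul_lt := hS.two_mul_lt
  pos := by have := hS.lt; omega
  lt := by have := hS.pos; omega
  short T N hT := hS.short T N (by
    have := hS.cyc.add_period 0
    simp only [zero_add, sub_add_cancel] at hT this
    rw [this] at hT
    exact hT.symm)

theorem le_sub_three (hS : ShortPair K h u W Y D d) : d ≤ D - 3 := by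
  have := hS.short _ _ (hS.cyc.sPath hS.pos.le (by have := hS.lt; omega))
  omega

theorem sub_le_sub_three (hS : ShortPair K h u W Y D d) : h - d ≤ D - 3 := hS.shift.le_sub_three

/-- Consecutive vertices of `Y` on the arc from `u 0` to `u d` have two neighbours in `W`. -/
theorem two_le_wdeg_add (hS : ShortPair K h u W Y D d) {y : ℤ} (h0 : 0 ≤ y) (hyd : y < d)
    (hy : u y ∈ Y) (hy' : u (y + 1) ∈ Y) : 2 ≤ wdeg K W (u y) + wdeg K W (u (y + 1)) := by
  have hd := hS.le_sub_three
  have hu := hS.cyc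
  have hlt := hS.lt
  have e1 := hS.le_cnt_add_wdeg hy 0
  have e2 := hS.le_cnt_add_wdeg hy' 0
  rw [cnt_split (j := d) _ (by omega) (by omega)] at e1 e2
  have f1 := cnt_le_of_mem (K := K) (u := u) h0 hyd.le
  have f2 := cnt_le_of_mem (K := K) (u := u) (show 0 ≤ y + 1 by omega) (show y + 1 ≤ d by omega)
  push_cast at e1 e2
  by_contra hlt2
  have g1 : 0 < cnt K u (u y) (d + 1) (0 + h - 1) := by omega
  have g2 : 0 < cnt K u (u (y + 1)) (d + 1) (0 + h - 1) := by omega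
  have := card_add_card_le_of_abs_sub_le (c := D - 4 - d) (Finset.card_pos.1 g1)
    (Finset.card_pos.1 g2) (by
      intro p hp q hq
      rw [Finset.mem_filter, Finset.mem_Icc] at hp hq
      have hmin : d + 1 ≤ min p q := le_min hp.1.1 hq.1.1
      have hmax : max p q ≤ 0 + h - 1 := max_le hp.1.2 hq.1.2
      have hP := ((hu.sPath h0 (by omega)).join (hu.sPath_uIcc (p := p) (q := q)
        (by rw [abs_lt]; omega)) hp.2 (hu.seg_disjoint (by omega) (by omega))).join
        (hu.sPath (i := y + 1) (j := d) (by omega) (by omega)) hq.2.symm (by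
          rw [Finset.disjoint_union_left]
          exact ⟨hu.seg_disjoint (by omega) (by omega), hu.seg_disjoint' (by omega) (by omega)⟩)
      have := hS.short _ _ hP
      omega)
  unfold cnt at e1 e2 f1 f2 g1 g2
  push_cast at this
  omega

end ShortPair

end LongPaths

section Crossing

open scoped Classical

variable {V : Type*} [DecidableEq V] [Fintype V] {K : SimpleGraph V} {h : ℕ} {u : ℤ → V}
  {W Y : Finset V} {D d : ℤ} {s : V} {y k : ℤ}

namespace CyclicEnum

theorem not_adj_succ_of_adj (hu : CyclicEnum K h u) (hb : CircBound K h) (hs : ∀ k, u k ≠ s)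
    (h1 : K.Adj s (u y)) : ¬ K.Adj s (u (y + 1)) := by
  intro h2
  have hpos := hu.pos
  have := ((SPath.single K s).join (hu.sPath (i := y + 1) (j := y + h) (by omega) (by omega)) h2
    (disjoint_singleton_seg hs)).le_of_adj hb (by rw [hu.add_period]; exact h1.symm)
  omega

theorem not_adj_adj_right (hu : CyclicEnum K h u) (hb : CircBound K h) (hs : ∀ k, u k ≠ s)
    (h1 : K.Adj s (u y)) (h2 : K.Adj s (u k)) (hyk : y < k) (hky : k < y + h)
    {m : ℤ} (hm : k + 1 ≤ m) (hm' : m < y + h)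
    (ha : K.Adj (u (y + 1)) (u m)) : ¬ K.Adj (u (k + 1)) (u (m + 1)) := by
  intro ha'
  have := ((((SPath.single K s).join (hu.sPath (i := y + 1) (j := k) (by omega) (by omega)).symm h2
    (disjoint_singleton_seg hs)).join (hu.sPath (i := k + 1) (j := m) hm (by omega)).symm ha (by
      rw [Finset.disjoint_union_left]
      exact ⟨disjoint_singleton_seg hs, hu.seg_disjoint (by omega) (by omega)⟩)).join
    (hu.sPath (i := m + 1) (j := y + h) (by omega) (by omega)) ha' (by
      simp only [Finset.disjoint_union_left]
      exact ⟨⟨disjoint_singleton_seg hs, hu.seg_disjoint (by omega) (by omega)⟩,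
        hu.seg_disjoint (by omega) (by omega)⟩)).le_of_adj hb
    (by rw [hu.add_period]; exact h1.symm)
  omega

theorem not_adj_adj_left (hu : CyclicEnum K h u) (hb : CircBound K h) (hs : ∀ k, u k ≠ s)
    (h1 : K.Adj s (u y)) (h2 : K.Adj s (u k)) (hyk : y < k) (hky : k < y + h)
    {m : ℤ} (hm : y + 1 ≤ m) (hm' : m < k)
    (ha : K.Adj (u (k + 1)) (u m)) : ¬ K.Adj (u (y + 1)) (u (m + 1)) := by
  intro ha'
  have := ((((SPath.single K s).join (hu.sPath (i := m + 1) (j := k) (by omega) (by omega)).symm h2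
    (disjoint_singleton_seg hs)).join (hu.sPath (i := y + 1) (j := m) hm (by omega)) ha'.symm (by
      rw [Finset.disjoint_union_left]
      exact ⟨disjoint_singleton_seg hs, hu.seg_disjoint' (by omega) (by omega)⟩)).join
    (hu.sPath (i := k + 1) (j := y + h) (by omega) (by omega)) ha.symm (by
      simp only [Finset.disjoint_union_left]
      exact ⟨⟨disjoint_singleton_seg hs, hu.seg_disjoint (by omega) (by omega)⟩,
        hu.seg_disjoint (by omega) (by omega)⟩)).le_of_adj hb
    (by rw [hu.add_period]; exact h1.symm)
  omega

theorem not_adj_common (hu : CyclicEnum K h u) (hb : CircBound K h) (hs : ∀ k, u k ≠ s)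
    (h1 : K.Adj s (u y)) (h2 : K.Adj s (u k)) (hyk : y < k) (hky : k < y + h)
    {s' : V} (hs' : ∀ k, u k ≠ s') (hne : s ≠ s')
    (ha : K.Adj (u (y + 1)) s') : ¬ K.Adj (u (k + 1)) s' := by
  intro ha'
  have := ((((SPath.single K s).join (hu.sPath (i := y + 1) (j := k) (by omega) (by omega)).symm h2
    (disjoint_singleton_seg hs)).join (SPath.single K s') ha (by
      rw [Finset.disjoint_union_left]
      exact ⟨by simpa using hne, disjoint_seg_singleton hs'⟩)).join
    (hu.sPath (i := k + 1) (j := y + h) (by omega) (by omega)) ha'.symm (by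
      simp only [Finset.disjoint_union_left]
      exact ⟨⟨disjoint_singleton_seg hs, hu.seg_disjoint (by omega) (by omega)⟩,
        disjoint_singleton_seg hs'⟩)).le_of_adj hb
    (by rw [hu.add_period]; exact h1.symm)
  omega

end CyclicEnum

namespace ShortPair

theorem wdeg_add_wdeg_lt (hS : ShortPair K h u W Y D d) (hs : s ∈ W)
    (h1 : K.Adj s (u y)) (h2 : K.Adj s (u k)) (hyk : y < k) (hky : k < y + h) :
    wdeg K W (u (y + 1)) + wdeg K W (u (k + 1)) < W.card := by
  have hu := hS.cyc
  have hb := hS.bound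
  have hs' := hS.notMem s hs
  unfold wdeg
  rw [← Finset.card_union_of_disjoint]
  · apply Finset.card_lt_card
    refine ⟨Finset.union_subset (Finset.filter_subset _ _) (Finset.filter_subset _ _), ?_⟩
    intro hsub
    have := hsub hs
    simp only [Finset.mem_union, Finset.mem_filter] at this
    rcases this with h | h
    · exact hu.not_adj_succ_of_adj hb hs' h1 h.2.symm
    · exact hu.not_adj_succ_of_adj hb hs' h2 h.2.symm
  · rw [Finset.disjoint_left]
    intro z hz hz'
    rw [Finset.mem_filter] at hz hz'
    rcases eq_or_ne s z with rfl | hne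
    · exact hu.not_adj_succ_of_adj hb hs' h1 hz.2.symm
    · exact hu.not_adj_common hb hs' h1 h2 hyk hky (hS.notMem z hz.1) hne hz.2 hz'.2

theorem two_mul_le_of_adj_adj (hS : ShortPair K h u W Y D d) (hs : s ∈ W)
    (h1 : K.Adj s (u y)) (h2 : K.Adj s (u k)) (hyk : y < k) (hky : k < y + h)
    (hv : u (y + 1) ∈ Y) (hw : u (k + 1) ∈ Y) : 2 * D - 1 - W.card ≤ h := by
  have hu := hS.cyc
  have hb := hS.bound
  have hs' := hS.notMem s hs
  have hW := hS.wdeg_add_wdeg_lt hs h1 h2 hyk hky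
  have e1 := hS.le_cnt_add_wdeg hv (y + 1)
  have e2 := hS.le_cnt_add_wdeg hw (y + 1)
  rw [cnt_split (j := k) _ (by omega) (by omega)] at e1 e2
  have f1 := card_filter_add_card_filter_le (A := fun m => K.Adj (u (k + 1)) (u m))
    (B := fun m => K.Adj (u (y + 1)) (u m)) (i := y + 1) (j := k) (by omega)
    (fun m hm hm' => hu.not_adj_adj_left hb hs' h1 h2 hyk hky hm hm')
  have f2 := card_filter_add_card_filter_le (A := fun m => K.Adj (u (y + 1)) (u m))
    (B := fun m => K.Adj (u (k + 1)) (u m)) (i := k + 1) (j := y + 1 + h - 1) (by omega)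
    (fun m hm hm' => hu.not_adj_adj_right hb hs' h1 h2 hyk hky hm (by omega))
  rw [if_neg (K.loopless.irrefl _)] at f1 f2
  unfold cnt at e1 e2
  push_cast at e1 e2 f1 f2
  omega

/-- The number of neighbours of an inner vertex of the arc from `u 0` to `u d` off that arc. -/
theorem cnt_le_of_inner (hS : ShortPair K h u W Y D d) {q : ℤ} (hq : 0 < q) (hqd : q < d)
    (hc : 0 < cnt K u (u q) (d + 1) (0 + h - 1)) :
    cnt K u (u q) (d + 1) (0 + h - 1) ≤ 2 * D - 7 - h := by
  have hu := hS.cyc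
  have hlt := hS.lt
  have hsub : (Finset.Icc (d + 1) (0 + h - 1)).filter (fun k => K.Adj (u q) (u k)) ⊆
      Finset.Icc (h + d - q + 4 - D) (D - 4 + d - q) := by
    intro m hm
    rw [Finset.mem_filter, Finset.mem_Icc] at hm
    rw [Finset.mem_Icc]
    have p1 := hS.short _ _ ((hu.sPath hq.le (by omega)).join
      (hu.sPath (i := d) (j := m) (by omega) (by omega)).symm hm.2
      (hu.seg_disjoint (by omega) (by omega)))
    have p2 := hS.short _ _ (show SPath K _ _ (u 0) (u d) from by
      have h0 := hu.add_period 0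
      rw [zero_add] at h0
      rw [← h0]
      exact (hu.sPath (i := m) (j := h) (by omega) (by omega)).symm.join
        (hu.sPath hqd.le (by omega)) hm.2.symm (hu.seg_disjoint' (by omega) (by omega)))
    omega
  have h1 := Finset.card_le_card hsub
  rw [Int.card_Icc] at h1
  unfold cnt at hc ⊢
  omega

theorem false_of_adj_adj (hS : ShortPair K h u W Y D d) (hs : s ∈ W)
    (h1 : K.Adj s (u y)) (h2 : K.Adj s (u k)) (h0 : 0 ≤ y) (hyk : y < k) (hkd : k + 1 < d)
    (hv : u (y + 1) ∈ Y) (hw : u (k + 1) ∈ Y) : False := by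
  have hu := hS.cyc
  have hb := hS.bound
  have hs' := hS.notMem s hs
  have hlt := hS.lt
  have hW := hS.wdeg_add_wdeg_lt hs h1 h2 hyk (by omega)
  have hbig := hS.two_mul_le_of_adj_adj hs h1 h2 hyk (by omega) hv hw
  have hr := hS.two_mul_lt (Finset.card_pos.2 ⟨s, hs⟩)
  have hd := hS.le_sub_three
  have hd' := hS.sub_le_sub_three
  have e1 := hS.le_cnt_add_wdeg hv 0
  have e2 := hS.le_cnt_add_wdeg hw 0
  rw [cnt_split (j := d) _ (by omega) (by omega), cnt_split (j := y) (k := d) _ (by omega)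
    (by omega), cnt_split (j := k) (k := d) _ (by omega) (by omega)] at e1 e2
  have f1 := card_filter_add_card_filter_le (A := fun m => K.Adj (u (y + 1)) (u m))
    (B := fun m => K.Adj (u (k + 1)) (u m)) (i := 0) (j := y) (by omega)
    (fun m hm hm' ha ha' => hu.not_adj_adj_right hb hs' h1 h2 hyk (by omega) (m := m + h)
      (by omega) (by omega) (by rwa [hu.add_period])
      (by rw [add_right_comm, hu.add_period]; exact ha'))
  have f2 := card_filter_add_card_filter_le (A := fun m => K.Adj (u (k + 1)) (u m))
    (B := fun m => K.Adj (u (y + 1)) (u m)) (i := y + 1) (j := k) (by omega)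
    (fun m hm hm' => hu.not_adj_adj_left hb hs' h1 h2 hyk (by omega) hm hm')
  have f3 := card_filter_add_card_filter_le (A := fun m => K.Adj (u (y + 1)) (u m))
    (B := fun m => K.Adj (u (k + 1)) (u m)) (i := k + 1) (j := d) (by omega)
    (fun m hm hm' => hu.not_adj_adj_right hb hs' h1 h2 hyk (by omega) hm (by omega))
  rw [if_neg (K.loopless.irrefl _)] at f2 f3
  have f1' : ∀ x : ℤ, x + (if K.Adj (u (k + 1)) (u 0) then 1 else 0) ≤ x + 1 := by
    intro x; split_ifs <;> omega
  replace f1 := f1.trans (f1' _)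
  have g1 := hS.cnt_le_of_inner (q := y + 1) (by omega) (by omega)
  have g2 := hS.cnt_le_of_inner (q := k + 1) (by omega) (by omega)
  have g3 : 0 < cnt K u (u (y + 1)) (d + 1) (0 + h - 1) →
      0 < cnt K u (u (k + 1)) (d + 1) (0 + h - 1) →
      ((cnt K u (u (y + 1)) (d + 1) (0 + h - 1) + cnt K u (u (k + 1)) (d + 1) (0 + h - 1) : ℕ) : ℤ)
        ≤ 2 * (D - 5 - d + 1) := by
    intro c1 c2
    refine card_add_card_le_of_abs_sub_le (Finset.card_pos.1 c1) (Finset.card_pos.1 c2) ?_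
    intro p hp q hq
    rw [Finset.mem_filter, Finset.mem_Icc] at hp hq
    have hmin : d + 1 ≤ min p q := le_min hp.1.1 hq.1.1
    have hmax : max p q ≤ 0 + h - 1 := max_le hp.1.2 hq.1.2
    have hP := ((((hu.sPath h0 (by omega)).join (SPath.single K s) h1.symm
      (disjoint_seg_singleton hs')).join (hu.sPath (i := y + 1) (j := k) (by omega)
        (by omega)).symm h2 (by
          rw [Finset.disjoint_union_left]
          exact ⟨hu.seg_disjoint (by omega) (by omega), disjoint_singleton_seg hs'⟩)).join
      (hu.sPath_uIcc (p := p) (q := q) (by rw [abs_lt]; omega)) hp.2 (by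
          simp only [Finset.disjoint_union_left]
          exact ⟨⟨hu.seg_disjoint (by omega) (by omega), disjoint_singleton_seg hs'⟩,
            hu.seg_disjoint (by omega) (by omega)⟩)).join
      (hu.sPath (i := k + 1) (j := d) (by omega) (by omega)) hq.2.symm (by
          simp only [Finset.disjoint_union_left]
          exact ⟨⟨⟨hu.seg_disjoint (by omega) (by omega), disjoint_singleton_seg hs'⟩,
            hu.seg_disjoint (by omega) (by omega)⟩, hu.seg_disjoint' (by omega) (by omega)⟩)
    have := hS.short _ _ hP
    omega
  unfold cnt at e1 e2 g1 g2 g3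
  push_cast at e1 e2 f1 f2 f3 g3
  omega

end ShortPair

end Crossing

section PairCount

open scoped Classical

variable {V : Type*} [DecidableEq V] [Fintype V] {K : SimpleGraph V} {h : ℕ} {u : ℤ → V}
  {W Y : Finset V} {D d : ℤ}

namespace ShortPair

theorem sum_wdeg_le {J : Finset ℤ} {f : ℤ → V}
    (hf : ∀ s ∈ W, ∀ i ∈ J, ∀ k ∈ J, i < k → K.Adj s (f i) → ¬ K.Adj s (f k)) :
    ∑ i ∈ J, wdeg K W (f i) ≤ W.card := by
  simp only [wdeg, Finset.card_filter]
  rw [Finset.sum_comm, Finset.card_eq_sum_ones]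
  apply Finset.sum_le_sum
  intro s hs
  rw [← Finset.card_filter, Finset.card_le_one]
  intro i hi k hk
  rw [Finset.mem_filter] at hi hk
  by_contra hne
  rcases lt_or_gt_of_ne hne with hlt | hlt
  · exact hf s hs i hi.1 k hk.1 hlt hi.2.symm hk.2.symm
  · exact hf s hs k hk.1 i hi.1 hlt hk.2.symm hi.2.symm

theorem card_le_of_sparse (hS : ShortPair K h u W Y D d) {J : Finset ℤ}
    (hJ : ∀ i ∈ J, 0 ≤ i ∧ i < d ∧ u i ∈ Y ∧ u (i + 1) ∈ Y)
    (h1 : ∀ s ∈ W, ∀ i ∈ J, ∀ k ∈ J, i < k → K.Adj s (u i) → ¬ K.Adj s (u k))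
    (h2 : ∀ s ∈ W, ∀ i ∈ J, ∀ k ∈ J, i < k → K.Adj s (u (i + 1)) → ¬ K.Adj s (u (k + 1))) :
    J.card ≤ W.card := by
  have e1 := sum_wdeg_le (f := u) h1
  have e2 := sum_wdeg_le (f := fun i => u (i + 1)) h2
  have e3 : ∑ _i ∈ J, 2 ≤ ∑ i ∈ J, (wdeg K W (u i) + wdeg K W (u (i + 1))) :=
    Finset.sum_le_sum fun i hi =>
      hS.two_le_wdeg_add (hJ i hi).1 (hJ i hi).2.1 (hJ i hi).2.2.1 (hJ i hi).2.2.2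
  rw [Finset.sum_add_distrib, Finset.sum_const, smul_eq_mul] at e3
  omega

/-- The number of consecutive pairs of `Y` on the arc from `u 0` to `u d`. -/
theorem card_pairs_le (hS : ShortPair K h u W Y D d) :
    (((Finset.Ico 0 d).filter fun i => u i ∈ Y ∧ u (i + 1) ∈ Y).card : ℤ) ≤
      W.card + if 2 * D - 1 - W.card ≤ h then 2 else 0 := by
  set I := (Finset.Ico 0 d).filter fun i => u i ∈ Y ∧ u (i + 1) ∈ Y with hI
  have hlt := hS.lt
  have hmem : ∀ i ∈ I, 0 ≤ i ∧ i < d ∧ u i ∈ Y ∧ u (i + 1) ∈ Y := by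
    intro i hi
    rw [hI, Finset.mem_filter, Finset.mem_Ico] at hi
    exact ⟨hi.1.1, hi.1.2, hi.2⟩
  have hr := hS.reflect
  split_ifs with hbig
  · set J := I.filter fun i => 1 ≤ i ∧ i + 2 ≤ d with hJ
    have hmemJ : ∀ i ∈ J, i ∈ I ∧ 1 ≤ i ∧ i + 2 ≤ d := fun i hi => Finset.mem_filter.1 hi
    have hsub : I ⊆ insert 0 (insert (d - 1) J) := by
      intro i hi
      have := hmem i hi
      simp only [Finset.mem_insert, hJ, Finset.mem_filter]
      by_cases h1 : i = 0
      · exact Or.inl h1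
      · by_cases h2 : i = d - 1
        · exact Or.inr (Or.inl h2)
        · exact Or.inr (Or.inr ⟨hi, by omega, by omega⟩)
    have h1 := Finset.card_le_card hsub
    have h2 := Finset.card_insert_le 0 (insert (d - 1) J)
    have h3 := Finset.card_insert_le (d - 1) J
    have h4 : J.card ≤ W.card := by
      refine hS.card_le_of_sparse (fun i hi => hmem i (hmemJ i hi).1) ?_ ?_
      · intro s hs i hi k hk hik a1 a2
        obtain ⟨hi1, hi2, hi3⟩ := hmemJ i hi
        obtain ⟨hk1, hk2, hk3⟩ := hmemJ k hk
        exact hS.false_of_adj_adj hs a1 a2 (by omega) hik (by omega) (hmem i hi1).2.2.2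
          (hmem k hk1).2.2.2
      · intro s hs i hi k hk hik a1 a2
        obtain ⟨hi1, hi2, hi3⟩ := hmemJ i hi
        obtain ⟨hk1, hk2, hk3⟩ := hmemJ k hk
        refine hr.false_of_adj_adj (y := d - (k + 1)) (k := d - (i + 1)) hs ?_ ?_ (by omega)
          (by omega) (by omega) ?_ ?_
        · simpa using a2
        · simpa using a1
        · have := (hmem k hk1).2.2.1
          convert this using 2; ring
        · have := (hmem i hi1).2.2.1
          convert this using 2; ring
    omega
  · have h4 : I.card ≤ W.card := by
      refine hS.card_le_of_sparse hmem ?_ ?_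
      · intro s hs i hi k hk hik a1 a2
        have hi1 := hmem i hi
        have hk1 := hmem k hk
        exact hbig (hS.two_mul_le_of_adj_adj hs a1 a2 hik (by omega) hi1.2.2.2 hk1.2.2.2)
      · intro s hs i hi k hk hik a1 a2
        have hi1 := hmem i hi
        have hk1 := hmem k hk
        refine hbig (hr.two_mul_le_of_adj_adj (y := d - (k + 1)) (k := d - (i + 1)) hs ?_ ?_
          (by omega) (by omega) ?_ ?_)
        · simpa using a2
        · simpa using a1
        · have := hk1.2.2.1
          convert this using 2; ring
        · have := hi1.2.2.1
          convert this using 2; ring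
    omega

end ShortPair

/-- Any two vertices of a longest cycle are joined by a long path, provided that most vertices of
the cycle have large degree and all of their neighbours on the cycle or in the small set `W`. -/
theorem exists_long_path (hu : CyclicEnum K h u) (hb : CircBound K h)
    (hW : ∀ s ∈ W, ∀ k, u k ≠ s) (hYS : Y ⊆ cycVerts h u)
    (hYn : ∀ y ∈ Y, ∀ z, K.Adj y z → z ∈ cycVerts h u ∨ z ∈ W)
    (hdeg : ∀ y ∈ Y, D - 1 ≤ (nbr K y).card)
    (h1 : 2 * ((h : ℤ) - Y.card) + 2 * W.card + 1 ≤ h)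
    (h2 : 0 < W.card → 2 * ((h : ℤ) - Y.card) + 2 * W.card + 1 ≤ D) {a b : V}
    (ha : a ∈ cycVerts h u) (hb' : b ∈ cycVerts h u) (hab : a ≠ b) :
    ∃ T, PathOn K T a b ∧ D - 1 ≤ T.card := by
  by_contra! hcon
  obtain ⟨i, rfl⟩ := hu.mem_cycVerts.1 ha
  obtain ⟨j, rfl⟩ := hu.mem_cycVerts.1 hb'
  obtain ⟨j', hj1, hj2, hj3⟩ := hu.exists_rep i j
  have hYh : Y.card ≤ h := by
    have := Finset.card_le_card hYS
    rwa [hu.card_cycVerts] at this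
  have hne : j' ≠ i := by rintro rfl; exact hab hj3
  have hS : ShortPair K h (fun k => u (k + i)) W Y D (j' - i) :=
    { cyc := hu.shift i
      bound := hb
      notMem := fun s hs k => hW s hs _
      nbr_subset := fun y hy z hz => (hYn y hy z hz).imp_left fun hz' => by
        obtain ⟨k, rfl⟩ := hu.mem_cycVerts.1 hz'
        exact ⟨k - i, by simp⟩
      le_card_nbr := hdeg
      two_mul_lt := fun hpos => by have := h2 hpos; omega
      pos := by omega
      lt := by omega
      short := fun T N hT => by
        have hT2 := hT.2
        simp only [zero_add, sub_add_cancel, hj3] at hT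
        have := hcon T hT.1
        omega }
  set v : ℤ → V := fun k => u (k + i) with hv
  set d := j' - i with hd
  have hvc : cycVerts h v = cycVerts h u := hu.cycVerts_shift i
  have p1 := hS.card_pairs_le
  have p2 := hS.shift.card_pairs_le
  have q1 := hS.le_sub_three
  have q2 := hS.sub_le_sub_three
  have hvY : ∀ v' : ℤ → V, CyclicEnum K h v' → cycVerts h v' = cycVerts h u →
      ∑ k ∈ Finset.Ico (0 : ℤ) (0 + h), (if v' k ∈ Y then 1 else 0) = Y.card := by
    intro v' h3 h4
    rw [← h3.sum_cycVerts (fun x => if x ∈ Y then 1 else 0) 0, Finset.sum_ite_mem, h4,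
      Finset.inter_eq_right.2 hYS]
    simp
  have y1 := hvY v hS.cyc hvc
  have y2 := hvY (fun k => v (k + 1)) (hS.cyc.shift 1) ((hS.cyc.cycVerts_shift 1).trans hvc)
  have hsum : ∑ k ∈ Finset.Ico (0 : ℤ) (0 + h),
      ((if v k ∈ Y then 1 else 0) + (if v (k + 1) ∈ Y then 1 else 0)) ≤
      ∑ k ∈ Finset.Ico (0 : ℤ) (0 + h), (1 + if v k ∈ Y ∧ v (k + 1) ∈ Y then 1 else 0) := by
    apply Finset.sum_le_sum
    intro k _
    by_cases a1 : v k ∈ Y <;> by_cases a2 : v (k + 1) ∈ Y <;> simp [a1, a2]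
  rw [Finset.sum_add_distrib, Finset.sum_add_distrib, y1, y2, ← Finset.card_filter] at hsum
  simp only [Finset.sum_const, Int.card_Ico, smul_eq_mul, mul_one] at hsum
  have hle : ((Finset.Ico (0 : ℤ) (0 + h)).filter fun k => v k ∈ Y ∧ v (k + 1) ∈ Y).card ≤
      ((Finset.Ico 0 d).filter fun k => v k ∈ Y ∧ v (k + 1) ∈ Y).card +
      ((Finset.Ico 0 (h - d)).filter fun k => v (k + d) ∈ Y ∧ v (k + 1 + d) ∈ Y).card := by
    rw [← Finset.card_image_of_injective (s := (Finset.Ico 0 (h - d)).filter _)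
      (add_left_injective d)]
    refine (Finset.card_le_card ?_).trans (Finset.card_union_le _ _)
    intro k hk
    simp only [Finset.mem_filter, Finset.mem_Ico, Finset.mem_union, Finset.mem_image] at hk ⊢
    rcases lt_or_ge k d with hkd | hkd
    · exact Or.inl ⟨by omega, hk.2⟩
    · refine Or.inr ⟨k - d, ⟨by omega, ?_⟩, by simp⟩
      rw [sub_add_cancel, sub_add_eq_add_sub, sub_add_cancel]
      exact hk.2
  split_ifs at p1 p2 with hbig
  · rcases Nat.eq_zero_or_pos W.card with hW0 | hWpos
    · omega
    · have := h2 hWpos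
      omega
  · omega

end PairCount

section Menger

variable {V : Type*} [DecidableEq V] {G G' : SimpleGraph V}

namespace PathOn

variable {S T U : Finset V} {a b c : V}

theorem eq_singleton_or (h : PathOn G T a b) :
    (T = {a} ∧ b = a) ∨ ∃ a', G.Adj a a' ∧ PathOn G (T.erase a) a' b := by
  obtain ⟨l, h1, h2, h3, h4, rfl⟩ := h
  match l, h1, h2, h3, h4 with
  | [x], _, _, h3, h4 => left; simp at h3 h4 ⊢; simp [← h3, ← h4]
  | x :: y :: l, h1, h2, h3, h4 =>
    right
    simp only [List.head?_cons, Option.some.injEq] at h3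
    subst h3
    rw [List.isChain_cons_cons] at h2
    refine ⟨y, h2.1, y :: l, (List.nodup_cons.1 h1).2, h2.2, rfl, by simpa using h4, ?_⟩
    rw [List.toFinset_cons (a := x), Finset.erase_insert]
    simpa using (List.nodup_cons.1 h1).1

theorem glue (h : PathOn G S a b) (h' : PathOn G T b c) (hST : ∀ z ∈ S, z ∈ T → z = b) :
    PathOn G (S ∪ T) a c := by
  rcases h'.eq_singleton_or with ⟨rfl, rfl⟩ | ⟨b', hb, hp⟩
  · rwa [Finset.union_eq_left.2 (by simpa using h.right_mem)]
  · have : S ∪ T = S ∪ T.erase b := by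
      ext z
      simp only [Finset.mem_union, Finset.mem_erase]
      have := h.right_mem
      by_cases hz : z = b
      · subst hz; simp [this]
      · simp [hz]
    rw [this]
    refine h.join hp hb (Finset.disjoint_left.2 fun z hz hz' => ?_)
    rw [Finset.mem_erase] at hz'
    exact hz'.1 (hST z hz hz'.2)

theorem subset_of_closed {U : Finset V} (h : PathOn G T a b) (ha : a ∈ U)
    (hU : ∀ p ∈ T, p ≠ b → p ∈ U → ∀ q, G.Adj p q → q ∈ U) : T ⊆ U := by
  induction hn : T.card generalizing T a with
  | zero => exact absurd h.card_pos (by omega)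
  | succ n ih =>
    rcases h.eq_singleton_or with ⟨rfl, rfl⟩ | ⟨b', hb, hp⟩
    · simpa using ha
    · have hab : a ≠ b := by
        rintro rfl
        simpa using hp.right_mem
      have h1 := ih hp (hU a h.left_mem hab ha _ hb)
        (fun p hp' => hU p (Finset.mem_of_mem_erase hp'))
        (by rw [Finset.card_erase_of_mem h.left_mem]; omega)
      intro z hz
      by_cases hza : z = a
      · rwa [hza]
      · exact h1 (Finset.mem_erase.2 ⟨hza, hz⟩)

end PathOn

/-- The paths on `P i`, for `i ∈ I`, are disjoint and lead from `s i` to `t i`, and each of them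
meets `A` and `B` in its ends only. -/
structure Linkage (G : SimpleGraph V) (A B I : Finset V) (P : V → Finset V) (s t : V → V) :
    Prop where
  path : ∀ i ∈ I, PathOn G (P i) (s i) (t i)
  left : ∀ i ∈ I, ∀ z ∈ P i, z ∈ A ↔ z = s i
  right : ∀ i ∈ I, ∀ z ∈ P i, z ∈ B ↔ z = t i
  disj : ∀ i ∈ I, ∀ j ∈ I, i ≠ j → Disjoint (P i) (P j)

namespace Linkage

variable {A B I : Finset V} {P : V → Finset V} {s t : V → V}

theorem symm (h : Linkage G A B I P s t) : Linkage G B A I P t s where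
  path i hi := (h.path i hi).symm
  left := h.right
  right := h.left
  disj := h.disj

theorem left_mem (h : Linkage G A B I P s t) {i : V} (hi : i ∈ I) : s i ∈ A :=
  (h.left i hi _ (h.path i hi).left_mem).2 rfl

theorem right_mem (h : Linkage G A B I P s t) {i : V} (hi : i ∈ I) : t i ∈ B :=
  h.symm.left_mem hi

theorem left_ne (h : Linkage G A B I P s t) {i j : V} (hi : i ∈ I) (hj : j ∈ I) (hij : i ≠ j) :
    s i ≠ s j := fun he => Finset.disjoint_left.1 (h.disj i hi j hj hij)
  (h.path i hi).left_mem (he ▸ (h.path j hj).left_mem)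

theorem right_ne (h : Linkage G A B I P s t) {i j : V} (hi : i ∈ I) (hj : j ∈ I) (hij : i ≠ j) :
    t i ≠ t j := h.symm.left_ne hi hj hij

/-- If the paths use all of `B`, they can be indexed by their ends in `B`. -/
theorem reindex (h : Linkage G A B I P s t) (hc : B.card ≤ I.card) :
    ∃ P' s', Linkage G A B B P' s' id := by
  have hinj : Set.InjOn t I := fun i hi j hj hij => by
    by_contra hne
    exact h.right_ne hi hj hne hij
  have himg : I.image t = B := by
    apply Finset.eq_of_subset_of_card_le
    · intro z hz
      obtain ⟨i, hi, rfl⟩ := Finset.mem_image.1 hz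
      exact h.right_mem hi
    · rwa [Finset.card_image_of_injOn hinj]
  have : ∀ b, ∃ i, b ∈ B → i ∈ I ∧ t i = b := by
    intro b
    by_cases hb : b ∈ B
    · rw [← himg] at hb
      obtain ⟨i, hi, rfl⟩ := Finset.mem_image.1 hb
      exact ⟨i, fun _ => ⟨hi, rfl⟩⟩
    · exact ⟨b, fun h => absurd h hb⟩
  choose r hr using this
  refine ⟨fun b => P (r b), fun b => s (r b), ?_, ?_, ?_, ?_⟩
  · intro b hb
    have := h.path _ (hr b hb).1
    rwa [(hr b hb).2] at this
  · intro b hb; exact h.left _ (hr b hb).1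
  · intro b hb
    have := h.right _ (hr b hb).1
    rwa [(hr b hb).2] at this
  · intro b hb c hc hbc
    refine h.disj _ (hr b hb).1 _ (hr c hc).1 fun he => hbc ?_
    rw [← (hr b hb).2, ← (hr c hc).2, he]

end Linkage

/-- The pair `(U, W)` is a separation of `G` with `A ⊆ U` and `B ⊆ W`. -/
structure Separates (G : SimpleGraph V) (A B U W : Finset V) : Prop where
  left : A ⊆ U
  right : B ⊆ W
  mem : ∀ z, z ∈ U ∨ z ∈ W
  adj : ∀ x y, G.Adj x y → x ∈ U → x ∉ W → y ∈ U

theorem Separates.symm {A B U W : Finset V} (h : Separates G A B U W) : Separates G B A W U where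
  left := h.right
  right := h.left
  mem z := (h.mem z).symm
  adj x y hxy hx hx' := by
    by_contra hy
    exact hx' (h.adj y x hxy.symm ((h.mem y).resolve_right hy) hy)

theorem Separates.le_of_deleteEdges {A B U W : Finset V} {x y : V} {k : ℕ}
    (hk : ∀ U W, Separates G A B U W → k ≤ (U ∩ W).card)
    (h : Separates (G.deleteEdges {s(x, y)}) A B U W) (hy : y ∉ U) (U' W' : Finset V)
    (h' : Separates (G.deleteEdges {s(x, y)}) A (insert x (U ∩ W)) U' W') :
    k ≤ (U' ∩ W').card := by
  have hx : x ∈ W' := h'.right (by simp)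
  have hS : ∀ z, z ∈ U → z ∈ W → z ∈ W' := fun z h1 h2 => h'.right (by simp [h1, h2])
  refine (hk (U' ∩ U) (W' ∪ W) ⟨?_, ?_, ?_, ?_⟩).trans (Finset.card_le_card ?_)
  · exact Finset.subset_inter h'.left h.left
  · exact h.right.trans Finset.subset_union_right
  · intro z
    have h1 := h.mem z
    have h2 := h'.mem z
    simp only [Finset.mem_inter, Finset.mem_union]
    tauto
  · intro p q hpq hp hp'
    simp only [Finset.mem_inter, Finset.mem_union, not_or] at hp hp' ⊢
    have he : (G.deleteEdges {s(x, y)}).Adj p q := by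
      rw [deleteEdges_adj]
      refine ⟨hpq, ?_⟩
      rw [Set.mem_singleton_iff, Sym2.eq_iff]
      rintro (⟨rfl, rfl⟩ | ⟨rfl, rfl⟩)
      · exact hp'.1 hx
      · exact hy hp.2
    exact ⟨h'.adj _ _ he hp.1 hp'.1, h.adj _ _ he hp.2 hp'.2⟩
  · intro z
    simp only [Finset.mem_inter, Finset.mem_union]
    rintro ⟨⟨h1, h2⟩, h3 | h3⟩
    · exact ⟨h1, h3⟩
    · exact ⟨h1, hS z h2 h3⟩

/-- Disjoint paths on the two sides of a separation of order `k - 1` and an edge across it combine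
to disjoint paths. -/
theorem Linkage.glue {A B U W : Finset V} {x y : V} (hG : G' ≤ G) (h : Separates G' A B U W)
    (hxy : G.Adj x y) (hy : y ∉ U) (hx : x ∉ W) {P Q : V → Finset V} {s t : V → V}
    (hP : Linkage G' A (insert x (U ∩ W)) (insert x (U ∩ W)) P s id)
    (hQ : Linkage G' (insert y (U ∩ W)) B (insert y (U ∩ W)) Q id t) :
    ∃ P' s' t', Linkage G A B (insert x (U ∩ W)) P' s' t' := by
  have hPU : ∀ b ∈ insert x (U ∩ W), P b ⊆ U := by
    intro b hb
    refine (hP.path b hb).subset_of_closed (h.left (hP.left_mem hb)) ?_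
    intro p hp hpb hpU q hq
    refine h.adj p q hq hpU fun hpW => hpb ?_
    exact (hP.right b hb p hp).1 (by simp [hpU, hpW])
  have hQW : ∀ b ∈ insert y (U ∩ W), Q b ⊆ W := by
    intro b hb
    refine (hQ.path b hb).symm.subset_of_closed (h.right (hQ.right_mem hb)) ?_
    intro p hp hpb hpU q hq
    refine h.symm.adj p q hq hpU fun hpW => hpb ?_
    exact (hQ.left b hb p hp).1 (by simp [hpU, hpW])
  have hyx : y ≠ x := hxy.ne'
  obtain ⟨σ, hσ⟩ : ∃ σ : V → V, ∀ b, σ b = if b = x then y else b := ⟨_, fun _ => rfl⟩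
  have hσx : σ x = y := by simp [hσ]
  have hσne : ∀ b, b ≠ x → σ b = b := fun b hb => by simp [hσ, hb]
  have hσm : ∀ b ∈ insert x (U ∩ W), σ b ∈ insert y (U ∩ W) := by
    intro b hb
    by_cases hbx : b = x
    · simp [hbx, hσx]
    · rw [hσne b hbx]
      exact Finset.mem_insert_of_mem ((Finset.mem_insert.1 hb).resolve_left hbx)
  have hPQ : ∀ b ∈ insert x (U ∩ W), ∀ c ∈ insert x (U ∩ W), ∀ z ∈ P b, z ∈ Q (σ c) →
      z = b ∧ z = c ∧ z = σ c := by
    intro b hb c hc z hz hz'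
    have h1 : z ∈ U ∩ W := Finset.mem_inter.2 ⟨hPU b hb hz, hQW _ (hσm c hc) hz'⟩
    have h2 : z = b := (hP.right b hb z hz).1 (Finset.mem_insert_of_mem h1)
    have h3 : z = σ c := (hQ.left _ (hσm c hc) z hz').1 (Finset.mem_insert_of_mem h1)
    refine ⟨h2, ?_, h3⟩
    by_cases hcx : c = x
    · subst hcx
      rw [hσx] at h3
      subst h3
      exact absurd (Finset.mem_inter.1 h1).1 hy
    · rwa [hσne c hcx] at h3
  refine ⟨fun b => P b ∪ Q (σ b), s, fun b => t (σ b), ?_, ?_, ?_, ?_⟩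
  · intro b hb
    have p1 := (hP.path b hb).mono hG
    have p2 := (hQ.path _ (hσm b hb)).mono hG
    by_cases hbx : b = x
    · subst hbx
      simp only [id] at p1 p2
      refine p1.join p2 (by rwa [hσx]) (Finset.disjoint_left.2 fun z hz hz' => ?_)
      have := hPQ b hb b hb z hz hz'
      rw [hσx] at this
      exact hyx (this.2.2.symm.trans this.1)
    · simp only [id] at p1 p2
      refine p1.glue (b := b) ?_ fun z hz hz' => (hPQ b hb b hb z hz hz').1
      have e := hσne b hbx
      rw [e] at p2 ⊢
      exact p2
  · intro b hb z hz
    rcases Finset.mem_union.1 hz with hz | hz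
    · exact hP.left b hb z hz
    · have hside : z ∈ U → z ∈ P b := by
        intro hzU
        have h1 : z ∈ U ∩ W := Finset.mem_inter.2 ⟨hzU, hQW _ (hσm b hb) hz⟩
        have h3 : z = σ b := (hQ.left _ (hσm b hb) z hz).1 (Finset.mem_insert_of_mem h1)
        by_cases hbx : b = x
        · subst hbx
          rw [hσx] at h3
          exact absurd (h3 ▸ hzU) hy
        · rw [hσne b hbx] at h3
          rw [h3]
          exact (hP.path b hb).right_mem
      constructor
      · intro hzA
        exact (hP.left b hb z (hside (h.left hzA))).1 hzA
      · rintro rfl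
        exact hP.left_mem hb
  · intro b hb z hz
    rcases Finset.mem_union.1 hz with hz | hz
    · have hside : z ∈ W → z ∈ Q (σ b) := by
        intro hzW
        have h1 : z ∈ U ∩ W := Finset.mem_inter.2 ⟨hPU b hb hz, hzW⟩
        have h3 : z = b := (hP.right b hb z hz).1 (Finset.mem_insert_of_mem h1)
        have hbx : b ≠ x := by
          rintro rfl
          exact hx (h3 ▸ hzW)
        have := (hQ.path _ (hσm b hb)).left_mem
        rw [id, hσne b hbx] at this
        rwa [hσne b hbx, h3]
      constructor
      · intro hzB
        exact (hQ.right _ (hσm b hb) z (hside (h.right hzB))).1 hzB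
      · rintro rfl
        exact hQ.right_mem (hσm b hb)
    · exact hQ.right _ (hσm b hb) z hz
  · intro b hb c hc hbc
    have hne : σ b ≠ σ c := by
      intro he
      by_cases h1 : b = x
      · rw [h1, hσx, hσne c (fun h2 => hbc (h1.trans h2.symm))] at he
        rw [← he] at hc
        simp [hyx, hy] at hc
      · by_cases h2 : c = x
        · rw [h2, hσx, hσne b h1] at he
          rw [he] at hb
          simp [hyx, hy] at hb
        · rw [hσne b h1, hσne c h2] at he
          exact hbc he
    rw [Finset.disjoint_union_left, Finset.disjoint_union_right, Finset.disjoint_union_right]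
    refine ⟨⟨hP.disj b hb c hc hbc, ?_⟩, ?_, hQ.disj _ (hσm b hb) _ (hσm c hc) hne⟩
    · refine Finset.disjoint_left.2 fun z hz hz' => ?_
      have := hPQ b hb c hc z hz hz'
      exact hbc (this.1.symm.trans this.2.1)
    · refine Finset.disjoint_left.2 fun z hz' hz => ?_
      have := hPQ c hc b hb z hz hz'
      exact hbc (this.2.1.symm.trans this.1)

/-- Menger's theorem. -/
theorem exists_linkage [Fintype V] (G : SimpleGraph V) (A B : Finset V) (k : ℕ)
    (hk : ∀ U W, Separates G A B U W → k ≤ (U ∩ W).card) :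
    ∃ I P s t, I.card = k ∧ Linkage G A B I P s t := by
  induction G using WellFoundedLT.induction generalizing A B with
  | ind G ih =>
  by_cases hE : ∃ x y, G.Adj x y
  · obtain ⟨x, y, hxy⟩ := hE
    have hlt : G.deleteEdges {s(x, y)} < G := by
      refine lt_of_le_of_ne (deleteEdges_le _) fun he => ?_
      have : (G.deleteEdges {s(x, y)}).Adj x y := by rw [he]; exact hxy
      simp at this
    by_cases hsep : ∀ U W, Separates (G.deleteEdges {s(x, y)}) A B U W → k ≤ (U ∩ W).card
    · obtain ⟨I, P, s, t, hI, hL⟩ := ih _ hlt A B hsep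
      exact ⟨I, P, s, t, hI, fun i hi => (hL.path i hi).mono hlt.le, hL.left, hL.right, hL.disj⟩
    push Not at hsep
    obtain ⟨U, W, h, hUW⟩ := hsep
    obtain ⟨x, y, hxy, hlt, h, hxU, hxW, hyU⟩ : ∃ x y, G.Adj x y ∧
        G.deleteEdges {s(x, y)} < G ∧
        Separates (G.deleteEdges {s(x, y)}) A B U W ∧ x ∈ U ∧ x ∉ W ∧ y ∉ U := by
      by_contra! hcon
      refine absurd (hk U W ⟨h.left, h.right, h.mem, ?_⟩) (by omega)
      intro p q hpq hp hp'
      by_contra hq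
      by_cases he : s(p, q) = s(x, y)
      · exact hq (hcon p q hpq (he ▸ hlt) (he ▸ h) hp hp')
      · exact hq (h.adj p q (by simp only [deleteEdges_adj, Set.mem_singleton_iff]; exact ⟨hpq, he⟩) hp hp')
    have hyW : y ∈ W := (h.mem y).resolve_left hyU
    have hk1 : k ≤ (insert x (U ∩ W)).card := by
      have := hk U (insert x W) ⟨h.left, h.right.trans (Finset.subset_insert _ _), fun z => ?_, ?_⟩
      · rwa [Finset.inter_insert_of_mem hxU] at this
      · have := h.mem z
        rw [Finset.mem_insert]; tauto
      · intro p q hpq hp hp'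
        rw [Finset.mem_insert, not_or] at hp'
        refine h.adj p q ?_ hp hp'.2
        simp only [deleteEdges_adj, Set.mem_singleton_iff]
        refine ⟨hpq, ?_⟩
        rw [Sym2.eq_iff]
        rintro (⟨rfl, rfl⟩ | ⟨rfl, rfl⟩)
        · exact hp'.1 rfl
        · exact hyU hp
    have hxc : (insert x (U ∩ W)).card = (U ∩ W).card + 1 :=
      Finset.card_insert_of_notMem (by simp [hxW])
    have hyc : (insert y (U ∩ W)).card = (U ∩ W).card + 1 :=
      Finset.card_insert_of_notMem (by simp [hyU])
    obtain ⟨I, P, s, t, hI, hL⟩ := ih _ hlt A (insert x (U ∩ W))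
      (fun U' W' h' => h.le_of_deleteEdges hk hyU U' W' h')
    obtain ⟨P, s, hP⟩ := hL.reindex (by omega)
    have hsw : s(x, y) = s(y, x) := Sym2.eq_swap
    obtain ⟨I', Q, t', t, hI', hL'⟩ := ih _ hlt B (insert y (U ∩ W)) (by
      intro U' W' h'
      have hs := h.symm
      rw [hsw] at hs h'
      rw [Finset.inter_comm U W] at h'
      refine hs.le_of_deleteEdges (fun U W h => ?_) hxW U' W' h'
      rw [Finset.inter_comm]
      exact hk W U h.symm)
    obtain ⟨Q, t, hQ⟩ := hL'.reindex (by omega)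
    obtain ⟨P', s', t', hfin⟩ := Linkage.glue hlt.le h hxy hyU hxW hP hQ.symm
    exact ⟨_, P', s', t', by omega, hfin⟩
  · push Not at hE
    have h1 := hk A ((Finset.univ \ A) ∪ B) ⟨subset_rfl, Finset.subset_union_right, fun z => by
      by_cases hz : z ∈ A <;> simp [hz], fun x y h => absurd h (hE x y)⟩
    have h2 : A ∩ (Finset.univ \ A ∪ B) = A ∩ B := by
      ext z; simp only [Finset.mem_inter, Finset.mem_union, Finset.mem_sdiff, Finset.mem_univ]
      tauto
    rw [h2] at h1
    obtain ⟨I, hI, hIc⟩ := Finset.exists_subset_card_eq h1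
    refine ⟨I, fun i => {i}, id, id, hIc, ?_, ?_, ?_, ?_⟩
    · intro i _; exact PathOn.single _ _
    · intro i hi z hz
      rw [Finset.mem_singleton] at hz
      subst hz
      simp [(Finset.mem_inter.1 (hI hi)).1]
    · intro i hi z hz
      rw [Finset.mem_singleton] at hz
      subst hz
      simp [(Finset.mem_inter.1 (hI hi)).2]
    · intro i _ j _ hij
      simpa using hij

end Menger

section Restrict

variable {V : Type*} [DecidableEq V] {K G : SimpleGraph V} {B T S : Finset V} {a b : V} {h : ℕ}
  {u : ℤ → V}

/-- The edges of `K` with both ends in `B`. -/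
def restrict (K : SimpleGraph V) (B : Finset V) : SimpleGraph V where
  Adj x y := K.Adj x y ∧ x ∈ B ∧ y ∈ B
  symm := ⟨fun _ _ h => ⟨h.1.symm, h.2.2, h.2.1⟩⟩
  loopless := ⟨fun _ h => K.loopless.irrefl _ h.1⟩

theorem restrict_le (K : SimpleGraph V) (B : Finset V) : restrict K B ≤ K := fun _ _ h => h.1

theorem PathOn.subset_of_restrict (hT : PathOn (restrict K B) T a b) (ha : a ∈ B) : T ⊆ B :=
  hT.subset_of_closed ha fun _ _ _ _ _ h => h.2.2

theorem CircBound.mono {n : ℕ} (hGK : K ≤ G) (h : CircBound G n) : CircBound K n :=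
  fun S a b hS hab => h S a b (hS.mono hGK) (hGK hab)

theorem CyclicEnum.restrict (hu : CyclicEnum K h u) (hB : cycVerts h u ⊆ B) :
    CyclicEnum (restrict K B) h u where
  pos := hu.pos
  eq_iff := hu.eq_iff
  adj i hi := ⟨hu.adj i hi, hB (hu.apply_mem i), hB (hu.apply_mem _)⟩

theorem circBound_restrict (K : SimpleGraph V) (R : Finset V) :
    CircBound (restrict K R) R.card :=
  fun _ _ _ hS hab => Finset.card_le_card (hS.subset_of_restrict hab.2.2)

/-- Two vertices of a cycle are joined by an arc that has more than half of the vertices. -/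
theorem CyclicEnum.exists_long_arc (hu : CyclicEnum K h u) (ha : a ∈ cycVerts h u)
    (hb : b ∈ cycVerts h u) (hab : a ≠ b) {D : ℤ} (hD : 2 * D ≤ h + 4) :
    ∃ T, PathOn K T a b ∧ T ⊆ cycVerts h u ∧ D - 1 ≤ T.card := by
  obtain ⟨i, rfl⟩ := hu.mem_cycVerts.1 ha
  obtain ⟨j', rfl⟩ := hu.mem_cycVerts.1 hb
  obtain ⟨j, hj, hj', he⟩ := hu.exists_rep i j'
  have hij : i ≠ j := by rintro rfl; exact hab he
  have hsub : ∀ p q : ℤ, seg u p q ⊆ cycVerts h u := by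
    intro p q x hx
    rw [mem_seg] at hx
    obtain ⟨k, -, -, rfl⟩ := hx
    exact hu.apply_mem _
  have e : u (i + h) = u i := hu.add_period i
  have s1 := hu.sPath (i := i) (j := j) hj hj'
  have s2 := hu.sPath (i := j) (j := i + h) (by omega) (by omega)
  rw [e] at s2
  rw [← he]
  rcases le_total (D - 1) (j + 1 - i) with h1 | h1
  · exact ⟨_, s1.1, hsub _ _, by rw [s1.2]; exact h1⟩
  · exact ⟨_, s2.1.symm, hsub _ _, by rw [s2.2]; omega⟩

end Restrict

section Spread

open scoped Classical

variable {V : Type*} [DecidableEq V] [Fintype V] {K G : SimpleGraph V} {L : ℕ} {c : ℤ → V}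

/-- Vertices that any two long paths of a set off a longest cycle join, spread out on the cycle. -/
theorem mul_le_of_linked (hc : CyclicEnum G L c) (hb : CircBound G L) {l D : ℕ} (hl : 2 ≤ l)
    (hconn : ∀ S : Finset V, S.card < l → (G.induce ((↑S : Set V)ᶜ)).Connected)
    (A : Finset V) (hA : ∀ a ∈ A, ∀ k, c k ≠ a) (hlA : l ≤ A.card) (hlL : l ≤ L)
    (hLP : ∀ a ∈ A, ∀ b ∈ A, a ≠ b → ∃ T, PathOn G T a b ∧ T ⊆ A ∧ (D : ℤ) - 1 ≤ T.card) :
    l * D ≤ L := by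
  have hsepc : ∀ U W, Separates G A (cycVerts L c) U W → l ≤ (U ∩ W).card := by
    intro U W hUW
    by_contra! hlt
    obtain ⟨a, ha, haS⟩ := Finset.exists_mem_notMem_of_card_lt_card (hlt.trans_le hlA)
    obtain ⟨b, hbc, hbS⟩ := Finset.exists_mem_notMem_of_card_lt_card
      (hlt.trans_le (hlL.trans hc.card_cycVerts.ge))
    have hr := (hconn _ hlt).preconnected ⟨a, by simpa using haS⟩ ⟨b, by simpa using hbS⟩
    rw [reachable_iff_reflTransGen] at hr
    have key : ∀ z, Relation.ReflTransGen (G.induce ((↑(U ∩ W) : Set V)ᶜ)).Adj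
        ⟨a, by simpa using haS⟩ z → (z : V) ∈ U := by
      intro z hz
      induction hz with
      | refl => exact hUW.left ha
      | @tail y z _ hyz ih =>
        have h1 : (y : V) ∉ U ∩ W := fun h => y.2 (Finset.mem_coe.2 h)
        exact hUW.adj _ _ hyz ih fun h => h1 (Finset.mem_inter.2 ⟨ih, h⟩)
    exact hbS (Finset.mem_inter.2 ⟨key _ hr, hUW.right hbc⟩)
  obtain ⟨I, P, s, t, hI, hL⟩ := exists_linkage G A _ l hsepc
  have hgap : ∀ i j : ℤ, i < j → j < i + L → c i ∈ I.image t → c j ∈ I.image t →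
      (D : ℤ) ≤ j - i := by
    intro i j hij hji hi hj
    obtain ⟨p, hp, hpi⟩ := Finset.mem_image.1 hi
    obtain ⟨q, hq, hqj⟩ := Finset.mem_image.1 hj
    have hcij : c i ≠ c j := by
      intro he
      have := hc.injOn (a := i) le_rfl (by omega) hij.le hji he
      omega
    have hpq : p ≠ q := by
      rintro rfl
      exact hcij (hpi.symm.trans hqj)
    obtain ⟨T, hT, hTA, hTc⟩ := hLP _ (hL.left_mem hp) _ (hL.left_mem hq) (hL.left_ne hp hq hpq)
    have p1 := (hL.path p hp).symm.glue hT fun z hz hz' => (hL.left p hp z hz).1 (hTA hz')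
    have p2 := p1.glue (hL.path q hq) (fun z hz hz' => by
      rcases Finset.mem_union.1 hz with hz | hz
      · exact absurd hz' (Finset.disjoint_left.1 (hL.disj p hp q hq hpq) hz)
      · exact (hL.left q hq z hz').1 (hTA hz))
    rw [hpi, hqj] at p2
    have hcT : ∀ k, c k ∉ T := fun k hk => hA _ (hTA hk) k rfl
    have hon : ∀ k, c k ∈ P p ∪ T ∪ P q → c k = c i ∨ c k = c j := by
      intro k hk
      rw [Finset.mem_union, Finset.mem_union] at hk
      rcases hk with (hk | hk) | hk
      · left; rw [← hpi]; exact (hL.right p hp _ hk).1 (hc.apply_mem k)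
      · exact absurd hk (hcT k)
      · right; rw [← hqj]; exact (hL.right q hq _ hk).1 (hc.apply_mem k)
    have hbr := hc.bridge_of_mem hb p2 (fun k hk hk' hkm => by
      rcases hon k hkm with h | h
      · have := hc.injOn (a := i) (by omega) hk' le_rfl (by omega) h
        omega
      · have := hc.injOn (a := i) (by omega) hk' hij.le hji h
        omega) hij hji
    have hsub : insert (c i) (insert (c j) T) ⊆ P p ∪ T ∪ P q := by
      intro z hz
      simp only [Finset.mem_insert, Finset.mem_union] at hz ⊢
      rcases hz with rfl | rfl | hz
      · left; left; rw [← hpi]; exact (hL.path p hp).right_mem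
      · right; rw [← hqj]; exact (hL.path q hq).right_mem
      · left; right; exact hz
    have hcard := Finset.card_le_card hsub
    rw [Finset.card_insert_of_notMem (by simp [hcij, hcT]),
      Finset.card_insert_of_notMem (hcT j)] at hcard
    omega
  have hinj : Set.InjOn t I := fun i hi j hj hij => by
    by_contra hne
    exact hL.right_ne hi hj hne hij
  have hcI : (I.image t).card = l := by rw [Finset.card_image_of_injOn hinj, hI]
  have hsubC : I.image t ⊆ cycVerts L c := by
    intro z hz
    obtain ⟨i, hi, rfl⟩ := Finset.mem_image.1 hz
    exact hL.right_mem hi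
  have hDL : ∀ i : ℤ, c i ∈ I.image t → (D : ℤ) ≤ L := by
    intro i hi
    obtain ⟨z, hz, hne⟩ := Finset.exists_mem_ne (s := I.image t) (by omega) (c i)
    obtain ⟨j', rfl⟩ := hc.mem_cycVerts.1 (hsubC hz)
    obtain ⟨j, hj, hj', he⟩ := hc.exists_rep i j'
    rw [← he] at hz hne
    have hij : i ≠ j := by rintro rfl; exact hne rfl
    have := hgap i j (by omega) hj' hi hz
    omega
  obtain ⟨f, hf⟩ : ∃ f : ℤ → ℕ, ∀ k, f k = if c k ∈ I.image t then D else 0 := ⟨_, fun _ => rfl⟩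
  have hsum := sum_le_period (f := f) (L := L) (fun i => by rw [hf, hf, hc.add_period])
    (fun i j hij hji hi hj => by
      have hi' : c i ∈ I.image t := by
        by_contra h; rw [hf, if_neg h] at hi; omega
      have hj' : c j ∈ I.image t := by
        by_contra h; rw [hf, if_neg h] at hj; omega
      rw [hf, hf, if_pos hi', if_pos hj']
      rcases hji.lt_or_eq with h | h
      · have := hgap i j hij h hi' hj'
        push_cast; omega
      · have := hDL i hi'
        push_cast; omega) 0
  have hs2 := hc.sum_cycVerts (fun x => if x ∈ I.image t then D else 0) 0
  simp only [← hf] at hs2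
  rw [← hs2, Finset.sum_ite_mem, Finset.inter_eq_right.2 hsubC, Finset.sum_const, hcI] at hsum
  simpa using hsum

end Spread

section SecondBound

open scoped Classical

variable {V : Type*} [DecidableEq V] [Fintype V] {K G : SimpleGraph V} {L h : ℕ} {c u : ℤ → V}

/-- A long path between two vertices of a cycle that avoids prescribed vertices off the cycle. -/
theorem exists_long_path_subset {W W' Y : Finset V} {D : ℤ} (hu : CyclicEnum K h u)
    (hb : CircBound K h) (hW : ∀ s ∈ W, ∀ k, u k ≠ s) (hYS : Y ⊆ cycVerts h u)
    (hYn : ∀ y ∈ Y, ∀ z, K.Adj y z → z ∈ cycVerts h u ∨ z ∈ W) (hW' : W' ⊆ W)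
    (hdeg : ∀ y ∈ Y, D - 1 + (W.card - W'.card) ≤ (nbr K y).card)
    (h1 : 2 * ((h : ℤ) - Y.card) + 2 * W'.card + 1 ≤ h)
    (h2 : 0 < W'.card → 2 * ((h : ℤ) - Y.card) + 2 * W'.card + 1 ≤ D) {a b : V}
    (ha : a ∈ cycVerts h u) (hb' : b ∈ cycVerts h u) (hab : a ≠ b) :
    ∃ T, PathOn K T a b ∧ T ⊆ cycVerts h u ∪ W' ∧ D - 1 ≤ T.card := by
  obtain ⟨T, hT, hTc⟩ := exists_long_path (K := restrict K (cycVerts h u ∪ W')) (W := W') (D := D)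
    (hu.restrict Finset.subset_union_left) (hb.mono (restrict_le _ _))
    (fun s hs => hW s (hW' hs)) hYS (fun y _ z hz => by simpa using hz.2.2) (by
      intro y hy
      have hsub : nbr K y ⊆ nbr (restrict K (cycVerts h u ∪ W')) y ∪ (W \ W') := by
        intro z hz
        have hz' : K.Adj y z := by simpa using hz
        have := hYn y hy z hz'
        by_cases hz2 : z ∈ cycVerts h u ∪ W'
        · rw [Finset.mem_union, mem_nbr]
          exact Or.inl ⟨hz', Finset.mem_union_left _ (hYS hy), hz2⟩
        · rw [Finset.mem_union, not_or] at hz2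
          rw [Finset.mem_union, Finset.mem_sdiff]
          tauto
      have h3 := (Finset.card_le_card hsub).trans (Finset.card_union_le _ _)
      have h4 := Finset.card_sdiff_add_card_eq_card hW'
      have h5 := hdeg y hy
      omega) h1 h2 ha hb' hab
  exact ⟨T, hT.mono (restrict_le _ _), hT.subset_of_restrict (Finset.mem_union_left _ ha), hTc⟩

/-- If many vertices of a cycle have all their neighbours on it or in a small set `W`, then any two
vertices of the cycle or of `W` are joined by a long path. -/
theorem exists_long_path_union {W Y : Finset V} {D : ℤ} (hu : CyclicEnum K h u)
    (hb : CircBound K h) (hW : ∀ s ∈ W, ∀ k, u k ≠ s) (hYS : Y ⊆ cycVerts h u)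
    (hYn : ∀ y ∈ Y, ∀ z, K.Adj y z → z ∈ cycVerts h u ∨ z ∈ W)
    (hWn : ∀ s ∈ W, ∀ x, ∃ y ∈ cycVerts h u, y ≠ x ∧ K.Adj y s)
    (hdeg : ∀ y ∈ Y, D - 1 ≤ (nbr K y).card) (hDh : D ≤ h)
    (h1 : 2 * ((h : ℤ) - Y.card) + 2 * W.card + 1 ≤ D) {a b : V}
    (ha : a ∈ cycVerts h u ∪ W) (hb' : b ∈ cycVerts h u ∪ W) (hab : a ≠ b) :
    ∃ T, PathOn K T a b ∧ T ⊆ cycVerts h u ∪ W ∧ D - 1 ≤ T.card := by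
  have hWd : ∀ s ∈ W, s ∉ cycVerts h u := by
    intro s hs hs'
    obtain ⟨k, hk⟩ := hu.mem_cycVerts.1 hs'
    exact hW s hs k hk
  -- one end on the cycle
  have step : ∀ b ∈ cycVerts h u, ∀ W' ⊆ W, ∀ (D' : ℤ), D' + (W.card - W'.card) = D → ∀ a,
      a ∈ cycVerts h u → a ≠ b → ∃ T, PathOn K T a b ∧ T ⊆ cycVerts h u ∪ W' ∧ D' - 1 ≤ T.card := by
    intro b hb2 W' hW' D' hD' a ha hab
    have hc := Finset.card_le_card hW'
    exact exists_long_path_subset hu hb hW hYS hYn hW' (fun y hy => by have := hdeg y hy; omega)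
      (by omega) (fun _ => by omega) ha hb2 hab
  have extend : ∀ {s x y : V} {T W' : Finset V}, s ∉ T → PathOn K T x y → K.Adj x s →
      PathOn K ({s} ∪ T) s y ∧ ({s} ∪ T).card = T.card + 1 := by
    intro s x y T W' hs hT hxs
    exact ⟨(PathOn.single K s).join hT hxs.symm (by simpa using hs),
      by rw [Finset.card_union_of_disjoint (by simpa using hs)]; simp; omega⟩
  have mixed : ∀ s ∈ W, ∀ W' ⊆ W, s ∉ W' → ∀ (D' : ℤ), D' + (W.card - W'.card) = D → ∀ b,
      b ∈ cycVerts h u → ∃ T, PathOn K T s b ∧ T ⊆ {s} ∪ (cycVerts h u ∪ W') ∧ D' ≤ T.card := by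
    intro s hs W' hW' hsW' D' hD' b hb2
    obtain ⟨x, hx, hxb, hxs⟩ := hWn s hs b
    obtain ⟨T, hT, hTs, hTc⟩ := step b hb2 W' hW' D' hD' x hx hxb
    have hsT : s ∉ T := fun h => by
      rcases Finset.mem_union.1 (hTs h) with h | h
      · exact hWd s hs h
      · exact hsW' h
    obtain ⟨p, pc⟩ := extend (W' := W') hsT hT hxs
    exact ⟨_, p, Finset.union_subset_union_right hTs, by rw [pc]; push_cast; omega⟩
  have mixed' : ∀ s ∈ W, ∀ b ∈ cycVerts h u,
      ∃ T, PathOn K T s b ∧ T ⊆ cycVerts h u ∪ W ∧ D - 1 ≤ T.card := by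
    intro s hs b hb2
    obtain ⟨T, hT, hTs, hTc⟩ := mixed s hs (W.erase s) (Finset.erase_subset _ _) (by simp) (D - 1)
      (by
        have := Finset.card_pos.2 ⟨s, hs⟩
        rw [Finset.card_erase_of_mem hs]
        omega) b hb2
    refine ⟨T, hT, hTs.trans ?_, hTc⟩
    intro z hz
    simp only [Finset.mem_union, Finset.mem_singleton, Finset.mem_erase] at hz ⊢
    rcases hz with rfl | hz | hz
    · exact Or.inr hs
    · exact Or.inl hz
    · exact Or.inr hz.2
  rcases Finset.mem_union.1 ha with ha | ha <;> rcases Finset.mem_union.1 hb' with hb' | hb'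
  · obtain ⟨T, hT⟩ := step b hb' W subset_rfl D (by omega) a ha hab
    exact ⟨T, hT⟩
  · obtain ⟨T, hT, hT'⟩ := mixed' b hb' a ha
    exact ⟨T, hT.symm, hT'⟩
  · exact mixed' a ha b hb'
  · obtain ⟨y, hy, -, hyb⟩ := hWn b hb' b
    have hbe : b ∈ W.erase a := Finset.mem_erase.2 ⟨hab.symm, hb'⟩
    obtain ⟨T, hT, hTs, hTc⟩ := mixed a ha ((W.erase a).erase b)
      ((Finset.erase_subset _ _).trans (Finset.erase_subset _ _)) (by simp) (D - 2) (by
        have := Finset.card_pos.2 ⟨b, hbe⟩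
        rw [Finset.card_erase_of_mem ha] at this
        rw [Finset.card_erase_of_mem hbe, Finset.card_erase_of_mem ha]
        omega) y hy
    have hbT : b ∉ T := fun h => by
      have := hTs h
      simp only [Finset.mem_union, Finset.mem_singleton, Finset.mem_erase] at this
      have := hWd b hb'
      tauto
    obtain ⟨p, pc⟩ := extend (W' := ∅) hbT hT.symm hyb
    refine ⟨_, p.symm, ?_, by rw [pc]; push_cast; omega⟩
    intro z hz
    have hz' : z = b ∨ z ∈ T := by simpa using hz
    rcases hz' with rfl | hz'
    · exact Finset.mem_union_right _ hb'
    · have := hTs hz'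
      simp only [Finset.mem_union, Finset.mem_singleton, Finset.mem_erase] at this ⊢
      rcases this with rfl | h | h
      · exact Or.inr ha
      · exact Or.inl h
      · exact Or.inr h.2.2

theorem CyclicEnum.le_of_circBound (hu : CyclicEnum K h u) (hh : 2 ≤ h) (hKG : K ≤ G)
    (hb : CircBound G L) : h ≤ L := by
  have hs := hu.sPath (i := 0) (j := h - 1) (by omega) (by omega)
  have e : u (h - 1 + 1) = u 0 := by
    have := hu.add_period 0
    rw [← this]; congr 1; ring
  have ha := hu.adj_succ hh (h - 1)
  rw [e] at ha
  have h1 := hb _ _ _ (hs.1.mono hKG) (hKG ha)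
  have h2 := hs.2
  omega

/-- A cycle off a longest cycle of a highly connected graph forces the latter to be long. -/
theorem mul_le_of_connected (hKG : K ≤ G) (hc : CyclicEnum G L c) (hb : CircBound G L)
    (hu : CyclicEnum K h u) (hbK : CircBound K h) (hK : ∀ x y, K.Adj x y → ∀ k, c k ≠ y)
    (hH : ∀ i k, c k ≠ u i) {l D : ℕ} (hl : 2 ≤ l) (hlD : l ≤ D) (hDh : D ≤ h)
    (hconn : ∀ S : Finset V, S.card < l → (G.induce ((↑S : Set V)ᶜ)).Connected)
    (hd : ∀ x, (∀ k, c k ≠ x) → l + D ≤ (nbr K x).card +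
      ((Finset.Ico (0 : ℤ) L).filter fun k => G.Adj (c k) x).card + 2) :
    l * D ≤ L := by
  have hhL : h ≤ L := hu.le_of_circBound (by omega) hKG hb
  have hHoff : ∀ a ∈ cycVerts h u, ∀ k, c k ≠ a := by
    intro a ha k
    obtain ⟨i, rfl⟩ := hu.mem_cycVerts.1 ha
    exact hH i k
  by_cases hbig : 2 * D ≤ h + 4
  · refine mul_le_of_linked hc hb hl hconn (cycVerts h u) hHoff (by rw [hu.card_cycVerts]; omega)
      (by omega) fun a ha b hb' hab => ?_
    obtain ⟨T, h1, h2⟩ := hu.exists_long_arc ha hb' hab (D := D) (by exact_mod_cast hbig)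
    exact ⟨T, h1.mono hKG, h2⟩
  obtain ⟨Bad, hBad⟩ : ∃ B : V → Prop, ∀ x, B x ↔ D - 1 ≤ (nbr K x).card := ⟨_, fun _ => Iff.rfl⟩
  by_cases hex : ∃ t x, MaxTails K (cycVerts h u) Bad t ∧ x ∈ cycVerts h u ∧ t x ≠ [] ∧
      Bad (tailEnd t x)
  · obtain ⟨R, Y, p, q, h1, h2, h3, h4, h5, h6⟩ := exists_cycle_of_nontrivial hu hbK (k := D - 1)
      (by omega) (fun x hx => (hBad x).1 hx) hex
    have hRh := hbK _ _ _ h1 h2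
    have hRoff : ∀ a ∈ R, ∀ k, c k ≠ a := by
      have := h1.subset_of_closed (U := Finset.univ.filter fun x => ∀ k, c k ≠ x)
        (by simpa using hK _ _ h2) (fun p _ _ _ q hq => by simpa using hK _ _ hq)
      intro a ha
      simpa using this ha
    obtain ⟨w, hw, hcw⟩ : ∃ w, CyclicEnum K R.card w ∧ cycVerts R.card w = R := by
      obtain ⟨l, k1, k2, k3, k4, rfl⟩ := h1
      obtain ⟨w, hw, -, hw2⟩ := exists_cyclicEnum_of_list k1 k2 k3 k4 (Or.inl h2)
      rw [← List.toFinset_card_of_nodup k1] at hw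
      refine ⟨w, hw, ?_⟩
      ext x
      rw [hw.mem_cycVerts, List.mem_toFinset, hw2]
    refine mul_le_of_linked hc hb hl hconn R hRoff (by omega) (by omega) fun a ha b hb' hab => ?_
    have hwr := hw.restrict hcw.subset
    obtain ⟨T, hT, hTc⟩ := exists_long_path (W := ∅) (Y := Y) (D := D) hwr (circBound_restrict K R)
      (by simp) (by rwa [hcw]) (fun y _ z hz => by rw [hcw]; exact Or.inl hz.2.2) (by
        intro y hy
        have : nbr (restrict K R) y = nbr K y := by
          ext z
          rw [mem_nbr, mem_nbr]
          exact ⟨fun h => h.1, fun h => ⟨h, h4 hy, (h6 y hy).2 (by simpa using h)⟩⟩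
        rw [this]
        have := (h6 y hy).1
        omega) (by simp; omega) (by simp) (by rwa [hcw]) (by rwa [hcw]) hab
    exact ⟨T, (hT.mono (restrict_le _ _)).mono hKG, hT.subset_of_restrict ha, hTc⟩
  obtain ⟨t, Y, W, ht, hYS, hWS, hY, ho, hW, hcard⟩ := exists_heads_of_trivial _ _ _ hex
  set J := (cycVerts h u).filter fun x => ¬ Bad (tailEnd t x) with hJ
  have hJc : ((cycVerts h u).filter fun x => Bad (tailEnd t x)).card + J.card = h := by
    rw [hJ, Finset.card_filter_add_card_filter_not, hu.card_cycVerts]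
  by_cases hg : D ≤ 2 * J.card
  · rw [mul_comm]
    have hend : ∀ x ∈ cycVerts h u, ∀ k, c k ≠ tailEnd t x := by
      intro x hx k hk
      rcases hl : t x with _ | ⟨z, l⟩
      · exact hHoff x hx k (by rw [hk]; simp [tailEnd, hl])
      · have hm : tailEnd t x ∈ t x := by
          rw [tailEnd, List.getLast_cons (by simp [hl])]
          exact List.getLast_mem _
        obtain ⟨y, hy⟩ := exists_adj_of_mem_tail (ht.chain x) hm
        exact hK _ _ hy k hk
    refine capacity hKG hc hb hu ht hK hH (Finset.filter_subset _ _) (J := J) ?_ hg (by omega)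
    intro x hx
    rw [hJ, Finset.mem_filter] at hx
    have h1 := hd _ (hend x hx.1)
    have h2 := hx.2
    rw [hBad, not_le] at h2
    omega
  have hWoff : ∀ s ∈ W, ∀ k, c k ≠ s := by
    intro s hs
    obtain ⟨y, -, hy⟩ := hW s hs
    exact hK _ _ hy
  refine mul_le_of_linked hc hb hl hconn (cycVerts h u ∪ W) ?_ ?_ (by omega)
    fun a ha b hb' hab => ?_
  · intro a ha
    rcases Finset.mem_union.1 ha with ha | ha
    · exact hHoff a ha
    · exact hWoff a ha
  · have := Finset.card_le_card (Finset.subset_union_left (s₁ := cycVerts h u) (s₂ := W))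
    rw [hu.card_cycVerts] at this
    omega
  · obtain ⟨T, h1, h2⟩ := exists_long_path_union (W := W) (Y := Y) (D := D) hu hbK
      (fun s hs k hk => Finset.disjoint_left.1 hWS hs (hk ▸ hu.apply_mem k)) hYS
      (fun y hy => (hY y hy).2) (by
        intro s hs x
        obtain ⟨y, hy, hys⟩ := hW s hs
        obtain ⟨o, -, ho⟩ := ho y hy
        obtain ⟨o1, o2, o3⟩ := ho s hs
        by_cases hyx : y = x
        · exact ⟨o s, o1, hyx ▸ o2, o3⟩
        · exact ⟨y, hYS hy, hyx, hys⟩)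
      (fun y hy => by have := (hBad y).1 (hY y hy).1; omega) (by exact_mod_cast hDh) (by omega)
      ha hb' hab
    exact ⟨T, h1.mono hKG, h2⟩

end SecondBound

section Translation

variable {V : Type*} [DecidableEq V] {G : SimpleGraph V}

theorem exists_cyclicEnum_of_isCycle {v : V} (C : G.Walk v v) (hC : C.IsCycle) :
    ∃ c, CyclicEnum G C.length c ∧ ∀ x, x ∈ C.support ↔ ∃ i, c i = x := by
  cases C with
  | nil => exact absurd hC (by simp)
  | @cons _ w _ hvw p =>
    have hnd : p.support.Nodup := by simpa using hC.support_nodup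
    obtain ⟨c, hc, -, hmem⟩ := exists_cyclicEnum_of_list hnd p.isChain_adj_support (a := w) (b := v)
      (by rw [List.head?_eq_some_head p.support_ne_nil, p.head_support])
      (by rw [List.getLast?_eq_some_getLast p.support_ne_nil, p.getLast_support]) (Or.inl hvw)
    refine ⟨c, by simpa using hc, fun x => ?_⟩
    rw [← hmem, Walk.support_cons, List.mem_cons, or_iff_right_iff_imp]
    rintro rfl
    exact p.end_mem_support

theorem circBound_of_isCycle {n : ℕ} (h : ∀ (v : V) (p : G.Walk v v), p.IsCycle → p.length ≤ n)
    (h2 : ∀ x y, G.Adj x y → 2 ≤ n) : CircBound G n := by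
  intro S a b hS hab
  by_cases h3 : 3 ≤ S.card
  · obtain ⟨v, p, hp, hpl⟩ := hS.exists_isCycle hab h3
    exact hpl ▸ h v p hp
  · have := h2 _ _ hab
    omega

/-- A graph with a vertex has a cycle enumeration of length `cbar`, and no longer cycle. -/
theorem exists_cyclicEnum_cbar {W : Type*} [Fintype W] [DecidableEq W] [Nonempty W]
    (H : SimpleGraph W) : ∃ u, CyclicEnum H (cbar H) u ∧ CircBound H (cbar H) := by
  have hbdd : BddAbove {n : ℕ | (n = 1 ∧ Nonempty W) ∨ (n = 2 ∧ ∃ u v : W, H.Adj u v) ∨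
      ∃ (v : W) (c : H.Walk v v), c.IsCycle ∧ c.length = n} := by
    refine ⟨Fintype.card W + 2, ?_⟩
    rintro n (⟨rfl, -⟩ | ⟨rfl, -⟩ | ⟨v, c, hc, rfl⟩)
    · omega
    · omega
    · have := hc.support_nodup.length_le_card
      simp at this
      omega
  have hmem := Nat.sSup_mem ⟨1, Or.inl ⟨rfl, inferInstance⟩⟩ hbdd
  change cbar H ∈ _ at hmem
  have hle : ∀ n, _ → n ≤ cbar H := fun n hn => le_csSup hbdd hn
  refine (exists_and_right (b := CircBound H (cbar H))).2 ⟨?_, circBound_of_isCycle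
    (fun v p hp => hle _ (Or.inr (Or.inr ⟨v, p, hp, rfl⟩)))
    fun x y h => hle _ (Or.inr (Or.inl ⟨rfl, x, y, h⟩))⟩
  rcases hmem with ⟨h1, ⟨x⟩⟩ | ⟨h2, x, y, hxy⟩ | ⟨v, c, hc, hcl⟩
  · obtain ⟨u, hu, -⟩ := exists_cyclicEnum_of_list (G := H) (l := [x]) (a := x) (b := x)
      (by simp) (by simp) rfl rfl (Or.inr rfl)
    exact ⟨u, by rw [h1]; exact hu⟩
  · obtain ⟨u, hu, -⟩ := exists_cyclicEnum_of_list (G := H) (l := [x, y]) (a := x) (b := y)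
      (by simpa using hxy.ne) (by simpa using hxy) rfl rfl (Or.inl hxy.symm)
    exact ⟨u, by rw [h2]; exact hu⟩
  · obtain ⟨u, hu, -⟩ := exists_cyclicEnum_of_isCycle c hc
    exact ⟨u, hcl ▸ hu⟩

theorem PathOn.comap {K : SimpleGraph V} {s : Set V} {S : Finset V} {a b : V}
    (hK : ∀ x y, K.Adj x y → G.Adj x y ∧ x ∈ s ∧ y ∈ s) (h : PathOn K S a b) (hab : K.Adj b a) :
    ∃ S' a' b', PathOn (G.induce s) S' a' b' ∧ (G.induce s).Adj b' a' ∧ S'.card = S.card := by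
  obtain ⟨l, h1, h2, h3, h4, rfl⟩ := h
  have hls : ∀ x ∈ l, x ∈ s := by
    have ha : a ∈ s := (hK _ _ hab).2.2
    clear h1 h4 hab
    induction l generalizing a with
    | nil => simp
    | cons x l ih =>
      simp only [List.head?_cons, Option.some.injEq] at h3
      subst h3
      intro z hz
      rcases List.mem_cons.1 hz with rfl | hz
      · exact ha
      · cases l with
        | nil => simp at hz
        | cons y l =>
          rw [List.isChain_cons_cons] at h2
          exact ih h2.2 rfl (hK _ _ h2.1).2.2 z hz
  lift l to List s using hls
  have h1' : l.Nodup := h1.of_map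
  have h2' : l.IsChain (G.induce s).Adj := by
    rw [List.isChain_map] at h2
    exact h2.imp fun x y h => (hK _ _ h).1
  rw [List.head?_map, Option.map_eq_some_iff] at h3
  rw [List.getLast?_map, Option.map_eq_some_iff] at h4
  obtain ⟨a', h3, rfl⟩ := h3
  obtain ⟨b', h4, rfl⟩ := h4
  refine ⟨l.toFinset, a', b', PathOn.of_list h1' h2' h3 h4, (hK _ _ hab).1, ?_⟩
  rw [List.toFinset_card_of_nodup h1', List.toFinset_card_of_nodup h1, List.length_map]

end Translation

section Degrees

open scoped Classical

variable {V : Type*} [DecidableEq V] [Fintype V] {G K : SimpleGraph V} {L : ℕ} {c : ℤ → V}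

theorem card_le_card_nbr_add (hc : CyclicEnum G L c)
    (hK : ∀ x y, (∀ k, c k ≠ x) → (∀ k, c k ≠ y) → G.Adj x y → K.Adj x y) {x : V}
    (hx : ∀ k, c k ≠ x) (S : Finset V) (hS : ∀ y ∈ S, G.Adj x y) :
    S.card ≤ (nbr K x).card + ((Finset.Ico (0 : ℤ) L).filter fun k => G.Adj (c k) x).card := by
  have hsub : S ⊆ nbr K x ∪ ((Finset.Ico (0 : ℤ) L).filter fun k => G.Adj (c k) x).image c := by
    intro y hy
    rw [Finset.mem_union, mem_nbr]
    by_cases h : ∀ k, c k ≠ y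
    · exact Or.inl (hK x y hx h (hS y hy))
    · push Not at h
      obtain ⟨k, rfl⟩ := h
      obtain ⟨j, h1, h2, h3⟩ := hc.exists_rep 0 k
      right
      rw [Finset.mem_image]
      refine ⟨j, ?_, h3⟩
      rw [Finset.mem_filter, Finset.mem_Ico, h3]
      exact ⟨⟨h1, by omega⟩, (hS _ hy).symm⟩
  refine (Finset.card_le_card hsub).trans ((Finset.card_union_le _ _).trans ?_)
  gcongr
  exact Finset.card_image_le

theorem mul_le_of_min_le {h l d : ℕ} {u : ℤ → V} (hKG : K ≤ G) (hc : CyclicEnum G L c)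
    (hb : CircBound G L) (hL : 2 ≤ L) (hu : CyclicEnum K h u) (hbK : CircBound K h)
    (hK : ∀ x y, K.Adj x y → ∀ k, c k ≠ y) (hH : ∀ i k, c k ≠ u i) (hl : 1 ≤ l)
    (hconn : ∀ S : Finset V, S.card < l → (G.induce ((↑S : Set V)ᶜ)).Connected)
    (hd : ∀ x, (∀ k, c k ≠ x) → d ≤ (nbr K x).card +
      ((Finset.Ico (0 : ℤ) L).filter fun k => G.Adj (c k) x).card)
    (hmin : min ((l : ℤ) - 1) ((d : ℤ) - l + 1) ≤ h) : (l : ℤ) * ((d : ℤ) - l + 2) ≤ L := by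
  by_cases hmax : (h : ℤ) ≤ max ((l : ℤ) - 1) ((d : ℤ) - l + 1)
  · have h1 := mul_le_of_cyclicEnum hKG hc hb hu hbK hK hH hd
    have h2 : ((h : ℤ) + 1) * ((d : ℤ) + 1 - h) ≤ L := by
      have h3 : ((h : ℤ) + 1) * ((d + 1 - h : ℕ) : ℤ) ≤ L := by exact_mod_cast h1
      refine le_trans ?_ h3
      gcongr
      omega
    have h3 : 0 ≤ ((h : ℤ) + 1 - l) * ((d : ℤ) - l + 1 - h) := by
      rcases le_total ((l : ℤ) - 1) ((d : ℤ) - l + 1) with hc | hc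
      · rw [min_eq_left hc] at hmin
        rw [max_eq_right hc] at hmax
        exact mul_nonneg (by omega) (by omega)
      · rw [min_eq_right hc] at hmin
        rw [max_eq_left hc] at hmax
        exact mul_nonneg_of_nonpos_of_nonpos (by omega) (by omega)
    nlinarith
  obtain ⟨h1, h2⟩ := max_lt_iff.1 (not_le.1 hmax)
  obtain ⟨m, hm, hml, hmd, hor⟩ : ∃ m : ℕ, 1 ≤ m ∧ m ≤ l ∧ 2 * m ≤ d + 2 ∧
      (m = l ∨ d + 2 ≤ m + l) := by
    rcases le_total (2 * l) (d + 2) with h | h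
    · exact ⟨l, hl, le_rfl, h, Or.inl rfl⟩
    · exact ⟨(d + 2) / 2, by omega, by omega, by omega, by omega⟩
  have hprod : (l : ℤ) * (d - l + 2) ≤ m * (d - m + 2) := by
    rcases hor with rfl | hor
    · exact le_rfl
    · have h3 : 0 ≤ ((l : ℤ) - m) * (m + l - d - 2) := mul_nonneg (by omega) (by omega)
      nlinarith
  refine hprod.trans ?_
  obtain ⟨D, hD⟩ : ∃ D : ℕ, m + D = d + 2 := ⟨d + 2 - m, by omega⟩
  have hDe : (d : ℤ) - m + 2 = D := by omega
  have hDh : D ≤ h ∨ D ≤ 2 := by omega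
  rw [hDe]
  rcases hm.eq_or_lt with rfl | hm2
  · rcases le_or_gt D 2 with h3 | h3
    · push_cast; omega
    · have := hu.le_of_circBound (by omega) hKG hb
      push_cast; omega
  · exact_mod_cast mul_le_of_connected hKG hc hb hu hbK hK hH hm2 (by omega) (by omega)
      (fun S hS => hconn S (by omega)) (fun x hx => by have := hd x hx; omega)

end Degrees

end LongCycle

/-- Theorem 4: if `G` is `l`-connected and a longest cycle `C` satisfies
`c̄ ≥ min (l-1) (δ-l+1)`, then `|C| ≥ l(δ-l+2)`. -/
theorem stmt_3 {V : Type*} [Fintype V] [DecidableEq V] (G : SimpleGraph V)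
    [DecidableRel G.Adj] (l : ℕ) (hl : 1 ≤ l) (hconn : IsKConnected G l)
    {v : V} (C : G.Walk v v) (hC : IsLongestCycle G C)
    (hcbar : (cbar (G.induce {x : V | x ∉ C.support}) : ℤ) ≥
      min ((l : ℤ) - 1) ((G.minDegree : ℤ) - (l : ℤ) + 1)) :
    (C.length : ℤ) ≥ (l : ℤ) * ((G.minDegree : ℤ) - (l : ℤ) + 2) := by
  have hL3 : 3 ≤ C.length := hC.1.three_le_length
  obtain ⟨c, hc, hcC⟩ := LongCycle.exists_cyclicEnum_of_isCycle C hC.1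
  have hb : LongCycle.CircBound G C.length :=
    LongCycle.circBound_of_isCycle hC.2 fun _ _ _ => by omega
  have hoff : ∀ x, x ∉ C.support ↔ ∀ k, c k ≠ x := fun x => by rw [hcC]; push Not; rfl
  have : Nonempty V := ⟨v⟩
  by_cases hne : Nonempty {x : V | x ∉ C.support}
  · let K : SimpleGraph V :=
      { Adj := fun x y => G.Adj x y ∧ x ∉ C.support ∧ y ∉ C.support
        symm := ⟨fun _ _ h => ⟨h.1.symm, h.2.2, h.2.1⟩⟩
        loopless := ⟨fun _ h => G.loopless.irrefl _ h.1⟩ }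
    obtain ⟨u, hu, hbu⟩ := LongCycle.exists_cyclicEnum_cbar (G.induce {x : V | x ∉ C.support})
    refine LongCycle.mul_le_of_min_le (K := K) (u := fun i => (u i : V)) (fun _ _ h => h.1) hc hb
      (by omega) ⟨hu.pos, fun i j => ?_, fun i hi => ?_⟩ ?_
      (fun x y h => (hoff y).1 h.2.2) (fun i => (hoff _).1 (u i).2) hl hconn.2 (fun x hx => ?_) hcbar
    · rw [← hu.eq_iff, Subtype.coe_inj]
    · exact ⟨hu.adj i fun h => hi (congrArg _ h), (u i).2, (u (i + 1)).2⟩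
    · intro S a b hS hab
      obtain ⟨S', a', b', h1, h2, h3⟩ := hS.comap (G := G) (s := {x : V | x ∉ C.support})
        (fun x y h => h) hab
      exact h3 ▸ hbu S' a' b' h1 h2
    · refine (G.minDegree_le_degree x).trans ?_
      exact LongCycle.card_le_card_nbr_add (K := K) hc
        (fun x y hx hy h => ⟨h, (hoff x).2 hx, (hoff y).2 hy⟩) hx (G.neighborFinset x)
        (fun y hy => by simpa using hy)
  · have hcb : cbar (G.induce {x : V | x ∉ C.support}) = 0 := by
      have hE : {n : ℕ | (n = 1 ∧ Nonempty {x : V | x ∉ C.support}) ∨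
          (n = 2 ∧ ∃ u v, (G.induce {x : V | x ∉ C.support}).Adj u v) ∨
          ∃ (v : _) (c : (G.induce {x : V | x ∉ C.support}).Walk v v),
            c.IsCycle ∧ c.length = n} = ∅ := by
        rw [Set.eq_empty_iff_forall_notMem]
        rintro n (⟨-, h⟩ | ⟨-, x, -⟩ | ⟨x, -⟩)
        · exact hne h
        · exact hne ⟨x⟩
        · exact hne ⟨x⟩
      rw [cbar, hE, csSup_empty]
      rfl
    have hall : ∀ x, x ∈ C.support := fun x => by
      by_contra hx
      exact hne ⟨x, hx⟩
    have hcard : Fintype.card V = C.length := by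
      rw [← hc.card_cycVerts, ← Finset.card_univ]
      congr 1
      ext x
      simpa [hc.mem_cycVerts] using (hcC x).1 (hall x)
    have hdeg := G.minDegree_lt_card
    have hlV := hconn.1
    rw [hcb, ge_iff_le, min_le_iff] at hcbar
    rcases hcbar with h | h
    · obtain rfl : l = 1 := by push_cast at h; omega
      push_cast
      omega
    · push_cast at h
      nlinarith
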